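/- arXiv:1512.08130 — 2 statements merged into one kernel-verified Lean document; each statement's English description precedes it below -/
import Mathlib

section
/- Every finite simple graph G with at least one edge such that θ(G) ≥ 10 and 2·ω(G) ≤ θ(G) admits a proper vertex coloring with ⌊θ(G)/2⌋ colors. -/
open SimpleGraph Finset

/-- The Ore-degree of `G`: the maximum of `d_G(x) + d_G(y)` over all edges `xy` of `G`
(and `0` if `G` has no edges). -/
def oreDeg {V : Type*} [Fintype V] (G : SimpleGraph V) [DecidableRel G.Adj] : ℕ :=
  Finset.univ.sup fun p : V × V =>
    if G.Adj p.1 p.2 then G.degree p.1 + G.degree p.2 else 0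

set_option linter.unusedSectionVars false


namespace OreBrooks

variable {V : Type*} [Fintype V] [DecidableEq V] (G : SimpleGraph V) [DecidableRel G.Adj]

/-- neighbours of `v` in `S` -/
def nb (v : V) (S : Finset V) : Finset V := S.filter (fun u => G.Adj v u)

/-- `c` is a proper coloring of `G[D]` with colors `< d` -/
def PC (c : V → ℕ) (D : Finset V) (d : ℕ) : Prop :=
  (∀ v ∈ D, c v < d) ∧ ∀ u ∈ D, ∀ v ∈ D, G.Adj u v → c u ≠ c v

def Col (D : Finset V) (d : ℕ) : Prop := ∃ c, PC G c D d

@[simp] lemma mem_nb {v u : V} {S : Finset V} : u ∈ nb G v S ↔ u ∈ S ∧ G.Adj v u := by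
  simp [nb]

variable {G}

lemma nb_mono {v : V} {S T : Finset V} (h : S ⊆ T) : nb G v S ⊆ nb G v T := by
  intro u; simp only [mem_nb]; exact fun ⟨a, b⟩ => ⟨h a, b⟩

lemma PC.mono {c : V → ℕ} {S T : Finset V} {d : ℕ} (h : PC G c T d) (hs : S ⊆ T) : PC G c S d :=
  ⟨fun v hv => h.1 v (hs hv), fun u hu v hv => h.2 u (hs hu) v (hs hv)⟩

lemma Col.mono {S T : Finset V} {d : ℕ} (h : Col G T d) (hs : S ⊆ T) : Col G S d := by
  obtain ⟨c, hc⟩ := h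
  exact ⟨c, hc.mono hs⟩

/-- extend a coloring to one more vertex with a given color -/
lemma PC.extend {c : V → ℕ} {D : Finset V} {d : ℕ} (h : PC G c D d) {v : V} (hv : v ∉ D)
    {x : ℕ} (hx : x < d) (hfree : ∀ u ∈ D, G.Adj v u → c u ≠ x) :
    PC G (Function.update c v x) (insert v D) d := by
  have key : ∀ u ∈ D, Function.update c v x u = c u := by
    intro u hu
    have : u ≠ v := by rintro rfl; exact hv hu
    simp [this]
  constructor
  · intro u hu
    rcases Finset.mem_insert.1 hu with rfl | hu
    · simpa
    · rw [key u hu]; exact h.1 u hu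
  · intro u hu w hw hadj
    rcases Finset.mem_insert.1 hu with hu' | hu'
    · rcases Finset.mem_insert.1 hw with hw' | hw'
      · subst hu' hw'; exact absurd hadj (G.loopless.irrefl _)
      · subst hu'; rw [key w hw']; simpa using (hfree w hw' hadj).symm
    · rcases Finset.mem_insert.1 hw with hw' | hw'
      · subst hw'; rw [key u hu']; simpa using (hfree u hu' hadj.symm)
      · rw [key u hu', key w hw']; exact h.2 u hu' w hw' hadj

lemma exists_free {I : Finset ℕ} {d : ℕ} (h : #I < d) : ∃ x < d, x ∉ I := by
  by_contra hcon
  push Not at hcon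
  have : Finset.range d ⊆ I := fun x hx => hcon x (by simpa using hx)
  have := Finset.card_le_card this
  simp at this
  omega

/-- greedy extension at one vertex -/
lemma PC.greedy {c : V → ℕ} {D : Finset V} {d : ℕ} (h : PC G c D d) {v : V} (hv : v ∉ D)
    (hfree : #((nb G v D).image c) < d) :
    ∃ c', PC G c' (insert v D) d ∧ ∀ u ∈ D, c' u = c u := by
  obtain ⟨x, hx, hx'⟩ := exists_free hfree
  refine ⟨_, h.extend hv hx ?_, ?_⟩
  · intro u hu hadj hc
    exact hx' (Finset.mem_image.2 ⟨u, by simp [hu, hadj], hc⟩)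
  · intro u hu
    have : u ≠ v := by rintro rfl; exact hv hu
    simp [this]

/-- two equal-coloured elements make the image smaller -/
lemma card_image_lt_of_eq {α : Type*} [DecidableEq α] {c : α → ℕ} {N : Finset α} {u v : α}
    (hu : u ∈ N) (hv : v ∈ N) (huv : u ≠ v) (hc : c u = c v) : #(N.image c) < #N := by
  refine lt_of_le_of_ne Finset.card_image_le ?_
  intro h
  exact huv (Finset.card_image_iff.1 h hu hv hc)

lemma greedy_chain {S : Finset V} {d : ℕ} (hdeg : ∀ v ∈ S, #(nb G v S) ≤ d) (z : V) :
    ∀ (l : List V) (D : Finset V) (c : V → ℕ), D ⊆ S → PC G c D d →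
      (l ++ [z]).IsChain G.Adj → (l ++ [z]).Nodup → (∀ v ∈ l ++ [z], v ∈ S ∧ v ∉ D) →
      ∃ c', PC G c' (D ∪ l.toFinset) d ∧ ∀ u ∈ D, c' u = c u := by
  intro l
  induction l with
  | nil => intro D c _ hc _ _ _; exact ⟨c, by simpa using hc, fun _ _ => rfl⟩
  | cons v l ih =>
    intro D c hDS hc hch hnd hmem
    have hvm := hmem v (by simp)
    obtain ⟨w, hw, hvw⟩ : ∃ w, w ∈ l ++ [z] ∧ G.Adj v w := by
      cases l with
      | nil => exact ⟨z, by simp, by simpa using hch⟩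
      | cons w l => 
        refine ⟨w, by simp, ?_⟩
        simp only [List.cons_append, List.isChain_cons_cons] at hch
        exact hch.1
    have hwm := hmem w (by simp only [List.cons_append, List.mem_cons]; exact Or.inr hw)
    have hfree : #((nb G v D).image c) < d := by
      have h1 : nb G v D ⊂ nb G v S := by
        refine Finset.ssubset_iff_of_subset (nb_mono hDS) |>.2 ⟨w, by simp [hwm, hvw], by simp [hwm]⟩
      have := Finset.card_lt_card h1
      have := hdeg v hvm.1
      have : #((nb G v D).image c) ≤ #(nb G v D) := Finset.card_image_le
      omega
    obtain ⟨c1, hc1, hc1'⟩ := hc.greedy hvm.2 hfree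
    have hnd' : v ∉ l ++ [z] ∧ (l ++ [z]).Nodup := by simpa using hnd
    obtain ⟨c2, hc2, hc2'⟩ := ih (insert v D) c1 (by
        intro u hu
        rcases Finset.mem_insert.1 hu with rfl | hu
        · exact hvm.1
        · exact hDS hu) hc1 (by
          rw [List.cons_append] at hch; exact hch.tail) hnd'.2 (by
        intro u hu
        have := hmem u (by simp only [List.cons_append, List.mem_cons]; exact Or.inr hu)
        refine ⟨this.1, ?_⟩
        simp only [Finset.mem_insert, not_or]
        exact ⟨fun h => hnd'.1 (h ▸ hu), this.2⟩)
    refine ⟨c2, hc2.mono ?_, ?_⟩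
    · intro u; simp
    · intro u hu
      rw [hc2' u (by simp [hu]), hc1' u hu]

lemma exists_first {α : Type*} {P : α → Prop} (l : List α) (h : ∃ a ∈ l, P a) :
    ∃ pre a post, l = pre ++ a :: post ∧ P a ∧ ∀ b ∈ pre, ¬ P b := by
  induction l with
  | nil => simp at h
  | cons x l ih =>
    by_cases hx : P x
    · exact ⟨[], x, l, by simp, hx, by simp⟩
    · obtain ⟨pre, a, post, h1, h2, h3⟩ := ih (by
        obtain ⟨a, ha, hP⟩ := h
        rcases List.mem_cons.1 ha with rfl | ha
        · exact absurd hP hx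
        · exact ⟨a, ha, hP⟩)
      refine ⟨x :: pre, a, post, by simp [h1], h2, ?_⟩
      intro b hb
      rcases List.mem_cons.1 hb with rfl | hb
      · exact hx
      · exact h3 b hb

lemma exists_last {α : Type*} {P : α → Prop} (l : List α) (h : ∃ a ∈ l, P a) :
    ∃ pre a post, l = pre ++ a :: post ∧ P a ∧ ∀ b ∈ post, ¬ P b := by
  obtain ⟨pre, a, post, h1, h2, h3⟩ := exists_first (P := P) l.reverse (by simpa using h)
  refine ⟨post.reverse, a, pre.reverse, ?_, h2, by simpa using h3⟩
  have := congrArg List.reverse h1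
  simpa using this

/-- extend a path at its end as far as possible -/
lemma exists_maxpath {S : Finset V} (n : ℕ) : ∀ l : List V, l ≠ [] → #S ≤ l.length + n →
    l.IsChain G.Adj → l.Nodup → (∀ v ∈ l, v ∈ S) →
    ∃ t z, (l ++ t).IsChain G.Adj ∧ (l ++ t).Nodup ∧ (∀ v ∈ l ++ t, v ∈ S) ∧
      (l ++ t).getLast? = some z ∧ ∀ u ∈ S, G.Adj z u → u ∈ l ++ t := by
  induction n with
  | zero =>
    intro l hne hn hch hnd hmem
    have hS : l.toFinset = S := Finset.eq_of_subset_of_card_le (by intro v; simpa using hmem v)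
      (by rw [List.toFinset_card_of_nodup hnd]; simpa using hn)
    refine ⟨[], l.getLast hne, by simpa using hch, by simpa using hnd, by simpa using hmem,
      by simp [List.getLast?_eq_getLast_of_ne_nil hne], ?_⟩
    intro u hu _
    rw [← hS] at hu
    simpa using hu
  | succ n ih =>
    intro l hne hn hch hnd hmem
    by_cases h : ∀ u ∈ S, G.Adj (l.getLast hne) u → u ∈ l
    · exact ⟨[], l.getLast hne, by simpa using hch, by simpa using hnd, by simpa using hmem,
        by simp [List.getLast?_eq_getLast_of_ne_nil hne], by simpa using h⟩
    · push Not at h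
      obtain ⟨u, hu, hadj, hul⟩ := h
      obtain ⟨t, z, h1, h2, h3, h4, h5⟩ := ih (l ++ [u]) (by simp) (by simp; omega) (by
          rw [List.isChain_append]
          refine ⟨hch, by simp, ?_⟩
          intro x hx y hy
          rw [List.getLast?_eq_getLast_of_ne_nil hne] at hx
          simp at hx hy
          subst hx; subst hy; exact hadj) (by
          rw [List.nodup_append]
          refine ⟨hnd, by simp, ?_⟩
          intro a ha b hb
          simp at hb; subst hb
          rintro rfl; exact hul ha) (by
          intro v hv
          simp at hv
          rcases hv with hv | rfl
          · exact hmem v hv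
          · exact hu)
      exact ⟨u :: t, z, by simpa using h1, by simpa using h2, by simpa using h3,
        by simpa using h4, by simpa using h5⟩

end OreBrooks

namespace OreBrooks

variable {V : Type*} [Fintype V] [DecidableEq V] {G : SimpleGraph V} [DecidableRel G.Adj]

/-- union of two colorings of non-adjacent parts -/
lemma Col.union {S T : Finset V} {d : ℕ} (hS : Col G S d) (hT : Col G T d)
    (h : ∀ u ∈ S, ∀ v ∈ T, G.Adj u v → v ∈ S ∧ u ∈ T) (hd : Disjoint S T) : Col G (S ∪ T) d := by
  obtain ⟨c, hc⟩ := hS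
  obtain ⟨c', hc'⟩ := hT
  have hno : ∀ u ∈ S, ∀ v ∈ T, ¬ G.Adj u v := by
    intro u hu v hv ha
    exact Finset.disjoint_left.1 hd hu (h u hu v hv ha).2
  have hTS : ∀ u ∈ T, u ∉ S := fun u hu hu' => Finset.disjoint_left.1 hd hu' hu
  refine ⟨fun v => if v ∈ S then c v else c' v, ?_, ?_⟩
  · intro v hv
    by_cases hvS : v ∈ S
    · simpa [hvS] using hc.1 v hvS
    · have : v ∈ T := by simpa [hvS] using hv
      simpa [hvS] using hc'.1 v this
  · intro u hu v hv ha
    by_cases huS : u ∈ S <;> by_cases hvS : v ∈ S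
    · simpa [huS, hvS] using hc.2 u huS v hvS ha
    · have hvT : v ∈ T := by simpa [hvS] using hv
      exact absurd ha (hno u huS v hvT)
    · have huT : u ∈ T := by simpa [huS] using hu
      exact absurd ha.symm (hno v hvS u huT)
    · have hvT : v ∈ T := by simpa [hvS] using hv
      have huT : u ∈ T := by simpa [huS] using hu
      simpa [huS, hvS] using hc'.2 u huT v hvT ha

/-- Hamiltonian case -/
lemma brooks_ham {S : Finset V} {d : ℕ} (hd : 3 ≤ d) (hdeg : ∀ v ∈ S, #(nb G v S) = d)
    {x v y : V} {rest : List V} (hch : (x :: v :: y :: rest).IsChain G.Adj)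
    (hnd : (x :: v :: y :: rest).Nodup) (hS : (x :: v :: y :: rest).toFinset = S)
    (hxy : ¬ G.Adj x y) : Col G S d := by
  have hmem : ∀ u, u ∈ S ↔ u = x ∨ u = v ∨ u = y ∨ u ∈ rest := by
    intro u; rw [← hS]; simp
  simp only [List.isChain_cons_cons] at hch
  obtain ⟨hxv, hvy, hch⟩ := hch
  simp only [List.nodup_cons, List.mem_cons, not_or] at hnd
  obtain ⟨⟨hxv', hxy', hxr⟩, ⟨hvy', hvr⟩, hyr, hrr⟩ := hnd
  have hdeg' : ∀ u ∈ S, #(nb G u S) ≤ d := fun u hu => (hdeg u hu).le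
  obtain ⟨w, hwr, hvw⟩ : ∃ w ∈ rest, G.Adj v w := by
    have hc : #(nb G v S) = d := hdeg v (by simp [hmem])
    have : ∃ w ∈ nb G v S, w ∉ ({x, y} : Finset V) := by
      by_contra hcon
      push Not at hcon
      have := Finset.card_le_card (show nb G v S ⊆ {x, y} from hcon)
      have := Finset.card_le_two (a := x) (b := y)
      omega
    obtain ⟨w, hw, hw'⟩ := this
    simp only [mem_nb, hmem] at hw
    simp at hw'
    refine ⟨w, ?_, hw.2⟩
    rcases hw.1 with h | h | h | h
    · exact absurd h hw'.1
    · subst h; exact absurd hw.2 (G.loopless.irrefl _)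
    · exact absurd h hw'.2
    · exact h
  obtain ⟨r1, r2, hr⟩ := List.append_of_mem hwr
  subst hr
  have h0 : PC G (fun _ => 0) {x, y} d := by
    refine ⟨fun _ _ => by show 0 < d; omega, ?_⟩
    intro a ha b hb hab
    simp only [Finset.mem_insert, Finset.mem_singleton] at ha hb
    exfalso
    rcases ha with rfl | rfl <;> rcases hb with rfl | rfl
    · exact G.loopless.irrefl _ hab
    · exact hxy hab
    · exact hxy hab.symm
    · exact G.loopless.irrefl _ hab
  have hch1 := List.isChain_split.1 hch.tail
  obtain ⟨c1, hc1, hc1'⟩ := greedy_chain hdeg' w r1 {x, y} _ (by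
    intro u hu; simp at hu; rw [hmem]; tauto) h0 hch1.1 (by
      have : (r1 ++ w :: r2) = (r1 ++ [w]) ++ r2 := by simp
      rw [this] at hrr
      exact hrr.of_append_left) (by
      intro u hu
      have hu' : u ∈ r1 ++ w :: r2 := by simp at hu ⊢; tauto
      refine ⟨by rw [hmem]; tauto, ?_⟩
      simp only [Finset.mem_insert, Finset.mem_singleton, not_or]
      exact ⟨fun h => hxr (h ▸ hu'), fun h => hyr (h ▸ hu')⟩)
  have hnd2 : (w :: r2).Nodup := hrr.of_append_right
  have hdisj : ∀ a ∈ r1, ∀ b ∈ w :: r2, a ≠ b := (List.nodup_append.1 hrr).2.2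
  obtain ⟨c2, hc2, hc2'⟩ := greedy_chain hdeg' v (w :: r2).reverse ({x, y} ∪ r1.toFinset) c1 (by
      intro u hu; rw [hmem]; simp at hu ⊢; tauto) hc1 (by
      have : (w :: r2).reverse ++ [v] = (v :: w :: r2).reverse := by simp
      rw [this, List.isChain_reverse, List.isChain_cons_cons]
      refine ⟨hvw.symm, ?_⟩
      exact hch1.2.imp (fun _ _ h => h.symm)) (by
      have : (w :: r2).reverse ++ [v] = (v :: w :: r2).reverse := by simp
      rw [this, List.nodup_reverse, List.nodup_cons]
      exact ⟨fun h => hvr (by simp only [List.mem_append]; exact Or.inr h), hnd2⟩) (by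
      intro u hu
      have hu' : u = v ∨ u ∈ w :: r2 := by simp at hu ⊢; tauto
      rcases hu' with rfl | hu'
      · refine ⟨by rw [hmem]; tauto, ?_⟩
        simp at hvr ⊢
        tauto
      · have hu2 : u ∈ r1 ++ w :: r2 := by simp only [List.mem_append]; exact Or.inr hu'
        refine ⟨by rw [hmem]; tauto, ?_⟩
        simp only [Finset.mem_union, Finset.mem_insert, Finset.mem_singleton, not_or,
          List.mem_toFinset]
        exact ⟨⟨fun h => hxr (h ▸ hu2), fun h => hyr (h ▸ hu2)⟩,
          fun h => hdisj u h u hu' rfl⟩)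
  set D := {x, y} ∪ r1.toFinset ∪ (w :: r2).reverse.toFinset with hD
  have hDv : v ∉ D := by
    rw [hD]
    simp at hvr ⊢
    tauto
  have hDS : insert v D = S := by
    ext u
    rw [hmem, hD]
    simp
    tauto
  have hlt : #((nb G v D).image c2) < d := by
    have hsub : nb G v D ⊆ nb G v S := nb_mono (by rw [← hDS]; exact Finset.subset_insert _ _)
    have h1 := Finset.card_le_card hsub
    rw [hdeg v (by rw [← hDS]; simp)] at h1
    have h2 : #((nb G v D).image c2) < #(nb G v D) := by
      refine card_image_lt_of_eq (u := x) (v := y) ?_ ?_ hxy' ?_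
      · simp [hD, hxv.symm]
      · simp [hD, hvy]
      · rw [hc2' x (by simp), hc2' y (by simp), hc1' x (by simp), hc1' y (by simp)]
    omega
  obtain ⟨c3, hc3, -⟩ := hc2.greedy hDv hlt
  rw [hDS] at hc3
  exact ⟨c3, hc3⟩

/-- cycle case: `c1 ++ v :: w :: c2` is a cycle `C`, `v` has a neighbour `u` outside `C`,
`w` has none, rest is colored -/
lemma brooks_cycle {S : Finset V} {d : ℕ} (hdeg : ∀ v ∈ S, #(nb G v S) ≤ d)
    {v w u : V} {c1 c2 : List V} (hch : (c1 ++ v :: w :: c2).IsChain G.Adj)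
    (hnd : (c1 ++ v :: w :: c2).Nodup) (hS : ∀ a ∈ c1 ++ v :: w :: c2, a ∈ S)
    (hclose : ∀ a ∈ (c1 ++ v :: w :: c2).getLast?, ∀ b ∈ (c1 ++ v :: w :: c2).head?, G.Adj a b)
    (hu : u ∈ S) (huC : u ∉ c1 ++ v :: w :: c2) (hvu : G.Adj v u)
    (hw : ∀ a ∈ S, G.Adj w a → a ∈ c1 ++ v :: w :: c2)
    (hcol : Col G (S \ (c1 ++ v :: w :: c2).toFinset) d) : Col G S d := by
  obtain ⟨c, hc⟩ := hcol
  set C := (c1 ++ v :: w :: c2).toFinset with hC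
  have huD : u ∈ S \ C := by
    rw [Finset.mem_sdiff, hC, List.mem_toFinset]; exact ⟨hu, huC⟩
  have hmC : ∀ a, a ∈ C ↔ a ∈ c1 ∨ a = v ∨ a = w ∨ a ∈ c2 := by intro a; simp [hC]; tauto
  have hwC : w ∉ S \ C := by simp [hmC]
  have h0 := hc.extend hwC (hc.1 u huD) (by
    intro a ha hwa
    exfalso
    rw [Finset.mem_sdiff] at ha
    exact ha.2 (by rw [hC, List.mem_toFinset]; exact hw a ha.1 hwa))
  have huw : u ≠ w := by rintro rfl; exact huC (by simp)
  have hvw : G.Adj v w := (List.isChain_append_cons_cons.1 hch).2.1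
  have hch1 : (c1 ++ [v]).IsChain G.Adj := (List.isChain_append_cons_cons.1 hch).1
  have hch2 : (w :: c2).IsChain G.Adj := (List.isChain_append_cons_cons.1 hch).2.2
  have hperm : (w :: (c2 ++ c1 ++ [v])).Perm (c1 ++ v :: w :: c2) := by
    have : w :: (c2 ++ c1 ++ [v]) = (w :: c2) ++ (c1 ++ [v]) := by simp
    rw [this]
    have h2 : c1 ++ v :: w :: c2 = (c1 ++ [v]) ++ (w :: c2) := by simp
    rw [h2]
    exact List.perm_append_comm
  have hnd2 := hperm.nodup_iff.2 hnd
  rw [List.nodup_cons] at hnd2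
  obtain ⟨c', hc', hc''⟩ := greedy_chain hdeg v (c2 ++ c1) (insert w (S \ C)) _ (by
      intro a ha
      rcases Finset.mem_insert.1 ha with rfl | ha
      · exact hS _ (by simp)
      · exact (Finset.mem_sdiff.1 ha).1) h0 (by
      rw [List.append_assoc, List.isChain_append]
      refine ⟨hch2.tail, hch1, ?_⟩
      intro a ha b hb
      refine hclose a ?_ b ?_
      · cases c2 with
        | nil => simp at ha
        | cons p c2 => simpa using ha
      · cases c1 with
        | nil => simpa using hb
        | cons p c1 => simpa using hb) hnd2.2 (by
      intro a ha
      have haC : a ∈ c1 ++ v :: w :: c2 := hperm.subset (List.mem_cons_of_mem _ ha)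
      refine ⟨hS a haC, ?_⟩
      rw [Finset.mem_insert, not_or]
      refine ⟨fun h => hnd2.1 (h ▸ ha), ?_⟩
      rw [Finset.mem_sdiff, hC, List.mem_toFinset]
      tauto)
  set D := insert w (S \ C) ∪ (c2 ++ c1).toFinset with hD
  have hvD : v ∉ D := by
    have hv2 : v ∉ c2 ++ c1 := by
      intro h
      have := List.nodup_append.1 hnd2.2
      exact this.2.2 v h v (by simp) rfl
    have : v ≠ w := hvw.ne
    rw [hD, Finset.mem_union, Finset.mem_insert, Finset.mem_sdiff, List.mem_toFinset]
    simp [hmC, this] at hv2 ⊢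
    exact hv2
  have hDS : insert v D = S := by
    ext a
    rw [hD]
    simp only [Finset.mem_insert, Finset.mem_union, Finset.mem_sdiff, List.mem_toFinset, hmC,
      List.mem_append]
    have : a ∈ c1 ∨ a = v ∨ a = w ∨ a ∈ c2 → a ∈ S := by
      intro h; exact hS a (by simp; tauto)
    tauto
  have hlt : #((nb G v D).image c') < d := by
    have hsub : nb G v D ⊆ nb G v S := nb_mono (by rw [← hDS]; exact Finset.subset_insert _ _)
    have h1 := Finset.card_le_card hsub
    have h3 := hdeg v (by rw [← hDS]; simp)
    have h2 : #((nb G v D).image c') < #(nb G v D) := by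
      refine card_image_lt_of_eq (u := u) (v := w) ?_ ?_ huw ?_
      · rw [mem_nb, hD]
        exact ⟨Finset.mem_union_left _ (Finset.mem_insert_of_mem huD), hvu⟩
      · rw [mem_nb, hD]
        exact ⟨Finset.mem_union_left _ (Finset.mem_insert_self _ _), hvw⟩
      · rw [hc'' u (Finset.mem_insert_of_mem huD), hc'' w (Finset.mem_insert_self _ _)]
        simp [huw]
    omega
  obtain ⟨c3, hc3, -⟩ := hc'.greedy hvD hlt
  rw [hDS] at hc3
  exact ⟨c3, hc3⟩

theorem brooks {d : ℕ} (hd : 3 ≤ d) (n : ℕ) : ∀ S : Finset V, #S ≤ n →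
    (∀ v ∈ S, #(nb G v S) ≤ d) →
    (∀ K ⊆ S, #K = d + 1 → ¬ ∀ a ∈ K, ∀ b ∈ K, a ≠ b → G.Adj a b) → Col G S d := by
  induction n with
  | zero =>
    intro S hS _ _
    have : S = ∅ := by simpa using hS
    subst this
    exact ⟨fun _ => 0, by simp, by simp⟩
  | succ n ih =>
    intro S hS hdeg hK
    have ih' : ∀ T ⊂ S, Col G T d := by
      intro T hT
      have := Finset.card_lt_card hT
      refine ih T (by omega) ?_ ?_
      · intro v hv
        exact (Finset.card_le_card (nb_mono hT.1)).trans (hdeg v (hT.1 hv))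
      · intro K hKT
        exact hK K (hKT.trans hT.1)
    by_cases hlow : ∃ v ∈ S, #(nb G v S) < d
    · obtain ⟨v, hv, hlt⟩ := hlow
      obtain ⟨c, hc⟩ := ih' (S.erase v) (Finset.erase_ssubset hv)
      obtain ⟨c', hc', -⟩ := hc.greedy (v := v) (by simp) (by
        refine lt_of_le_of_lt Finset.card_image_le (lt_of_le_of_lt ?_ hlt)
        exact Finset.card_le_card (nb_mono (Finset.erase_subset _ _)))
      rw [Finset.insert_erase hv] at hc'
      exact ⟨c', hc'⟩
    push Not at hlow
    have hreg : ∀ v ∈ S, #(nb G v S) = d := fun v hv => le_antisymm (hdeg v hv) (hlow v hv)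
    rcases S.eq_empty_or_nonempty with rfl | ⟨v, hv⟩
    · exact ⟨fun _ => 0, by simp, by simp⟩
    obtain ⟨x, hx, y, hy, hxy, hnxy⟩ : ∃ x ∈ nb G v S, ∃ y ∈ nb G v S, x ≠ y ∧ ¬ G.Adj x y := by
      by_contra hcon
      push Not at hcon
      have hvn : v ∉ nb G v S := by simp
      refine hK (insert v (nb G v S)) ?_ ?_ ?_
      · intro a ha
        rcases Finset.mem_insert.1 ha with rfl | ha
        · exact hv
        · exact ((mem_nb G).1 ha).1
      · rw [Finset.card_insert_of_notMem hvn, hreg v hv]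
      · intro a ha b hb hab
        rcases Finset.mem_insert.1 ha with ha' | ha' <;>
          rcases Finset.mem_insert.1 hb with hb' | hb'
        · exact absurd (ha'.trans hb'.symm) hab
        · subst ha'; exact ((mem_nb G).1 hb').2
        · subst hb'; exact ((mem_nb G).1 ha').2.symm
        · exact hcon a ha' b hb' hab
    rw [mem_nb] at hx hy
    obtain ⟨t, z, h1, h2, h3, h4, h5⟩ := exists_maxpath (G := G) (S := S) #S [x, v, y] (by simp)
      (by simp) (by simp [hx.2.symm, hy.2])
      (by simp [hxy, hx.2.symm.ne, hy.2.ne]) (by simp [hx.1, hy.1, hv])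
    set l := [x, v, y] ++ t with hl
    have hzl : z ∈ l := List.mem_of_getLast? h4
    have hzS := h3 z hzl
    obtain ⟨pre, h, post, hsplit, hzh, hpre⟩ := exists_first (P := fun a => G.Adj z a) l (by
      have : (nb G z S).Nonempty := by
        rw [← Finset.card_pos, hreg z hzS]; omega
      obtain ⟨a, ha⟩ := this
      rw [mem_nb] at ha
      exact ⟨a, h5 a ha.1 ha.2, ha.2⟩)
    have hcS : ∀ a ∈ h :: post, a ∈ S := fun a ha => h3 a (by
      rw [hsplit, List.mem_append]; exact Or.inr ha)
    have hcz : (h :: post).getLast? = some z := by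
      rw [hsplit] at h4
      simpa using h4
    have hnbz : ∀ a ∈ S, G.Adj z a → a ∈ h :: post := by
      intro a ha hza
      have := h5 a ha hza
      rw [hsplit, List.mem_append] at this
      exact this.resolve_left (fun hp => hpre a hp hza)
    have hchC : (h :: post).IsChain G.Adj := by
      rw [hsplit] at h1
      exact (List.isChain_append.1 h1).2.1
    have hndC : (h :: post).Nodup := by
      rw [hsplit] at h2
      exact h2.of_append_right
    by_cases hout : ∃ a ∈ h :: post, ∃ u ∈ S, G.Adj a u ∧ u ∉ h :: post
    · obtain ⟨c1, a, c2, hsp, ⟨u, hu, hau, huC⟩, hlast⟩ :=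
        exists_last (P := fun a => ∃ u ∈ S, G.Adj a u ∧ u ∉ h :: post) _ hout
      cases c2 with
      | nil =>
        exfalso
        rw [hsp] at hcz
        simp at hcz
        subst hcz
        exact huC (hnbz u hu hau)
      | cons w c2 =>
        have hsub : (h :: post).toFinset ⊆ S := by
          intro b hb; exact hcS b (by simpa using hb)
        have hcol := ih' (S \ (h :: post).toFinset) (by
          refine Finset.sdiff_ssubset hsub ⟨h, by simp⟩)
        have hclose : ∀ a ∈ (h :: post).getLast?, ∀ b ∈ (h :: post).head?, G.Adj a b := by
          intro a ha b hb
          rw [hcz] at ha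
          simp at ha hb
          subst ha; subst hb; exact hzh
        have hw : ∀ b ∈ S, G.Adj w b → b ∈ h :: post := by
          intro b hb hwb
          by_contra hcon
          exact hlast w (by simp) ⟨b, hb, hwb, hcon⟩
        rw [hsp] at hchC hndC hcS huC hcol hclose hw
        exact brooks_cycle hdeg hchC hndC hcS hclose hu huC hau hw hcol
    · push Not at hout
      have hsub : (h :: post).toFinset ⊆ S := by
        intro b hb; exact hcS b (by simpa using hb)
      by_cases hCS : (h :: post).toFinset = S
      · have hpn : pre = [] := by
          rw [List.eq_nil_iff_forall_not_mem]
          intro a ha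
          have haS : a ∈ S := h3 a (by rw [hsplit, List.mem_append]; exact Or.inl ha)
          rw [← hCS, List.mem_toFinset] at haS
          rw [hsplit] at h2
          exact (List.nodup_append.1 h2).2.2 a ha a haS rfl
        rw [hpn, List.nil_append] at hsplit
        rw [← hsplit] at hCS
        exact brooks_ham hd hreg h1 h2 hCS hnxy
      · have hss : (h :: post).toFinset ⊂ S := Finset.ssubset_iff_subset_ne.2 ⟨hsub, hCS⟩
        have hu := (ih' _ hss).union (ih' (S \ (h :: post).toFinset)
          (Finset.sdiff_ssubset hsub ⟨h, by simp⟩)) (by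
            intro a ha b hb hab
            exfalso
            rw [List.mem_toFinset] at ha
            rw [Finset.mem_sdiff, List.mem_toFinset] at hb
            exact hb.2 (hout a ha b hb.1 hab)) Finset.disjoint_sdiff
        rwa [Finset.union_sdiff_of_subset hsub] at hu

end OreBrooks

namespace OreBrooks

variable {V : Type*} [Fintype V] [DecidableEq V] {G : SimpleGraph V} [DecidableRel G.Adj]

variable (G) in
/-- twice the number of edges inside `S` -/
def edg (S : Finset V) : ℕ := ∑ v ∈ S, #(nb G v S)

variable (G) in
/-- partitioned coloring with hole `p` -/
structure St (r s : ℕ) (p : V) (X Y : Finset V) : Prop where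
  pX : p ∉ X
  pY : p ∉ Y
  disj : Disjoint X Y
  cover : ∀ v, v = p ∨ v ∈ X ∨ v ∈ Y
  colX : Col G X r
  colY : Col G Y s

variable (G) in
/-- minimal partitioned coloring -/
def Mn (r s : ℕ) (p : V) (X Y : Finset V) : Prop :=
  St G r s p X Y ∧ ∀ p' X' Y', St G r s p' X' Y' → edg G X + edg G Y ≤ edg G X' + edg G Y'

variable (G) in
/-- reachability inside `W` -/
def R (W : Finset V) : V → V → Prop :=
  Relation.ReflTransGen (fun a b => G.Adj a b ∧ a ∈ W ∧ b ∈ W)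

lemma R.symm {W : Finset V} {a b : V} (h : R G W a b) : R G W b a := by
  induction h with
  | refl => exact Relation.ReflTransGen.refl
  | tail _ h ih => exact Relation.ReflTransGen.head ⟨h.1.symm, h.2.2, h.2.1⟩ ih

lemma R.mem {W : Finset V} {a b : V} (h : R G W a b) (ha : a ∈ W) : b ∈ W := by
  induction h with
  | refl => exact ha
  | tail _ h ih => exact h.2.2

lemma R.mono {W W' : Finset V} (hW : W ⊆ W') {a b : V} (h : R G W a b) : R G W' a b := by
  induction h with
  | refl => exact Relation.ReflTransGen.refl
  | tail _ h ih => exact ih.tail ⟨h.1, hW h.2.1, hW h.2.2⟩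

/-- closed sets contain everything reachable -/
lemma R.closed {W F : Finset V} (hF : ∀ v ∈ F, ∀ u ∈ W, G.Adj v u → u ∈ F) {a b : V}
    (h : R G W a b) (ha : a ∈ F) : b ∈ F := by
  induction h with
  | refl => exact ha
  | tail _ h ih => exact hF _ ih _ h.2.2 h.1

/-- paths starting in a closed set transfer -/
lemma R.transfer {W W' F : Finset V} (hF : ∀ v ∈ F, ∀ u ∈ W, G.Adj v u → u ∈ F) (hFW : F ⊆ W')
    {a b : V} (h : R G W a b) (ha : a ∈ F) : R G W' a b := by
  induction h with
  | refl => exact Relation.ReflTransGen.refl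
  | tail hab h ih =>
    have h1 := R.closed hF hab ha
    exact ih.tail ⟨h.1, hFW h1, hFW (hF _ h1 _ h.2.2 h.1)⟩

lemma R.last {W : Finset V} {v y : V} (h : R G W v y) (hne : v ≠ y) :
    ∃ u ∈ W.erase y, G.Adj y u ∧ R G (W.erase y) v u := by
  induction h using Relation.ReflTransGen.head_induction_on with
  | refl => exact absurd rfl hne
  | head hab hb ih =>
    rename_i a b
    by_cases hby : b = y
    · subst hby
      exact ⟨a, by simp [hne, hab.2.1], hab.1.symm, Relation.ReflTransGen.refl⟩
    · obtain ⟨u, hu, hyu, hr⟩ := ih hby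
      exact ⟨u, hu, hyu, hr.head ⟨hab.1, by simp [hne, hab.2.1], by simp [hby, hab.2.2]⟩⟩

lemma nb_insert_self (p : V) (X : Finset V) : nb G p (insert p X) = nb G p X := by
  ext u; simp only [mem_nb, Finset.mem_insert]
  constructor
  · rintro ⟨rfl | h, ha⟩
    · exact absurd ha (G.loopless.irrefl _)
    · exact ⟨h, ha⟩
  · rintro ⟨h, ha⟩; exact ⟨Or.inr h, ha⟩

lemma nb_erase_self (p : V) (X : Finset V) : nb G p (X.erase p) = nb G p X := by
  ext u; simp only [mem_nb, Finset.mem_erase]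
  constructor
  · rintro ⟨h, ha⟩; exact ⟨h.2, ha⟩
  · rintro ⟨h, ha⟩; exact ⟨⟨ha.ne', h⟩, ha⟩

lemma edg_insert {p : V} {X : Finset V} (hp : p ∉ X) :
    edg G (insert p X) = edg G X + 2 * #(nb G p X) := by
  unfold edg
  rw [Finset.sum_insert hp, nb_insert_self]
  have : ∀ v ∈ X, #(nb G v (insert p X)) = #(nb G v X) + if G.Adj p v then 1 else 0 := by
    intro v hv
    unfold nb
    rw [Finset.filter_insert]
    by_cases h : G.Adj p v
    · rw [if_pos h.symm, if_pos h, Finset.card_insert_of_notMem (by simp [hp])]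
    · rw [if_neg (fun h' => h h'.symm), if_neg h]; simp
  rw [Finset.sum_congr rfl this, Finset.sum_add_distrib, ← Finset.card_filter]
  unfold nb
  omega

lemma St.symm {r s : ℕ} {p : V} {X Y : Finset V} (h : St G r s p X Y) : St G s r p Y X :=
  ⟨h.pY, h.pX, h.disj.symm, fun v => by have := h.cover v; tauto, h.colY, h.colX⟩

lemma Mn.symm {r s : ℕ} {p : V} {X Y : Finset V} (h : Mn G r s p X Y) : Mn G s r p Y X :=
  ⟨h.1.symm, fun p' X' Y' h' => by have := h.2 p' Y' X' h'.symm; omega⟩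

lemma St.notcol {r s : ℕ} {p : V} {X Y : Finset V} (h : St G r s p X Y)
    (hn : ¬ Col G univ (r + s)) : ¬ Col G (insert p X) r := by
  rintro ⟨c, hc⟩
  obtain ⟨c', hc'⟩ := h.colY
  apply hn
  have hcov : ∀ v, v ∉ insert p X → v ∈ Y := by
    intro v hv
    have := h.cover v
    simp at hv; tauto
  refine ⟨fun v => if v ∈ insert p X then c v else r + c' v, ?_, ?_⟩
  · intro v _
    by_cases hv : v ∈ insert p X
    · have := hc.1 v hv
      simp only [if_pos hv]; omega
    · have := hc'.1 v (hcov v hv)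
      simp only [if_neg hv]; omega
  · intro u _ v _ ha
    by_cases hu : u ∈ insert p X <;> by_cases hv : v ∈ insert p X
    · simp only [if_pos hu, if_pos hv]; exact hc.2 u hu v hv ha
    · have := hc.1 u hu
      simp only [if_pos hu, if_neg hv]; omega
    · have := hc.1 v hv
      simp only [if_neg hu, if_pos hv]; omega
    · have := hc'.2 u (hcov u hu) v (hcov v hv) ha
      simp only [if_neg hu, if_neg hv]; omega

lemma St.ge {r s : ℕ} {p : V} {X Y : Finset V} (h : St G r s p X Y)
    (hn : ¬ Col G univ (r + s)) : r ≤ #(nb G p X) := by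
  by_contra hcon
  obtain ⟨c, hc⟩ := h.colX
  obtain ⟨c', hc', -⟩ := hc.greedy h.pX (lt_of_le_of_lt Finset.card_image_le (not_le.1 hcon))
  exact h.notcol hn ⟨c', hc'⟩

/-- if the hole is tight then colors on its neighbours are distinct -/
lemma inj_of_tight {r : ℕ} {p : V} {X : Finset V} (hpX : p ∉ X) (hn : ¬ Col G (insert p X) r)
    (ht : #(nb G p X) = r) {c : V → ℕ} (hc : PC G c X r) {u v : V} (hu : u ∈ nb G p X)
    (hv : v ∈ nb G p X) (h : c u = c v) : u = v := by
  by_contra hne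
  have := card_image_lt_of_eq hu hv hne h
  obtain ⟨c', hc', -⟩ := hc.greedy hpX (by omega)
  exact hn ⟨c', hc'⟩

lemma Mn.swap {r s : ℕ} {p : V} {X Y : Finset V} (h : Mn G r s p X Y)
    (hn : ¬ Col G univ (r + s)) (ht : #(nb G p X) = r) {q : V} (hq : q ∈ X) (hpq : G.Adj p q) :
    Mn G r s q ((insert p X).erase q) Y ∧ #(nb G q ((insert p X).erase q)) = r := by
  have hpX := h.1.pX
  have hqp : q ≠ p := hpq.ne'
  have hst : St G r s q ((insert p X).erase q) Y := by
    refine ⟨by simp, Finset.disjoint_left.1 h.1.disj hq, ?_, ?_, ?_, h.1.colY⟩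
    · rw [Finset.disjoint_left]
      intro v hv
      simp only [Finset.mem_erase, Finset.mem_insert] at hv
      rcases hv.2 with rfl | hv
      · exact h.1.pY
      · exact Finset.disjoint_left.1 h.1.disj hv
    · intro v
      have := h.1.cover v
      simp only [Finset.mem_erase, Finset.mem_insert]
      tauto
    · obtain ⟨c, hc⟩ := h.1.colX
      have hc2 : PC G c (X.erase q) r := hc.mono (Finset.erase_subset _ _)
      have := hc2.extend (v := p) (x := c q) (by simp [hpX]) (hc.1 q hq) (by
        intro u hu hpu hcu
        rw [Finset.mem_erase] at hu
        exact hu.1 (inj_of_tight hpX (h.1.notcol hn) ht hc (by simp [hu.2, hpu])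
          (by simp [hq, hpq]) hcu))
      rw [Finset.erase_insert_of_ne hqp.symm]
      exact ⟨_, this⟩
  have hge := hst.ge hn
  have hmin := h.2 _ _ _ hst
  have e1 := edg_insert (G := G) hpX
  have e2 := edg_insert (G := G) (p := q) (X := (insert p X).erase q) (by simp)
  rw [Finset.insert_erase (by simp [hq])] at e2
  have heq : #(nb G q ((insert p X).erase q)) = r := by omega
  refine ⟨⟨hst, ?_⟩, heq⟩
  intro p' X' Y' h'
  have := h.2 _ _ _ h'
  omega

lemma Mn.reach {r s : ℕ} {p : V} {X Y : Finset V} (h : Mn G r s p X Y)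
    (hn : ¬ Col G univ (r + s)) (ht : #(nb G p X) = r) {v : V} (hv : R G (insert p X) p v) :
    Mn G r s v ((insert p X).erase v) Y ∧ #(nb G v ((insert p X).erase v)) = r := by
  induction hv with
  | refl => rw [Finset.erase_insert h.1.pX]; exact ⟨h, ht⟩
  | tail hab hb ih =>
    rename_i a b
    have := ih.1.swap hn ih.2 (q := b) (by simp [hb.1.ne', Finset.mem_insert.1 hb.2.2]) hb.1
    rwa [Finset.insert_erase hb.2.1] at this

lemma Mn.clique {r s : ℕ} {p : V} {X Y : Finset V} (h : Mn G r s p X Y) (hr : 3 ≤ r)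
    (hn : ¬ Col G univ (r + s)) (ht : #(nb G p X) = r) :
    (∀ a ∈ nb G p X, ∀ b ∈ nb G p X, a ≠ b → G.Adj a b) ∧
    (∀ a ∈ nb G p X, ∀ b ∈ X, G.Adj a b → b ∈ nb G p X) := by
  classical
  set W := insert p X with hW
  set Z := W.filter (fun v => R G W p v) with hZ
  have hZW : Z ⊆ W := Finset.filter_subset _ _
  have hpZ : p ∈ Z := by
    simp only [hZ, Finset.mem_filter]
    exact ⟨by simp [hW], Relation.ReflTransGen.refl⟩
  have hdeg : ∀ v ∈ Z, #(nb G v W) = r := by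
    intro v hv
    have := (h.reach hn ht (Finset.mem_filter.1 hv).2).2
    rwa [nb_erase_self] at this
  have hclZ : ∀ a ∈ Z, ∀ b ∈ W, G.Adj a b → b ∈ Z := by
    intro a ha b hb hab
    simp only [hZ, Finset.mem_filter] at ha ⊢
    exact ⟨hb, ha.2.tail ⟨hab, ha.1, hb⟩⟩
  have hncol : ¬ Col G Z r := by
    intro hcol
    have h2 : Col G (W \ Z) r := h.1.colX.mono (by
      intro v hv
      rw [Finset.mem_sdiff, hW, Finset.mem_insert] at hv
      rcases hv.1 with rfl | h'
      · exact absurd hpZ hv.2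
      · exact h')
    have := hcol.union h2 (by
      intro a ha b hb hab
      rw [Finset.mem_sdiff] at hb
      exact absurd (hclZ a ha b hb.1 hab) hb.2) Finset.disjoint_sdiff
    rw [Finset.union_sdiff_of_subset hZW] at this
    exact h.1.notcol hn this
  obtain ⟨K, hKZ, hKc, hK⟩ : ∃ K ⊆ Z, #K = r + 1 ∧ ∀ a ∈ K, ∀ b ∈ K, a ≠ b → G.Adj a b := by
    by_contra hcon
    push Not at hcon
    refine hncol (brooks hr _ Z le_rfl ?_ ?_)
    · intro v hv
      exact (Finset.card_le_card (nb_mono hZW)).trans (hdeg v hv).le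
    · intro K hK hc hcl
      obtain ⟨a, ha, b, hb, hab, hn⟩ := hcon K hK hc
      exact hn (hcl a ha b hb hab)
  have hKcl : ∀ a ∈ K, nb G a W = K.erase a := by
    intro a ha
    symm
    apply Finset.eq_of_subset_of_card_le
    · intro b hb
      rw [Finset.mem_erase] at hb
      rw [mem_nb]
      exact ⟨hZW (hKZ hb.2), hK a ha b hb.2 hb.1.symm⟩
    · rw [hdeg a (hKZ ha), Finset.card_erase_of_mem ha]; omega
  have hpK : p ∈ K := by
    have : K.Nonempty := by rw [← Finset.card_pos]; omega
    obtain ⟨a, ha⟩ := this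
    have hr := (Finset.mem_filter.1 (hKZ ha)).2.symm
    refine R.closed ?_ hr ha
    intro v hv u hu hvu
    have : u ∈ nb G v W := by simp [hu, hvu]
    rw [hKcl v hv] at this
    exact Finset.mem_of_mem_erase this
  have hnb : nb G p X = K.erase p := by rw [← hKcl p hpK, hW, nb_insert_self]
  rw [hnb]
  constructor
  · intro a ha b hb hab
    exact hK a (Finset.mem_of_mem_erase ha) b (Finset.mem_of_mem_erase hb) hab
  · intro a ha b hb hab
    have : b ∈ nb G a W := by simp [hW, hb, hab]
    rw [hKcl a (Finset.mem_of_mem_erase ha)] at this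
    rw [Finset.mem_erase]
    refine ⟨?_, Finset.mem_of_mem_erase this⟩
    rintro rfl
    exact h.1.pX hb

lemma conn {p : V} {X : Finset V} (hpX : p ∉ X) (hn : ¬ Col G (insert p X) 2) (hcol : Col G X 2)
    (ht : #(nb G p X) = 2) {u e : V} (hu : u ∈ nb G p X) (he : e ∈ nb G p X) : R G X u e := by
  classical
  by_contra hR
  have hue : u ≠ e := by rintro rfl; exact hR Relation.ReflTransGen.refl
  obtain ⟨c, hc⟩ := hcol
  have hcue : c u ≠ c e := fun h => hue (inj_of_tight hpX hn ht hc hu he h)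
  have hu' := (mem_nb G).1 hu
  have he' := (mem_nb G).1 he
  have hc2 : PC G (fun v => if R G X u v then 1 - c v else c v) X 2 := by
    constructor
    · intro v hv
      have := hc.1 v hv
      dsimp only
      split_ifs <;> omega
    · intro a ha b hb hab
      have h1 := hc.1 a ha
      have h2 := hc.1 b hb
      have h3 := hc.2 a ha b hb hab
      have h4 : R G X u a ↔ R G X u b :=
        ⟨fun h => h.tail ⟨hab, ha, hb⟩, fun h => h.tail ⟨hab.symm, hb, ha⟩⟩
      dsimp only
      by_cases h5 : R G X u a
      · rw [if_pos h5, if_pos (h4.1 h5)]; omega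
      · rw [if_neg h5, if_neg (fun h => h5 (h4.2 h))]; exact h3
  refine hue (inj_of_tight hpX hn ht hc2 hu he ?_)
  have h1 := hc.1 u hu'.1
  have h2 := hc.1 e he'.1
  have h3 : R G X u u := Relation.ReflTransGen.refl
  simp only [if_pos h3, if_neg hR]
  omega

end OreBrooks

namespace OreBrooks

variable {V : Type*} [Fintype V] [DecidableEq V] {G : SimpleGraph V} [DecidableRel G.Adj]

/-- color a set of vertices greedily -/
lemma greedy_set {c : V → ℕ} {D : Finset V} {d : ℕ} (hc : PC G c D d) (T : Finset V)
    (hT : Disjoint T D) (h : ∀ t ∈ T, ∀ c' D', D ⊆ D' → D' ⊆ D ∪ T → (∀ u ∈ D, c' u = c u) →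
      #((nb G t D').image c') < d) :
    ∃ c', PC G c' (D ∪ T) d ∧ ∀ u ∈ D, c' u = c u := by
  have key : ∀ T0 : Finset V, T0 ⊆ T → ∃ c', PC G c' (D ∪ T0) d ∧ ∀ u ∈ D, c' u = c u := by
    intro T0
    induction T0 using Finset.induction_on with
    | empty => intro _; exact ⟨c, by simpa using hc, fun _ _ => rfl⟩
    | insert a T0 ha ih =>
      intro hsub
      have haT : a ∈ T := hsub (by simp)
      have hsub' : T0 ⊆ T := (Finset.subset_insert _ _).trans hsub
      obtain ⟨c1, hc1, hc1'⟩ := ih hsub'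
      have hfree := h a haT c1 (D ∪ T0) Finset.subset_union_left
        (Finset.union_subset_union_right hsub') hc1'
      obtain ⟨c2, hc2, hc2'⟩ := hc1.greedy (v := a) (by
        rw [Finset.mem_union, not_or]
        exact ⟨Finset.disjoint_left.1 hT haT, ha⟩) hfree
      refine ⟨c2, ?_, ?_⟩
      · rwa [Finset.union_insert]
      · intro u hu
        rw [hc2' u (Finset.mem_union_left _ hu), hc1' u hu]
  exact key T (Finset.Subset.refl _)

variable (G) in
/-- critical counterexample -/
structure Crit (k : ℕ) : Prop where
  hk : 5 ≤ k
  ncol : ¬ Col G univ k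
  crit : ∀ v, Col G (univ.erase v) k
  ore : ∀ x y, G.Adj x y → #(nb G x univ) + #(nb G y univ) ≤ 2 * k + 1
  noclq : ∀ K : Finset V, #K = k + 1 → ¬ ∀ a ∈ K, ∀ b ∈ K, a ≠ b → G.Adj a b

variable {k : ℕ}

lemma Crit.ge (C : Crit G k) (v : V) : k ≤ #(nb G v univ) := by
  by_contra hcon
  obtain ⟨c, hc⟩ := C.crit v
  obtain ⟨c', hc', -⟩ := hc.greedy (v := v) (by simp) (by
    refine lt_of_le_of_lt Finset.card_image_le ?_
    rw [nb_erase_self]; omega)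
  rw [Finset.insert_erase (by simp)] at hc'
  exact C.ncol ⟨c', hc'⟩

lemma Crit.le (C : Crit G k) (v : V) : #(nb G v univ) ≤ k + 1 := by
  have h1 := C.ge v
  have hk := C.hk
  have : (nb G v univ).Nonempty := by rw [← Finset.card_pos]; omega
  obtain ⟨u, hu⟩ := this
  have := C.ore v u ((mem_nb G).1 hu).2
  have := C.ge u
  omega

lemma Crit.low_or (C : Crit G k) {u v : V} (h : G.Adj u v) :
    #(nb G u univ) = k ∨ #(nb G v univ) = k := by
  have := C.ore u v h
  have := C.ge u
  have := C.ge v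
  omega

lemma Crit.ncol' (C : Crit G k) : ¬ Col G univ (k - 2 + 2) := by
  have := C.hk
  rw [show k - 2 + 2 = k by omega]; exact C.ncol

lemma Crit.ncol2 (C : Crit G k) : ¬ Col G univ (2 + (k - 2)) := by
  have := C.hk
  rw [show 2 + (k - 2) = k by omega]; exact C.ncol

lemma Crit.finish (C : Crit G k) {u v : V} (huv : u ≠ v) (hna : ¬ G.Adj u v) (S T : Finset V)
    (hS : ∀ s ∈ S, #(nb G s univ) = k ∧ G.Adj s u ∧ G.Adj s v)
    (hT : ∀ t ∈ T, #(nb G t univ \ S) < k) (huT : u ∉ T) (hvT : v ∉ T) (hTS : Disjoint T S)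
    (hcount : #((nb G u univ ∪ nb G v univ) \ (S ∪ T)) < k) : False := by
  have huS : u ∉ S := fun h => G.loopless.irrefl _ (hS u h).2.1
  have hvS : v ∉ S := fun h => G.loopless.irrefl _ (hS v h).2.2
  set D0 : Finset V := univ \ (S ∪ T ∪ {u, v}) with hD0
  obtain ⟨c, hc⟩ : Col G D0 k := (C.crit u).mono (by
    intro w hw
    simp only [hD0, Finset.mem_sdiff, Finset.mem_union, Finset.mem_insert,
      Finset.mem_singleton] at hw
    simp; tauto)
  have hmD0 : ∀ w, w ∈ D0 ↔ w ∉ S ∧ w ∉ T ∧ w ≠ u ∧ w ≠ v := by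
    intro w; simp [hD0]; tauto
  obtain ⟨x, hx, hxn⟩ := exists_free (I := (nb G u D0 ∪ nb G v D0).image c) (d := k) (by
    refine lt_of_le_of_lt Finset.card_image_le (lt_of_le_of_lt (Finset.card_le_card ?_) hcount)
    intro w hw
    simp only [Finset.mem_union, mem_nb, hmD0, Finset.mem_sdiff, Finset.mem_univ, true_and] at hw ⊢
    tauto)
  have hfr : ∀ w ∈ D0, (G.Adj u w ∨ G.Adj v w) → c w ≠ x := by
    intro w hw ha he
    apply hxn
    rw [Finset.mem_image]
    refine ⟨w, ?_, he⟩
    simp only [Finset.mem_union, mem_nb]; tauto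
  have hc1 := hc.extend (v := u) (by simp [hmD0]) hx (fun w hw ha => hfr w hw (Or.inl ha))
  have hc2 := hc1.extend (v := v) (x := x) (by simp [hmD0, huv.symm]) hx (by
    intro w hw ha
    rcases Finset.mem_insert.1 hw with rfl | hw
    · exact absurd ha.symm hna
    · have : w ≠ u := ((hmD0 w).1 hw).2.2.1
      simp only [Function.update_of_ne this]
      exact hfr w hw (Or.inr ha))
  set c2 := Function.update (Function.update c u x) v x with hc2def
  set D2 := insert v (insert u D0) with hD2
  have hmD2 : ∀ w, w ∈ D2 ↔ w ∉ S ∧ w ∉ T := by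
    intro w
    simp only [hD2, Finset.mem_insert, hmD0]
    constructor
    · rintro (rfl | rfl | h)
      · exact ⟨hvS, hvT⟩
      · exact ⟨huS, huT⟩
      · exact ⟨h.1, h.2.1⟩
    · intro h
      by_cases h1 : w = v
      · exact Or.inl h1
      by_cases h2 : w = u
      · exact Or.inr (Or.inl h2)
      exact Or.inr (Or.inr ⟨h.1, h.2, h2, h1⟩)
  have hcc : c2 u = c2 v := by simp [hc2def, huv]
  have huD2 : u ∈ D2 := by simp [hD2]
  have hvD2 : v ∈ D2 := by simp [hD2]
  obtain ⟨c3, hc3, hc3'⟩ := greedy_set hc2 T (by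
      rw [Finset.disjoint_left]; intro w hw hw2; exact ((hmD2 w).1 hw2).2 hw) (by
      intro t ht c' D' _ hD' _
      refine lt_of_le_of_lt Finset.card_image_le
        (lt_of_le_of_lt (Finset.card_le_card ?_) (hT t ht))
      intro w hw
      rw [mem_nb] at hw
      rw [Finset.mem_sdiff, mem_nb]
      refine ⟨⟨by simp, hw.2⟩, ?_⟩
      rcases Finset.mem_union.1 (hD' hw.1) with h | h
      · exact ((hmD2 w).1 h).1
      · exact Finset.disjoint_left.1 hTS h)
  obtain ⟨c4, hc4, -⟩ := greedy_set hc3 S (by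
      rw [Finset.disjoint_left]; intro w hw hw2
      rcases Finset.mem_union.1 hw2 with h | h
      · exact ((hmD2 w).1 h).1 hw
      · exact Finset.disjoint_left.1 hTS h hw) (by
      intro s hs c' D' hD1 _ hagree
      have h1 := hS s hs
      have hu3 : u ∈ D2 ∪ T := Finset.mem_union_left _ huD2
      have hv3 : v ∈ D2 ∪ T := Finset.mem_union_left _ hvD2
      have h2 : #((nb G s D').image c') < #(nb G s D') := by
        refine card_image_lt_of_eq (u := u) (v := v) ?_ ?_ huv ?_
        · simp [hD1 hu3, h1.2.1]
        · simp [hD1 hv3, h1.2.2]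
        · rw [hagree u hu3, hagree v hv3, hc3' u huD2, hc3' v hvD2, hcc]
      have h3 := Finset.card_le_card (nb_mono (G := G) (v := s) (Finset.subset_univ D'))
      omega)
  refine C.ncol ⟨c4, hc4.mono ?_⟩
  intro w _
  simp only [Finset.mem_union, hmD2]
  tauto

lemma Crit.split (C : Crit G k) {p : V} {X Y : Finset V} {r s : ℕ} (h : St G r s p X Y) :
    #(nb G p univ) = #(nb G p X) + #(nb G p Y) := by
  rw [← Finset.card_union_of_disjoint]
  · congr 1
    ext w
    simp only [mem_nb, Finset.mem_union, Finset.mem_univ, true_and]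
    have := h.cover w
    constructor
    · intro ha
      rcases this with rfl | h | h
      · exact absurd ha (G.loopless.irrefl _)
      · exact Or.inl ⟨h, ha⟩
      · exact Or.inr ⟨h, ha⟩
    · tauto
  · rw [Finset.disjoint_left]
    intro w hw hw'
    exact Finset.disjoint_left.1 h.disj ((mem_nb G).1 hw).1 ((mem_nb G).1 hw').1

lemma Crit.tight (C : Crit G k) {p : V} {X Y : Finset V} (h : Mn G (k - 2) 2 p X Y)
    (hp : #(nb G p univ) = k) : #(nb G p X) = k - 2 ∧ #(nb G p Y) = 2 := by
  have h1 := C.split h.1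
  have h2 := h.1.ge C.ncol'
  have h3 := h.1.symm.ge C.ncol2
  have := C.hk
  omega

lemma Crit.swap1 (C : Crit G k) {p a : V} {X Y : Finset V} (h : Mn G (k - 2) 2 p X Y)
    (hp : #(nb G p univ) = k) (ha : a ∈ nb G p X) :
    Mn G (k - 2) 2 a ((insert p X).erase a) Y := by
  rw [mem_nb] at ha
  exact (h.swap C.ncol' (C.tight h hp).1 ha.1 ha.2).1

lemma Crit.reach2 (C : Crit G k) {p v : V} {X Y : Finset V} (h : Mn G (k - 2) 2 p X Y)
    (hp : #(nb G p univ) = k) (hv : R G (insert p Y) p v) :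
    Mn G (k - 2) 2 v X ((insert p Y).erase v) ∧ #(nb G v (insert p Y)) = 2 := by
  have := h.symm.reach C.ncol2 (C.tight h hp).2 hv
  rw [nb_erase_self] at this
  exact ⟨this.1.symm, this.2⟩

lemma Crit.cl (C : Crit G k) {p : V} {X Y : Finset V} (h : Mn G (k - 2) 2 p X Y)
    (hp : #(nb G p univ) = k) :
    (∀ a ∈ nb G p X, ∀ b ∈ nb G p X, a ≠ b → G.Adj a b) ∧
    (∀ a ∈ nb G p X, ∀ b ∈ X, G.Adj a b → b ∈ nb G p X) :=
  h.clique (by have := C.hk; omega) C.ncol' (C.tight h hp).1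

lemma R.edge {W : Finset V} {a b : V} (h : G.Adj a b) (ha : a ∈ W) (hb : b ∈ W) : R G W a b :=
  Relation.ReflTransGen.single ⟨h, ha, hb⟩

lemma Crit.aux (C : Crit G k) {p q a a' : V} {X Y : Finset V} (h : Mn G (k - 2) 2 p X Y)
    (hp : #(nb G p univ) = k) (ha : a ∈ nb G p X) (ha' : a' ∈ nb G p X) (hne : a ≠ a')
    (hla : #(nb G a univ) = k) (hqY : q ∈ Y) (hq : #(nb G q univ) = k)
    (hqa : G.Adj q a) (hqa' : G.Adj q a') : G.Adj q p := by
  have s1 := C.swap1 h hp ha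
  have s2 := (C.reach2 s1 hla (R.edge hqa.symm (by simp) (by simp [hqY]))).1
  have hcl := C.cl s2 hq
  rw [mem_nb] at ha ha'
  have h1 : a' ∈ nb G q ((insert p X).erase a) := by
    simp [hne.symm, ha'.1, hqa']
  have := hcl.2 a' h1 p (by simp [ha.2.ne]) ha'.2.symm
  exact ((mem_nb G).1 this).2

lemma Crit.esub (C : Crit G k) {a b q : V} {X X' Y : Finset V} (h : Mn G (k - 2) 2 a X Y)
    (ha : #(nb G a univ) = k) (h' : Mn G (k - 2) 2 b X' Y) (hb : #(nb G b univ) = k)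
    (hqY : q ∈ Y) (haq : G.Adj a q) (hbq : G.Adj b q) : nb G a Y ⊆ nb G b Y := by
  intro e he
  have he' := (mem_nb G).1 he
  have h1 : R G Y q e := conn h.1.pY (h.1.symm.notcol C.ncol2) h.1.colY (C.tight h ha).2
    (by simp [hqY, haq]) he
  have h2 : R G (insert b Y) b e :=
    (R.edge hbq (by simp) (by simp [hqY])).trans (h1.mono (Finset.subset_insert _ _))
  have h3 := (C.reach2 h' hb h2).2
  have h4 := (C.reach2 h ha (R.edge he'.2 (by simp) (by simp [he'.1]))).2
  rw [mem_nb]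
  refine ⟨he'.1, ?_⟩
  by_contra hcon
  unfold nb at h3 h4
  rw [Finset.filter_insert, if_neg (fun h => hcon h.symm)] at h3
  rw [Finset.filter_insert, if_pos he'.2.symm, Finset.card_insert_of_notMem (by simp [h.1.pY])] at h4
  omega

lemma Crit.wheel (C : Crit G k) {p q : V} {X Y : Finset V} (h : Mn G (k - 2) 2 p X Y)
    (hp : #(nb G p univ) = k) (hqY : q ∈ Y) (hq : #(nb G q univ) = k)
    (hqA : ∀ b ∈ nb G p X, G.Adj q b) : False := by
  have hk := C.hk
  obtain ⟨hcl1, hcl2⟩ := C.cl h hp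
  obtain ⟨ht1, ht2⟩ := C.tight h hp
  set A := nb G p X with hA
  set AL := A.filter (fun v => #(nb G v univ) = k) with hAL
  set AH := A.filter (fun v => ¬ #(nb G v univ) = k) with hAH
  have hsum : #AL + #AH = k - 2 := by rw [← ht1]; exact Finset.card_filter_add_card_filter_not _
  have hmA : ∀ v, v ∈ A ↔ v ∈ X ∧ G.Adj p v := fun v => mem_nb G
  have hmL : ∀ v, v ∈ AL ↔ v ∈ A ∧ #(nb G v univ) = k := by intro v; simp [hAL]
  have hmH : ∀ v, v ∈ AH ↔ v ∈ A ∧ ¬ #(nb G v univ) = k := by intro v; simp [hAH]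
  have hH1 : #AH ≤ 1 := by
    rw [Finset.card_le_one]
    intro a ha b hb
    rw [hmH] at ha hb
    by_contra hne
    rcases C.low_or (hcl1 a ha.1 b hb.1 hne) with h | h
    · exact ha.2 h
    · exact hb.2 h
  have hXY := Finset.disjoint_left.1 h.1.disj
  obtain ⟨a, ha, a', ha', haa⟩ := Finset.one_lt_card.1 (show 1 < #AL by omega)
  rw [hmL] at ha ha'
  have hqp : G.Adj q p := C.aux h hp ha.1 ha'.1 haa ha.2 hqY hq (hqA _ ha.1) (hqA _ ha'.1)
  obtain ⟨e, he, heq⟩ : ∃ e ∈ nb G p Y, e ≠ q :=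
    Finset.exists_mem_ne (by omega) q
  have he' := (mem_nb G).1 he
  have hea : ∀ a ∈ AL, G.Adj a e := by
    intro a ha
    rw [hmL] at ha
    have := C.esub h hp (C.swap1 h hp ha.1) ha.2 hqY hqp.symm (hqA a ha.1).symm he
    exact ((mem_nb G).1 this).2
  have hpA : p ∉ A := fun h' => h.1.pX ((hmA p).1 h').1
  have hqnA : q ∉ A := fun h' => hXY ((hmA q).1 h').1 hqY
  have henA : e ∉ A := fun h' => hXY ((hmA e).1 h').1 he'.1
  have hpL : p ∉ AL := fun h' => hpA ((hmL p).1 h').1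
  have hqL : q ∉ AL := fun h' => hqnA ((hmL q).1 h').1
  have hpe : p ≠ e := he'.2.ne
  by_cases hqe : G.Adj q e
  · by_cases hall : ∀ b ∈ A, G.Adj b e
    · refine C.noclq (insert p (insert q (insert e A))) ?_ ?_
      · rw [Finset.card_insert_of_notMem, Finset.card_insert_of_notMem,
          Finset.card_insert_of_notMem henA, ht1]
        · omega
        · simp [heq.symm, hqnA]
        · simp [hqp.ne', hpe, hpA]
      · have hpb : ∀ b ∈ A, G.Adj p b := fun b hb => ((hmA b).1 hb).2
        have base : ∀ x ∈ insert p (insert q (insert e A)), ∀ y ∈ insert p (insert q (insert e A)),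
            x ≠ y → G.Adj x y := by
          intro x hx y hy hxy
          simp only [Finset.mem_insert] at hx hy
          rcases hx with rfl | rfl | rfl | hx <;> rcases hy with rfl | rfl | rfl | hy
          · exact absurd rfl hxy
          · exact hqp.symm
          · exact he'.2
          · exact hpb _ hy
          · exact hqp
          · exact absurd rfl hxy
          · exact hqe
          · exact hqA _ hy
          · exact he'.2.symm
          · exact hqe.symm
          · exact absurd rfl hxy
          · exact (hall _ hy).symm
          · exact (hpb _ hx).symm
          · exact (hqA _ hx).symm
          · exact hall _ hx
          · exact hcl1 _ hx _ hy hxy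
        exact base
    · push Not at hall
      obtain ⟨s, hs, hse⟩ := hall
      have hsH : s ∈ AH := by
        rw [hmH]
        exact ⟨hs, fun h' => hse (hea s ((hmL s).2 ⟨hs, h'⟩))⟩
      have hH : 0 < #AH := Finset.card_pos.2 ⟨s, hsH⟩
      set S := insert p (insert q AL) with hSdef
      have hScard : #S = k - 1 := by
        rw [hSdef, Finset.card_insert_of_notMem (by simp [hqp.ne', hpL]),
          Finset.card_insert_of_notMem hqL]
        omega
      have hS : ∀ t ∈ S, #(nb G t univ) = k ∧ G.Adj t s ∧ G.Adj t e := by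
        intro t ht
        simp only [hSdef, Finset.mem_insert] at ht
        rcases ht with rfl | rfl | ht
        · exact ⟨hp, ((hmA s).1 hs).2, he'.2⟩
        · exact ⟨hq, hqA s hs, hqe⟩
        · have ht2 := (hmL t).1 ht
          refine ⟨ht2.2, hcl1 t ht2.1 s hs ?_, hea t ht⟩
          rintro rfl
          exact ((hmH t).1 hsH).2 ht2.2
      refine C.finish (u := s) (v := e) ?_ hse S ∅ hS (by simp) (by simp) (by simp) (by simp) ?_
      · rintro rfl; exact henA hs
      · rw [Finset.union_empty, Finset.union_sdiff_distrib]
        have c1 := Finset.card_union_le (nb G s univ \ S) (nb G e univ \ S)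
        have c2 := Finset.card_sdiff_of_subset (show S ⊆ nb G s univ from
          fun t ht => by simp [(hS t ht).2.1.symm])
        have c3 := Finset.card_sdiff_of_subset (show S ⊆ nb G e univ from
          fun t ht => by simp [(hS t ht).2.2.symm])
        have := C.le s
        have := C.le e
        omega
  · set S := insert p AL with hSdef
    have hScard : #S = #AL + 1 := by rw [hSdef, Finset.card_insert_of_notMem hpL]
    have hS : ∀ t ∈ S, #(nb G t univ) = k ∧ G.Adj t q ∧ G.Adj t e := by
      intro t ht
      simp only [hSdef, Finset.mem_insert] at ht
      rcases ht with rfl | ht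
      · exact ⟨hp, hqp.symm, he'.2⟩
      · have ht2 := (hmL t).1 ht
        exact ⟨ht2.2, (hqA t ht2.1).symm, hea t ht⟩
    have hdis : Disjoint AH S := by
      rw [Finset.disjoint_left]
      intro t ht ht2
      rw [hmH] at ht
      simp only [hSdef, Finset.mem_insert, hmL] at ht2
      rcases ht2 with rfl | ht2
      · exact hpA ht.1
      · exact ht.2 ht2.2
    refine C.finish (u := q) (v := e) heq.symm hqe S AH hS ?_ ?_ ?_ hdis ?_
    · intro t ht
      have ht' := (hmH t).1 ht
      have c2 := Finset.card_sdiff_of_subset (show S ⊆ nb G t univ from by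
        intro w hw
        simp only [hSdef, Finset.mem_insert] at hw
        rw [mem_nb]
        refine ⟨by simp, ?_⟩
        rcases hw with rfl | hw
        · exact ((hmA t).1 ht'.1).2.symm
        · have hw2 := (hmL w).1 hw
          refine hcl1 t ht'.1 w hw2.1 ?_
          rintro rfl
          exact ht'.2 hw2.2)
      have := C.le t
      omega
    · intro h'; exact hqnA ((hmH q).1 h').1
    · intro h'; exact henA ((hmH e).1 h').1
    · rw [Finset.union_sdiff_distrib]
      have c1 := Finset.card_union_le (nb G q univ \ (S ∪ AH)) (nb G e univ \ (S ∪ AH))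
      have c2 := Finset.card_sdiff_of_subset (show S ∪ AH ⊆ nb G q univ from by
        intro t ht
        rw [mem_nb]
        refine ⟨by simp, ?_⟩
        rcases Finset.mem_union.1 ht with ht | ht
        · exact (hS t ht).2.1.symm
        · exact hqA t ((hmH t).1 ht).1)
      have c3 := Finset.card_sdiff_of_subset (show S ⊆ nb G e univ from
        fun t ht => by simp [(hS t ht).2.2.symm])
      have c4 : #(nb G e univ \ (S ∪ AH)) ≤ #(nb G e univ \ S) :=
        Finset.card_le_card (Finset.sdiff_subset_sdiff (Finset.Subset.refl _)
          Finset.subset_union_left)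
      have c5 : #(S ∪ AH) = #S + #AH := Finset.card_union_of_disjoint hdis.symm
      have := C.le e
      omega

end OreBrooks

namespace OreBrooks

section

variable {V : Type*} [Fintype V] [DecidableEq V] {G : SimpleGraph V} [DecidableRel G.Adj]
variable {k : ℕ}

lemma Crit.lowpair (C : Crit G k) {a : V} {X Y : Finset V} (h : Mn G (k - 2) 2 a X Y) :
    ∃ y e, #(nb G y univ) = k ∧ #(nb G e univ) = k ∧ G.Adj y e ∧ R G (insert a Y) a y ∧
      R G (insert a Y) a e ∧ y ≠ a := by
  classical
  by_contra hcon
  have hno : ∀ y e, #(nb G y univ) = k → #(nb G e univ) = k → R G (insert a Y) a y →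
      R G (insert a Y) a e → ¬ G.Adj y e := by
    intro y e hy he hRy hRe hye
    by_cases hya : y = a
    · exact hcon ⟨e, y, he, hy, hye.symm, hRe, hRy, hya ▸ hye.ne'⟩
    · exact hcon ⟨y, e, hy, he, hye, hRy, hRe, hya⟩
  apply h.1.symm.notcol C.ncol2
  set W := insert a Y with hW
  set Z := W.filter (fun v => R G W a v) with hZ
  have hZcol : Col G Z 2 := by
    refine ⟨fun v => if #(nb G v univ) = k then 0 else 1, ?_, ?_⟩
    · intro v _
      dsimp only
      split_ifs <;> omega
    · intro u hu v hv huv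
      have hu' := (Finset.mem_filter.1 hu).2
      have hv' := (Finset.mem_filter.1 hv).2
      have h1 := C.low_or huv
      dsimp only
      by_cases h2 : #(nb G u univ) = k
      · by_cases h3 : #(nb G v univ) = k
        · exact absurd huv (hno u v h2 h3 hu' hv')
        · simp [h2, h3]
      · have h3 := h1.resolve_left h2
        simp [h2, h3]
  have h2 : Col G (W \ Z) 2 := h.1.colY.mono (by
    intro v hv
    rw [Finset.mem_sdiff, hW, Finset.mem_insert] at hv
    rcases hv.1 with rfl | h'
    · exact absurd (Finset.mem_filter.2 ⟨by simp [hW], Relation.ReflTransGen.refl⟩) hv.2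
    · exact h')
  have := hZcol.union h2 (by
    intro u hu b hb hub
    rw [Finset.mem_sdiff] at hb
    rw [hZ, Finset.mem_filter] at hu
    exact absurd (Finset.mem_filter.2 ⟨hb.1, hu.2.tail ⟨hub, hu.1, hb.1⟩⟩) hb.2)
    Finset.disjoint_sdiff
  rwa [Finset.union_sdiff_of_subset (Finset.filter_subset _ _)] at this

variable (G) in
/-- `w` is low and complete to the component of `y` in `X` -/
def Dom (k : ℕ) (X : Finset V) (w y : V) : Prop :=
  #(nb G w univ) = k ∧ G.Adj w y ∧ ∀ z ∈ X, G.Adj z y → G.Adj w z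

variable (G) in
structure Inv (k : ℕ) (p : V) (X Y F1 F2 : Finset V) : Prop where
  mn : Mn G (k - 2) 2 p X Y
  low : #(nb G p univ) = k
  s1 : F1 ⊆ X
  s2 : F2 ⊆ Y
  closed : ∀ v ∈ F2, ∀ u ∈ Y, G.Adj v u → u ∈ F2
  i1 : ∀ y ∈ F1, ∃ w ∈ F2, Dom G k X w y
  i2 : ∀ v ∈ F2, ∃ e, R G Y v e ∧ #(nb G e univ) = k ∧ ∃ y, G.Adj y e ∧
    (y = p ∨ (y ∈ F1 ∧ ∃ w ∈ F2, w ≠ e ∧ Dom G k X w y))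

/-- a dominated clique gives a contradiction -/
lemma Crit.dom (C : Crit G k) {p w y : V} {X Y : Finset V} (h : Mn G (k - 2) 2 p X Y)
    (hp : #(nb G p univ) = k) (hy : y ∈ X) (hpy : G.Adj p y) (hw : w ∈ Y) (hd : Dom G k X w y) :
    False := by
  refine C.wheel h hp hw hd.1 ?_
  intro b hb
  by_cases hby : b = y
  · subst hby; exact hd.2.1
  · exact hd.2.2 b ((mem_nb G).1 hb).1 ((C.cl h hp).1 b hb y (by simp [hy, hpy]) hby)

lemma Crit.step (C : Crit G k) {p : V} {X Y F1 F2 : Finset V} (I : Inv G k p X Y F1 F2) :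
    ∃ p' X' Y' F1' F2', Inv G k p' X' Y' F1' F2' ∧ #F1 < #F1' := by
  classical
  have hk := C.hk
  have hp := I.low
  have hpF1 : ∀ y ∈ F1, ¬ G.Adj p y := by
    intro y hy hpy
    obtain ⟨w, hw, hd⟩ := I.i1 y hy
    exact C.dom I.mn hp (I.s1 hy) hpy (I.s2 hw) hd
  -- a low vertex in the clique
  obtain ⟨hcl1, hcl2⟩ := C.cl I.mn hp
  obtain ⟨a, haA, ha⟩ : ∃ a ∈ nb G p X, #(nb G a univ) = k := by
    have ht := (C.tight I.mn hp).1
    obtain ⟨a, ha, b, hb, hab⟩ := Finset.one_lt_card.1 (show 1 < #(nb G p X) by omega)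
    rcases C.low_or (hcl1 a ha b hb hab) with h | h
    · exact ⟨a, ha, h⟩
    · exact ⟨b, hb, h⟩
  have haA' := (mem_nb G).1 haA
  have s1 := C.swap1 I.mn hp haA
  set X1 := (insert p X).erase a with hX1
  have hmX1 : ∀ z, z ∈ X1 ↔ z ≠ a ∧ (z = p ∨ z ∈ X) := by intro z; simp [hX1]
  have hpX1 : p ∈ X1 := by rw [hmX1]; exact ⟨haA'.2.ne, Or.inl rfl⟩
  have haY : a ∉ Y := s1.1.pY
  have hF1X1 : F1 ⊆ X1 := by
    intro y hy
    rw [hmX1]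
    refine ⟨?_, Or.inr (I.s1 hy)⟩
    rintro rfl
    exact hpF1 _ hy haA'.2
  have hDa : Dom G k X1 a p := by
    refine ⟨ha, haA'.2.symm, ?_⟩
    intro z hz hzp
    rw [hmX1] at hz
    have hzX : z ∈ X := hz.2.resolve_left hzp.ne
    exact hcl1 a haA z (by simp [hzX, hzp.symm]) hz.1.symm
  have hDold : ∀ w y, y ∈ F1 → Dom G k X w y → Dom G k X1 w y := by
    intro w y hy hd
    refine ⟨hd.1, hd.2.1, ?_⟩
    intro z hz hzy
    rw [hmX1] at hz
    rcases hz.2 with rfl | hzX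
    · exact absurd hzy (hpF1 y hy)
    · exact hd.2.2 z hzX hzy
  have haF2 : ∀ v ∈ F2, ¬ G.Adj a v := by
    intro v hv hav
    obtain ⟨e, hRe, hle, y, hye, hy⟩ := I.i2 v hv
    have hvY := I.s2 hv
    have heY : e ∈ Y := hRe.mem hvY
    have hR : R G (insert a Y) a e :=
      (R.edge hav (by simp) (by simp [hvY])).trans (hRe.mono (Finset.subset_insert _ _))
    have s2 := (C.reach2 s1 ha hR).1
    rcases hy with rfl | ⟨hyF, w, hw, hwe, hd⟩
    · refine C.dom s2 hle hpX1 hye.symm (w := a) ?_ hDa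
      have : a ≠ e := by rintro rfl; exact haY heY
      simp [this]
    · refine C.dom s2 hle (hF1X1 hyF) hye.symm (w := w) ?_ (hDold w y hyF hd)
      simp [hwe, I.s2 hw]
  obtain ⟨y', e, hly, hle, hye, hRy, hRe, hya⟩ := C.lowpair s1
  have s2 := (C.reach2 s1 ha hRy).1
  set Y2 := (insert a Y).erase y' with hY2
  have hmY2 : ∀ z, z ∈ Y2 ↔ z ≠ y' ∧ (z = a ∨ z ∈ Y) := by intro z; simp [hY2]
  have haY2 : a ∈ Y2 := by rw [hmY2]; exact ⟨hya.symm, Or.inl rfl⟩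
  have heY2 : e ∈ Y2 := by
    have := hRe.mem (by simp)
    rw [hmY2]
    exact ⟨hye.ne', by simpa using this⟩
  have hyF2 : y' ∉ F2 := by
    intro hy
    obtain ⟨u, hu, hau, hR⟩ := hRy.symm.last hya
    rw [Finset.erase_insert haY] at hu hR
    exact haF2 u (R.closed I.closed hR hy) hau
  have hF2Y2 : F2 ⊆ Y2 := by
    intro v hv
    rw [hmY2]
    refine ⟨?_, Or.inr (I.s2 hv)⟩
    rintro rfl
    exact hyF2 hv
  have hRae : R G Y2 a e := by
    obtain ⟨u, hu, hyu, hR⟩ := hRy.last hya.symm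
    refine Relation.ReflTransGen.trans hR ?_
    exact conn s2.1.pY (s2.1.symm.notcol C.ncol2) s2.1.colY (C.tight s2 hly).2
      (by rw [mem_nb]; exact ⟨hu, hyu⟩) (by rw [mem_nb]; exact ⟨heY2, hye⟩)
  set F2' := F2 ∪ Y2.filter (fun v => R G Y2 e v) with hF2'
  have hmF2' : ∀ v, v ∈ F2' ↔ v ∈ F2 ∨ (v ∈ Y2 ∧ R G Y2 e v) := by intro v; simp [hF2']
  have haF2' : a ∈ F2' := by rw [hmF2']; exact Or.inr ⟨haY2, hRae.symm⟩
  refine ⟨y', X1, Y2, insert p F1, F2', ⟨s2, hly, ?_, ?_, ?_, ?_, ?_⟩, ?_⟩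
  · intro v hv
    rcases Finset.mem_insert.1 hv with rfl | hv
    · exact hpX1
    · exact hF1X1 hv
  · intro v hv
    rcases (hmF2' v).1 hv with h | h
    · exact hF2Y2 h
    · exact h.1
  · intro v hv u hu hvu
    rw [hmF2'] at hv ⊢
    rcases hv with hv | hv
    · left
      rcases ((hmY2 u).1 hu).2 with rfl | huY
      · exact absurd hvu.symm (haF2 v hv)
      · exact I.closed v hv u huY hvu
    · right
      exact ⟨hu, hv.2.tail ⟨hvu, hv.1, hu⟩⟩
  · intro y hy
    rcases Finset.mem_insert.1 hy with rfl | hy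
    · exact ⟨a, haF2', hDa⟩
    · obtain ⟨w, hw, hd⟩ := I.i1 y hy
      exact ⟨w, (hmF2' w).2 (Or.inl hw), hDold w y hy hd⟩
  · intro v hv
    rcases (hmF2' v).1 hv with hv | hv
    · obtain ⟨e0, hR0, hl0, y, hy0, hy⟩ := I.i2 v hv
      refine ⟨e0, R.transfer I.closed hF2Y2 hR0 hv, hl0, y, hy0, Or.inr ?_⟩
      rcases hy with rfl | ⟨hyF, w, hw, hwe, hd⟩
      · refine ⟨by simp, a, haF2', ?_, hDa⟩
        rintro rfl
        exact haY (hR0.mem (I.s2 hv))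
      · exact ⟨by simp [hyF], w, (hmF2' w).2 (Or.inl hw), hwe, hDold w y hyF hd⟩
    · exact ⟨e, hv.2.symm, hle, y', hye, Or.inl rfl⟩
  · rw [Finset.card_insert_of_notMem (fun h => I.mn.1.pX (I.s1 h))]
    omega

/-- there is a minimal partitioned coloring with a low hole -/
lemma Crit.start (C : Crit G k) : ∃ p X Y, Mn G (k - 2) 2 p X Y ∧ #(nb G p univ) = k := by
  classical
  have hk := C.hk
  have hne : Nonempty V := by
    by_contra hcon
    rw [not_nonempty_iff] at hcon
    exact C.ncol ⟨fun _ => 0, fun v => hcon.elim v, fun v => hcon.elim v⟩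
  obtain ⟨v⟩ := hne
  have hex : ∃ n p X Y, St G (k - 2) 2 p X Y ∧ edg G X + edg G Y = n := by
    obtain ⟨c, hc⟩ := C.crit v
    refine ⟨_, v, (univ.erase v).filter (fun w => c w < k - 2),
      (univ.erase v).filter (fun w => ¬ c w < k - 2), ⟨by simp, by simp, ?_, ?_, ?_, ?_⟩, rfl⟩
    · exact Finset.disjoint_filter_filter_not _ _ _
    · intro w
      by_cases h : w = v
      · simp [h]
      · simp [h]; omega
    · refine ⟨c, ?_, ?_⟩
      · intro w hw; exact (Finset.mem_filter.1 hw).2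
      · intro x hx y hy
        exact hc.2 x (Finset.mem_filter.1 hx).1 y (Finset.mem_filter.1 hy).1
    · refine ⟨fun w => c w - (k - 2), ?_, ?_⟩
      · intro w hw
        rw [Finset.mem_filter] at hw
        have := hc.1 w hw.1
        dsimp only
        omega
      · intro x hx y hy hxy
        rw [Finset.mem_filter] at hx hy
        have := hc.2 x hx.1 y hy.1 hxy
        dsimp only
        omega
  obtain ⟨p, X, Y, hst, hn⟩ := Nat.find_spec hex
  have hmn : Mn G (k - 2) 2 p X Y := by
    refine ⟨hst, ?_⟩
    intro p' X' Y' h'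
    rw [hn]
    exact Nat.find_min' hex ⟨p', X', Y', h', rfl⟩
  by_cases hp : #(nb G p univ) = k
  · exact ⟨p, X, Y, hmn, hp⟩
  have h1 := C.split hst
  have h2 := hst.ge C.ncol'
  have h3 := hst.symm.ge C.ncol2
  have h4 := C.le p
  by_cases ht : #(nb G p X) = k - 2
  · obtain ⟨q, hq⟩ := Finset.card_pos.1 (show 0 < #(nb G p X) by omega)
    rw [mem_nb] at hq
    exact ⟨q, _, _, (hmn.swap C.ncol' ht hq.1 hq.2).1, (C.low_or hq.2).resolve_left hp⟩
  · have ht2 : #(nb G p Y) = 2 := by omega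
    obtain ⟨q, hq⟩ := Finset.card_pos.1 (show 0 < #(nb G p Y) by omega)
    rw [mem_nb] at hq
    exact ⟨q, _, _, (hmn.symm.swap C.ncol2 ht2 hq.1 hq.2).1.symm, (C.low_or hq.2).resolve_left hp⟩

theorem Crit.false (C : Crit G k) : False := by
  have key : ∀ n, ∃ p X Y F1 F2, Inv G k p X Y F1 F2 ∧ n ≤ #F1 := by
    intro n
    induction n with
    | zero =>
      obtain ⟨p, X, Y, h, hp⟩ := C.start
      exact ⟨p, X, Y, ∅, ∅, ⟨h, hp, by simp, by simp, by simp, by simp, by simp⟩, by simp⟩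
    | succ n ih =>
      obtain ⟨p, X, Y, F1, F2, I, hn⟩ := ih
      obtain ⟨p', X', Y', F1', F2', I', hlt⟩ := C.step I
      exact ⟨p', X', Y', F1', F2', I', by omega⟩
  obtain ⟨p, X, Y, F1, F2, -, hn⟩ := key (Fintype.card V + 1)
  have := Finset.card_le_univ F1
  omega

end

lemma le_oreDeg {V : Type*} [Fintype V] {G : SimpleGraph V} [DecidableRel G.Adj] {x y : V}
    (h : G.Adj x y) : G.degree x + G.degree y ≤ oreDeg G := by
  have := Finset.le_sup (f := fun p : V × V =>
    if G.Adj p.1 p.2 then G.degree p.1 + G.degree p.2 else 0) (Finset.mem_univ (x, y))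
  simpa [h, oreDeg] using this

lemma exists_min_notcol {V : Type*} [Fintype V] {G : SimpleGraph V} {k : ℕ}
    (hn : ¬ Col G univ k) : ∃ S : Finset V, ¬ Col G S k ∧ ∀ T ⊂ S, Col G T k := by
  by_contra hcon
  push Not at hcon
  have : ∀ S : Finset V, Col G S k := by
    intro S
    induction S using Finset.strongInduction with
    | H S ih =>
      by_contra hS
      obtain ⟨T, hT, hT'⟩ := hcon S hS
      exact hT' (ih T hT)
  exact hn (this univ)

end OreBrooks

open OreBrooks in
/-- Every graph with at least one edge, `θ(G) ≥ 10` and `2·ω(G) ≤ θ(G)` is properly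
`⌊θ(G)/2⌋`-colorable. -/
theorem ore_brooks_coloring {V : Type*} [Fintype V] [DecidableEq V]
    (G : SimpleGraph V) [DecidableRel G.Adj]
    (hedge : G.edgeFinset.Nonempty)
    (hθ : 10 ≤ oreDeg G) (hω : 2 * G.cliqueNum ≤ oreDeg G) :
    G.Colorable (oreDeg G / 2) := by
  classical
  set k := oreDeg G / 2 with hk
  have hmain : Col G univ k := by
    by_contra hn
    obtain ⟨S, hS, hSmin⟩ := exists_min_notcol (G := G) (k := k) hn
    let H : SimpleGraph S := G.comap (fun v : S => (v : V))
    have hdeg : ∀ x : S, #(nb H x univ) ≤ G.degree x := by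
      intro x
      rw [← Finset.card_map (Function.Embedding.subtype (fun v => v ∈ S)),
        ← SimpleGraph.card_neighborFinset_eq_degree]
      apply Finset.card_le_card
      intro w hw
      simp only [Finset.mem_map, mem_nb] at hw
      obtain ⟨a, ha, rfl⟩ := hw
      rw [SimpleGraph.mem_neighborFinset]
      exact ha.2
    have C : Crit H k := by
      refine ⟨by omega, ?_, ?_, ?_, ?_⟩
      · rintro ⟨c, hc⟩
        apply hS
        refine ⟨fun v => if h : v ∈ S then c ⟨v, h⟩ else 0, ?_, ?_⟩
        · intro v hv
          simpa [hv] using hc.1 ⟨v, hv⟩ (by simp)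
        · intro u hu v hv huv
          simpa [hu, hv] using hc.2 ⟨u, hu⟩ (by simp) ⟨v, hv⟩ (by simp) huv
      · intro v
        obtain ⟨c, hc⟩ := hSmin (S.erase v) (Finset.erase_ssubset v.2)
        refine ⟨fun w => c w, ?_, ?_⟩
        · intro w hw
          refine hc.1 w ?_
          simp only [Finset.mem_erase, Finset.mem_univ, and_true] at hw
          simp [Subtype.coe_injective.ne hw]
        · intro u hu w hw huw
          simp only [Finset.mem_erase, Finset.mem_univ, and_true] at hu hw
          exact hc.2 u (by simp [Subtype.coe_injective.ne hu]) w
            (by simp [Subtype.coe_injective.ne hw]) huw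
      · intro x y hxy
        have h1 := hdeg x
        have h2 := hdeg y
        have h3 : G.degree x + G.degree y ≤ oreDeg G := le_oreDeg hxy
        omega
      · intro K hK hcl
        have h1 : G.IsClique (K.map (Function.Embedding.subtype (fun v => v ∈ S)) : Finset V) := by
          intro a ha b hb hab
          simp only [Finset.coe_map, Set.mem_image] at ha hb
          obtain ⟨a', ha', rfl⟩ := ha
          obtain ⟨b', hb', rfl⟩ := hb
          exact hcl a' ha' b' hb' (fun h => hab (by rw [h]))
        have h2 := h1.card_le_cliqueNum
        rw [Finset.card_map, hK] at h2
        omega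
    exact C.false
  obtain ⟨c, hc⟩ := hmain
  exact ⟨SimpleGraph.Coloring.mk (fun v => (⟨c v, hc.1 v (by simp)⟩ : Fin k)) (by
    intro u v huv h
    exact hc.2 u (by simp) v (by simp) huv (by simpa using h))⟩
end

section
/- Every finite simple graph G with at least one edge, θ(G) ≥ 18, and 2·ω(G) ≤ θ(G) is ⌊θ(G)/2⌋-choosable. -/
open SimpleGraph Finset

/-- `G` is `f`-choosable: for every assignment `L` of finite lists of natural numbers with
`|L v| = f v`, there is a proper coloring choosing colors from the lists. -/
def Choosable {V : Type*} (G : SimpleGraph V) (f : V → ℤ) : Prop :=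
  ∀ L : V → Finset ℕ, (∀ v, ((L v).card : ℤ) = f v) →
    ∃ c : V → ℕ, (∀ v, c v ∈ L v) ∧ ∀ x y, G.Adj x y → c x ≠ c y

namespace OB
section
open scoped Classical

/-- independent (no edges inside) -/
def Ind {V : Type*} (G : SimpleGraph V) (A : Finset V) : Prop :=
  ∀ x ∈ A, ∀ y ∈ A, ¬ G.Adj x y

/-- degree of `v` into `X` -/
noncomputable def dg {V : Type*} (G : SimpleGraph V) (X : Finset V) (v : V) : ℕ :=
  (X.filter (fun u => G.Adj v u)).card

def LCol {V : Type*} (G : SimpleGraph V) (L : V → Finset ℕ) (X : Finset V) : Prop :=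
  ∃ c : V → ℕ, (∀ v ∈ X, c v ∈ L v) ∧ ∀ x ∈ X, ∀ y ∈ X, G.Adj x y → c x ≠ c y

lemma bbs {V : Type*} (G : SimpleGraph V) (Out : V → V → Prop) :
    ∀ (n : ℕ) (W : Finset V), W.card = n → ∀ L : V → Finset ℕ,
    (∀ Y ⊆ W, ∃ K ⊆ Y, Ind G K ∧ ∀ v ∈ Y, v ∉ K → ∃ u ∈ K, Out v u) →
    (∀ v ∈ W, (W.filter (fun u => Out v u)).card < (L v).card) → LCol G L W := by
  intro n
  induction n using Nat.strong_induction_on with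
  | _ n ih =>
  intro W hW L hker hL
  rcases W.eq_empty_or_nonempty with rfl | ⟨w, hw⟩
  · exact ⟨fun _ => 0, by simp, by simp⟩
  have h1 : 0 < (L w).card := lt_of_le_of_lt (Nat.zero_le _) (hL w hw)
  obtain ⟨α, hα⟩ := Finset.card_pos.mp h1
  obtain ⟨K, hKY, hKi, hKd⟩ := hker (W.filter (fun v => α ∈ L v)) (Finset.filter_subset _ _)
  have hKne : K.Nonempty := by
    by_cases h : w ∈ K
    · exact ⟨w, h⟩
    · obtain ⟨u, hu, _⟩ := hKd w (by simp [hw, hα]) h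
      exact ⟨u, hu⟩
  have hKW : K ⊆ W := hKY.trans (Finset.filter_subset _ _)
  have hlt : (W \ K).card < n := by
    rw [← hW]
    apply Finset.card_lt_card
    refine ⟨Finset.sdiff_subset, fun h => ?_⟩
    obtain ⟨x, hx⟩ := hKne
    exact (Finset.mem_sdiff.mp (h (hKW hx))).2 hx
  obtain ⟨c, hc1, hc2⟩ := ih _ hlt (W \ K) rfl (fun v => (L v).erase α)
    (fun Y hY => hker Y (hY.trans Finset.sdiff_subset)) (by
      intro v hv
      obtain ⟨hvW, hvK⟩ := Finset.mem_sdiff.mp hv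
      have h0 := hL v hvW
      have hsub : (W \ K).filter (fun u => Out v u) ⊆ W.filter (fun u => Out v u) :=
        Finset.filter_subset_filter _ Finset.sdiff_subset
      by_cases hα' : α ∈ L v
      · obtain ⟨u, hu, huo⟩ := hKd v (by simp [hvW, hα']) hvK
        have : ((W \ K).filter (fun u => Out v u)).card < (W.filter (fun u => Out v u)).card := by
          apply Finset.card_lt_card
          refine ⟨hsub, fun h => ?_⟩
          have := h (Finset.mem_filter.mpr ⟨hKW hu, huo⟩)
          simp [hu] at this
        rw [Finset.card_erase_of_mem hα']
        omega
      · rw [Finset.erase_eq_of_notMem hα']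
        exact lt_of_le_of_lt (Finset.card_le_card hsub) h0)
  refine ⟨fun v => if v ∈ K then α else c v, ?_, ?_⟩
  · intro v hv
    by_cases h : v ∈ K
    · simpa [h] using (Finset.mem_filter.mp (hKY h)).2
    · simpa [h] using Finset.mem_of_mem_erase (hc1 v (by simp [hv, h]))
  · intro x hx y hy hxy
    by_cases h : x ∈ K <;> by_cases h' : y ∈ K
    · exact absurd hxy (hKi x h y h')
    · have := hc1 y (by simp [hy, h'])
      simp only [h, h', if_true, if_false]
      exact fun e => Finset.ne_of_mem_erase this e.symm
    · have := hc1 x (by simp [hx, h])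
      simp only [h, h', if_true, if_false]
      exact fun e => Finset.ne_of_mem_erase this e
    · simpa [h, h'] using hc2 x (by simp [hx, h]) y (by simp [hy, h']) hxy

lemma kernel {V : Type*} (G : SimpleGraph V) (A : Finset V) (hA : Ind G A)
    (In : V → Finset V) (h1 : ∀ v, ∀ u ∈ In v, (v ∈ A ↔ u ∉ A))
    (h2 : ∀ v, ∀ u ∈ In v, v ∉ In u) :
    ∀ (n : ℕ) (Y : Finset V), Y.card = n →
      ∃ K ⊆ Y, Ind G K ∧ ∀ v ∈ Y, v ∉ K → ∃ u ∈ K, G.Adj v u ∧ u ∉ In v := by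
  intro n
  induction n using Nat.strong_induction_on with
  | _ n ih =>
  intro Y hY
  by_cases hb : ∀ b ∈ Y, b ∉ A → ∃ a ∈ Y, a ∈ A ∧ G.Adj b a ∧ a ∉ In b
  · refine ⟨Y.filter (· ∈ A), Finset.filter_subset _ _, ?_, ?_⟩
    · intro x hx y hy
      exact hA x (Finset.mem_filter.mp hx).2 y (Finset.mem_filter.mp hy).2
    · intro v hv hvK
      obtain ⟨a, ha, haA, h⟩ := hb v hv (fun h => hvK (by simp [hv, h]))
      exact ⟨a, by simp [ha, haA], h⟩
  · push Not at hb
    obtain ⟨b, hbY, hbA, hb⟩ := hb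
    have hlt : (Y.filter (fun u => u ≠ b ∧ ¬ G.Adj u b)).card < n := by
      rw [← hY]
      apply Finset.card_lt_card
      refine ⟨Finset.filter_subset _ _, fun h => ?_⟩
      have := h hbY
      simp at this
    obtain ⟨K, hKY, hKi, hKd⟩ := ih _ hlt _ rfl
    have hKn : ∀ x ∈ K, x ∈ Y ∧ x ≠ b ∧ ¬ G.Adj x b := fun x hx => by
      simpa using hKY hx
    refine ⟨insert b K, ?_, ?_, ?_⟩
    · intro x hx
      rcases Finset.mem_insert.mp hx with rfl | hx
      · exact hbY
      · exact (hKn x hx).1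
    · intro x hx y hy
      rcases Finset.mem_insert.mp hx with hxb | hx <;> rcases Finset.mem_insert.mp hy with hyb | hy
      · subst hxb; subst hyb; exact G.loopless.irrefl _
      · rw [hxb]; exact fun h => (hKn y hy).2.2 h.symm
      · rw [hyb]; exact (hKn x hx).2.2
      · exact hKi x hx y hy
    · intro v hv hvK
      have hvb : v ≠ b := fun h => hvK (by simp [h])
      have hvK' : v ∉ K := fun h => hvK (by simp [h])
      by_cases hadj : G.Adj v b
      · refine ⟨b, by simp, hadj, ?_⟩
        intro hin
        by_cases hvA : v ∈ A
        · exact h2 v b hin (hb v hv hvA hadj.symm)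
        · exact hvA ((h1 v b hin).mpr hbA)
      · obtain ⟨u, hu, h⟩ := hKd v (by simp [hv, hvb, hadj]) hvK'
        exact ⟨u, by simp [hu], h⟩

lemma dg_split {V : Type*} (G : SimpleGraph V) {W X : Finset V} (h : W ⊆ X) (v : V) :
    dg G X v = dg G W v + dg G (X \ W) v := by
  unfold dg
  rw [← Finset.card_union_of_disjoint]
  · rw [← Finset.filter_union, Finset.union_sdiff_of_subset h]
  · exact Finset.disjoint_filter_filter Finset.disjoint_sdiff

lemma dg_mono {V : Type*} (G : SimpleGraph V) {W X : Finset V} (h : W ⊆ X) (v : V) :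
    dg G W v ≤ dg G X v := by
  rw [dg_split G h]; omega

/-- extension of a coloring from `X \ W` -/
lemma extend {V : Type*} (G : SimpleGraph V) (L : V → Finset ℕ) {W X : Finset V}
    (h1 : LCol G L (X \ W))
    (h2 : ∀ L' : V → Finset ℕ, (∀ v ∈ W, (L v).card ≤ (L' v).card + dg G (X \ W) v) →
      LCol G L' W) : LCol G L X := by
  obtain ⟨c, hc1, hc2⟩ := h1
  obtain ⟨c', hc1', hc2'⟩ := h2
    (fun v => L v \ (((X \ W).filter (fun u => G.Adj v u)).image c)) (by
      intro v hv
      have := Finset.le_card_sdiff (((X \ W).filter (fun u => G.Adj v u)).image c) (L v)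
      have h3 : (((X \ W).filter (fun u => G.Adj v u)).image c).card ≤ dg G (X \ W) v :=
        Finset.card_image_le
      omega)
  have key : ∀ x ∈ W, ∀ y ∈ X, y ∉ W → G.Adj x y → c' x ≠ c y := by
    intro x hx y hy hyW hxy e
    have := (Finset.mem_sdiff.mp (hc1' x hx)).2
    exact this (Finset.mem_image.mpr ⟨y, by simp [hy, hyW, hxy], e.symm⟩)
  refine ⟨fun v => if v ∈ W then c' v else c v, ?_, ?_⟩
  · intro v hv
    by_cases h : v ∈ W
    · simpa [h] using (Finset.mem_sdiff.mp (hc1' v h)).1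
    · simpa [h] using hc1 v (by simp [hv, h])
  · intro x hx y hy hxy
    by_cases h : x ∈ W <;> by_cases h' : y ∈ W <;> simp only [h, h', if_true, if_false]
    · exact hc2' x h y h' hxy
    · exact key x h y hy h' hxy
    · exact (key y h' x hx h hxy.symm).symm
    · exact hc2 x (by simp [hx, h]) y (by simp [hy, h']) hxy

/-- edges between `A ∩ W` and `W \ A` -/
noncomputable def EE {V : Type*} (G : SimpleGraph V) (A W : Finset V) : Finset (V × V) :=
  (W ×ˢ W).filter (fun p => p.1 ∈ A ∧ p.2 ∉ A ∧ G.Adj p.1 p.2)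

lemma sum_eq_EE {V : Type*} (G : SimpleGraph V) (A W : Finset V) (hA : Ind G A) (hAW : A ⊆ W) :
    ∑ v ∈ A, dg G W v = (EE G A W).card := by
  have : EE G A W = (A.sigma (fun v => W.filter (fun u => G.Adj v u))).map
      ⟨fun p => (p.1, p.2), fun p q h => by
        rcases p with ⟨a, b⟩; rcases q with ⟨c, d⟩; simp at h; simp [h]⟩ := by
    ext ⟨a, b⟩
    simp only [EE, Finset.mem_filter, Finset.mem_product, Finset.mem_map, Finset.mem_sigma]
    constructor
    · rintro ⟨⟨ha, hb⟩, haA, hbA, hab⟩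
      exact ⟨⟨a, b⟩, ⟨haA, hb, hab⟩, rfl⟩
    · rintro ⟨⟨a', b'⟩, ⟨h1, h2, h3⟩, h4⟩
      obtain ⟨rfl, rfl⟩ := Prod.mk.inj h4
      simp only at h1 h2 h3
      exact ⟨⟨hAW h1, h2⟩, h1, fun h => hA _ h1 _ h h3, h3⟩
  rw [this, Finset.card_map, Finset.card_sigma]
  rfl

/-- the orientation exists on a subset -/
lemma orient {V : Type*} (G : SimpleGraph V) (A : Finset V) (g : V → ℕ) :
    ∀ (n : ℕ) (W : Finset V), W.card = n → W.Nonempty → ∑ v ∈ W, g v ≤ (EE G A W).card →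
    ∃ W' ⊆ W, W'.Nonempty ∧ ∃ In : V → Finset V,
      (∀ v, ∀ u ∈ In v, (v ∈ A ↔ u ∉ A)) ∧ (∀ v, ∀ u ∈ In v, v ∉ In u) ∧
      (∀ v, ∀ u ∈ In v, u ∈ W' ∧ G.Adj v u) ∧ ∀ v ∈ W', g v ≤ (In v).card := by
  intro n
  induction n using Nat.strong_induction_on with
  | _ n ih =>
  intro W hW hne hsum
  set t : V → Finset (V × V) := fun v => (EE G A W).filter (fun p => p.1 = v ∨ p.2 = v) with ht
  by_cases hall : ∀ S ⊆ W, ∑ v ∈ S, g v ≤ (S.biUnion t).card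
  · let ι := Σ v : {v // v ∈ W}, Fin (g v)
    have hH : ∀ s : Finset ι, s.card ≤ (s.biUnion (fun i : ι => t i.1.1)).card := by
      intro s
      have e1 : s.biUnion (fun i : ι => t i.1.1) = (s.image (fun i : ι => i.1.1)).biUnion t := by
        rw [Finset.image_biUnion]
      rw [e1]
      refine le_trans ?_ (hall _ ?_)
      · have : s ⊆ (s.image (fun i : ι => i.1)).sigma (fun v => (Finset.univ : Finset (Fin (g v)))) := by
          intro i hi
          exact Finset.mem_sigma.mpr ⟨Finset.mem_image_of_mem _ hi, Finset.mem_univ _⟩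
        refine (Finset.card_le_card this).trans ?_
        rw [Finset.card_sigma]
        simp only [Finset.card_univ, Fintype.card_fin]
        have e2 : s.image (fun i : ι => i.1.1) = (s.image (fun i : ι => i.1)).map
            (Function.Embedding.subtype _) := by
          ext x; simp
        rw [e2, Finset.sum_map]
        exact le_rfl
      · intro x hx
        obtain ⟨i, _, rfl⟩ := Finset.mem_image.mp hx
        exact i.1.2
    obtain ⟨f, hf, hft⟩ := (Finset.all_card_le_biUnion_card_iff_exists_injective _).mp hH
    have hft' : ∀ i : ι, ((f i).1 ∈ W ∧ (f i).2 ∈ W) ∧ ((f i).1 ∈ A ∧ (f i).2 ∉ A ∧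
        G.Adj (f i).1 (f i).2) ∧ ((f i).1 = i.1.1 ∨ (f i).2 = i.1.1) := by
      intro i
      have := hft i
      simp only [ht, EE, Finset.mem_filter, Finset.mem_product] at this
      tauto
    let In : V → Finset V := fun v => if h : v ∈ W then
      (Finset.univ : Finset (Fin (g v))).image
        (fun j => if v ∈ A then (f ⟨⟨v, h⟩, j⟩).2 else (f ⟨⟨v, h⟩, j⟩).1) else ∅
    have hIn : ∀ v u, u ∈ In v → ∃ h : v ∈ W, ∃ j, (v ∈ A ∧ f ⟨⟨v, h⟩, j⟩ = (v, u)) ∨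
        (v ∉ A ∧ f ⟨⟨v, h⟩, j⟩ = (u, v)) := by
      intro v u hu
      by_cases h : v ∈ W
      · simp only [In, h, dif_pos, Finset.mem_image, Finset.mem_univ, true_and] at hu
        obtain ⟨j, hj⟩ := hu
        refine ⟨h, j, ?_⟩
        have h3 := hft' ⟨⟨v, h⟩, j⟩
        by_cases hv : v ∈ A
        · left
          simp only [hv, if_true] at hj
          refine ⟨hv, ?_⟩
          rcases h3.2.2 with h4 | h4
          · exact Prod.ext h4 hj
          · exact absurd hv ((show _ = v from h4) ▸ h3.2.1.2.1)
        · right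
          simp only [hv, if_false] at hj
          refine ⟨hv, ?_⟩
          rcases h3.2.2 with h4 | h4
          · exact absurd ((show _ = v from h4) ▸ h3.2.1.1) hv
          · exact Prod.ext hj h4
      · simp [In, h] at hu
    refine ⟨W, subset_rfl, hne, In, ?_, ?_, ?_, ?_⟩
    · intro v u hu
      obtain ⟨h, j, h3⟩ := hIn v u hu
      have h4 := hft' ⟨⟨v, h⟩, j⟩
      rcases h3 with ⟨a, e⟩ | ⟨a, e⟩ <;> simp only [e] at h4 <;> tauto
    · intro v u hu hv
      obtain ⟨h, j, h3⟩ := hIn v u hu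
      obtain ⟨h', j', h3'⟩ := hIn u v hv
      have h4 := hft' ⟨⟨v, h⟩, j⟩
      have key : f ⟨⟨v, h⟩, j⟩ = f ⟨⟨u, h'⟩, j'⟩ → False := by
        intro e
        have := congrArg (fun i : ι => i.1.1) (hf e)
        simp only at this
        subst this
        rcases h3 with ⟨a, e⟩ | ⟨a, e⟩ <;> simp only [e] at h4 <;> tauto
      rcases h3 with ⟨a, e⟩ | ⟨a, e⟩ <;> rcases h3' with ⟨a', e'⟩ | ⟨a', e'⟩
      · simp only [e] at h4; tauto
      · exact key (e.trans e'.symm)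
      · exact key (e.trans e'.symm)
      · simp only [e] at h4; tauto
    · intro v u hu
      obtain ⟨h, j, h3⟩ := hIn v u hu
      have h4 := hft' ⟨⟨v, h⟩, j⟩
      rcases h3 with ⟨a, e⟩ | ⟨a, e⟩ <;> simp only [e] at h4
      · exact ⟨h4.1.2, h4.2.1.2.2⟩
      · exact ⟨h4.1.1, h4.2.1.2.2.symm⟩
    · intro v hv
      simp only [In, hv, dif_pos]
      rw [Finset.card_image_of_injective]
      · simp
      · intro j j' hjj
        have h3 := hft' ⟨⟨v, hv⟩, j⟩
        have h3' := hft' ⟨⟨v, hv⟩, j'⟩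
        have : f ⟨⟨v, hv⟩, j⟩ = f ⟨⟨v, hv⟩, j'⟩ := by
          by_cases hvA : v ∈ A
          · simp only [hvA, if_true] at hjj
            refine Prod.ext ?_ hjj
            rcases h3.2.2 with h4 | h4
            · rcases h3'.2.2 with h5 | h5
              · exact h4.trans h5.symm
              · exact absurd hvA ((show _ = v from h5) ▸ h3'.2.1.2.1)
            · exact absurd hvA ((show _ = v from h4) ▸ h3.2.1.2.1)
          · simp only [hvA, if_false] at hjj
            refine Prod.ext hjj ?_
            rcases h3.2.2 with h4 | h4
            · exact absurd ((show _ = v from h4) ▸ h3.2.1.1) hvA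
            · rcases h3'.2.2 with h5 | h5
              · exact absurd ((show _ = v from h5) ▸ h3'.2.1.1) hvA
              · exact h4.trans h5.symm
        have := hf this
        exact eq_of_heq (Sigma.mk.inj this).2
  · push Not at hall
    obtain ⟨S, hSW, hS⟩ := hall
    have hSne : S.Nonempty := by
      rcases S.eq_empty_or_nonempty with rfl | h
      · simp at hS
      · exact h
    have e1 : EE G A (W \ S) = EE G A W \ S.biUnion t := by
      ext ⟨a, b⟩
      simp only [EE, ht, Finset.mem_filter, Finset.mem_product, Finset.mem_sdiff,
        Finset.mem_biUnion]
      constructor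
      · rintro ⟨⟨⟨h1, h2⟩, h3, h4⟩, h5⟩
        refine ⟨⟨⟨h1, h3⟩, h5⟩, ?_⟩
        rintro ⟨v, hv, _, rfl | rfl⟩
        · exact h2 hv
        · exact h4 hv
      · rintro ⟨⟨⟨h1, h3⟩, h5⟩, h6⟩
        refine ⟨⟨⟨h1, fun h => h6 ⟨a, h, ⟨⟨h1, h3⟩, h5⟩, Or.inl rfl⟩⟩, h3, fun h => h6 ⟨b, h, ⟨⟨h1, h3⟩, h5⟩, Or.inr rfl⟩⟩, h5⟩
    have e2 : (S.biUnion t) ⊆ EE G A W := by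
      intro p hp
      obtain ⟨v, _, hv⟩ := Finset.mem_biUnion.mp hp
      exact (Finset.mem_filter.mp hv).1
    have e3 := Finset.card_sdiff_of_subset e2
    rw [← e1] at e3
    have e4 := Finset.sum_sdiff hSW (f := g)
    have hlt : (W \ S).card < n := by
      rw [← hW]
      apply Finset.card_lt_card
      refine ⟨Finset.sdiff_subset, fun h => ?_⟩
      obtain ⟨x, hx⟩ := hSne
      exact (Finset.mem_sdiff.mp (h (hSW hx))).2 hx
    have hne' : (W \ S).Nonempty := by
      by_contra hcon
      rw [Finset.not_nonempty_iff_eq_empty] at hcon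
      rw [hcon] at e3 e4
      have e5 : (EE G A ∅) = ∅ := by simp [EE]
      rw [e5] at e3
      have e6 := Finset.card_le_card e2
      simp only [Finset.card_empty, Finset.sum_empty] at e3 e4
      omega
    obtain ⟨W', hW', h⟩ := ih _ hlt (W \ S) rfl hne' (by omega)
    exact ⟨W', hW'.trans Finset.sdiff_subset, h⟩

/-- the key inequality (*) for a minimal non-colorable set -/
lemma star {V : Type*} (G : SimpleGraph V) (L : V → Finset ℕ) (X : Finset V) (k : ℕ)
    (hL : ∀ v, (L v).card = k) (hX : ¬ LCol G L X) (hmin : ∀ Y ⊂ X, LCol G L Y)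
    (g : V → ℕ) (hg : ∀ v ∈ X, dg G X v + 1 ≤ k + g v) (W : Finset V) (hWX : W ⊆ X)
    (hW : W.Nonempty) (A : Finset V) (hAW : A ⊆ W) (hA : Ind G A) :
    ∑ v ∈ A, dg G W v < ∑ v ∈ W, g v := by
  by_contra hcon
  push Not at hcon
  rw [sum_eq_EE G A W hA hAW] at hcon
  obtain ⟨W', hW'W, hW'ne, In, h1, h2, h3, h4⟩ := orient G A g _ W rfl hW hcon
  have hW'X := hW'W.trans hWX
  apply hX
  apply extend G L (W := W')
  · apply hmin
    refine ⟨Finset.sdiff_subset, fun h => ?_⟩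
    obtain ⟨x, hx⟩ := hW'ne
    exact (Finset.mem_sdiff.mp (h (hW'X hx))).2 hx
  · intro L' hL'
    apply bbs G (fun v u => G.Adj v u ∧ u ∉ In v) _ W' rfl L'
    · intro Y _
      exact kernel G A hA In h1 h2 _ Y rfl
    · intro v hv
      have e1 := hL' v hv
      rw [hL] at e1
      have e2 := dg_split G hW'X v
      have e3 := hg v (hW'X hv)
      have e4 := h4 v hv
      have e5 : (W'.filter (fun u => G.Adj v u ∧ u ∉ In v)) =
          W'.filter (fun u => G.Adj v u) \ In v := by
        ext u; simp; tauto
      have e6 : In v ⊆ W'.filter (fun u => G.Adj v u) := by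
        intro u hu
        simpa using h3 v u hu
      have e7 := Finset.card_sdiff_of_subset e6
      have e8 := Finset.card_le_card e6
      have e9 : (W'.filter (fun u => G.Adj v u ∧ u ∉ In v)).card < (L' v).card := by
        rw [e5, e7]
        unfold dg at *
        omega
      convert e9

end
end OB

namespace OB
section
open scoped Classical

def Pth {V : Type*} (G : SimpleGraph V) (a : V) (l : List V) (b : V) : Prop :=
  List.IsChain G.Adj (a :: (l ++ [b]))

lemma pth_nil {V : Type*} (G : SimpleGraph V) (a b : V) : Pth G a [] b ↔ G.Adj a b := by
  simp [Pth]

lemma pth_cons {V : Type*} (G : SimpleGraph V) (a c b : V) (l : List V) :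
    Pth G a (c :: l) b ↔ G.Adj a c ∧ Pth G c l b := by
  simp [Pth]

lemma pth_append {V : Type*} (G : SimpleGraph V) (a c b : V) (p q : List V) :
    Pth G a (p ++ c :: q) b ↔ Pth G a p c ∧ Pth G c q b := by
  induction p generalizing a with
  | nil => simp [pth_nil, pth_cons]
  | cons d p ih => simp [pth_cons, ih, and_assoc]

lemma pth_rev {V : Type*} (G : SimpleGraph V) (a b : V) (p : List V) :
    Pth G a p.reverse b ↔ Pth G b p a := by
  induction p generalizing b with
  | nil => simp [pth_nil, G.adj_comm]
  | cons d p ih => simp [pth_append, pth_cons, pth_nil, ih, G.adj_comm, and_comm]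

/-- A cyclic list in `Lo`. -/
def Cyc {V : Type*} (G : SimpleGraph V) (Lo : Finset V) : List V → Prop
  | [] => False
  | (x :: l) => (∀ v ∈ x :: l, v ∈ Lo) ∧ (x :: l).Nodup ∧ Pth G x l x

lemma cyc_rot {V : Type*} (G : SimpleGraph V) (Lo : Finset V) (a b : List V)
    (h : Cyc G Lo (a ++ b)) : Cyc G Lo (b ++ a) := by
  cases a with
  | nil => simpa using h
  | cons x p =>
    cases b with
    | nil => simpa using h
    | cons y q =>
      obtain ⟨h1, h2, h3⟩ := h
      refine ⟨?_, ?_, ?_⟩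
      · intro v hv
        apply h1
        simp at hv ⊢
        tauto
      · have h2' : ((x :: p) ++ (y :: q)).Nodup := h2
        exact (List.perm_append_comm.nodup_iff).mp h2'
      · change Pth G x (p ++ y :: q) x at h3
        change Pth G y (q ++ x :: p) y
        rw [pth_append] at h3 ⊢
        exact h3.symm

def Clq {V : Type*} (G : SimpleGraph V) (l : List V) : Prop :=
  ∀ x ∈ l, ∀ y ∈ l, x ≠ y → G.Adj x y

lemma clq_perm {V : Type*} (G : SimpleGraph V) {l l' : List V} (h : l.Perm l') (hc : Clq G l) :
    Clq G l' := fun x hx y hy hne => hc x (h.mem_iff.mpr hx) y (h.mem_iff.mpr hy) hne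

def alt {V : Type*} : List V → List V
  | [] => []
  | [a] => [a]
  | a :: _ :: t => a :: alt t

lemma alt_sub {V : Type*} : ∀ l : List V, (alt l).Sublist l
  | [] => by simp [alt]
  | [a] => by simp [alt]
  | a :: b :: t => by
    simp only [alt]
    exact ((alt_sub t).cons b).cons_cons a

lemma alt_len {V : Type*} : ∀ l : List V, Even l.length → 2 * (alt l).length = l.length
  | [], _ => by simp [alt]
  | [a], h => by simp at h
  | a :: b :: t, h => by
    have := alt_len t (by simp at h; rcases h with ⟨r, hr⟩; exact ⟨r - 1, by omega⟩)
    simp [alt]; omega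

lemma alt_split {V : Type*} : ∀ (l : List V) (x : V), x ∈ alt l →
    ∃ s t, l = s ++ x :: t ∧ Even s.length
  | [], x, h => by simp [alt] at h
  | [a], x, h => by
    simp [alt] at h; subst h; exact ⟨[], [], by simp, by simp⟩
  | a :: b :: t, x, h => by
    simp only [alt, List.mem_cons] at h
    rcases h with rfl | h
    · exact ⟨[], b :: t, by simp, by simp⟩
    · obtain ⟨s, t', h1, h2⟩ := alt_split t x h
      refine ⟨a :: b :: s, t', by simp [h1], ?_⟩
      obtain ⟨r, hr⟩ := h2
      exact ⟨r + 1, by simp; omega⟩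

lemma alt_split2 {V : Type*} (G : SimpleGraph V) : ∀ (l : List V) (x y : V), x ∈ alt l → y ∈ alt l →
    G.Adj x y → ∃ s u p w q, l = s ++ u :: (p ++ w :: q) ∧ Even s.length ∧ Odd p.length ∧ G.Adj u w
  | [], x, y, h, _, _ => by simp [alt] at h
  | [a], x, y, h, h', hxy => by
    simp [alt] at h h'; subst h; subst h'; exact absurd hxy (G.irrefl)
  | a :: b :: t, x, y, h, h', hxy => by
    simp only [alt, List.mem_cons] at h h'
    rcases h with rfl | h
    · rcases h' with rfl | h'
      · exact absurd hxy (G.irrefl)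
      · obtain ⟨s, t', h1, h2⟩ := alt_split t y h'
        exact ⟨[], x, b :: s, y, t', by simp [h1], by simp, by simpa using h2.add_one, hxy⟩
    · rcases h' with rfl | h'
      · obtain ⟨s, t', h1, h2⟩ := alt_split t x h
        exact ⟨[], y, b :: s, x, t', by simp [h1], by simp, by simpa using h2.add_one, hxy.symm⟩
      · obtain ⟨s, u, p, w, q, h1, h2, h3, h4⟩ := alt_split2 G t x y h h' hxy
        refine ⟨a :: b :: s, u, p, w, q, by simp [h1], ?_, h3, h4⟩
        obtain ⟨r, hr⟩ := h2
        exact ⟨r + 1, by simp; omega⟩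

/-- even cycles have a same-parity chord -/
lemma even_chord {V : Type*} (G : SimpleGraph V) (Lo : Finset V)
    (hP : ∀ W ⊆ Lo, W.Nonempty → ∀ A ⊆ W, Ind G A → ∑ v ∈ A, dg G W v < W.card)
    (l : List V) (hl : Cyc G Lo l) (he : Even l.length) (h4 : 4 ≤ l.length) :
    ∃ s u p w q, l = s ++ u :: (p ++ w :: q) ∧ Even s.length ∧ Odd p.length ∧ G.Adj u w := by
  by_contra hcon
  have hnd : l.Nodup := by
    cases l with
    | nil => simp
    | cons a l => exact hl.2.1
  have hlo : ∀ v ∈ l, v ∈ Lo := by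
    cases l with
    | nil => simp
    | cons a l => exact hl.1
  have hind : Ind G (alt l).toFinset := by
    intro x hx y hy hxy
    simp at hx hy
    exact hcon (alt_split2 G l x y hx hy hxy)
  have h1 := hP l.toFinset (by intro v hv; simp at hv; exact hlo v hv)
    (by cases l with
        | nil => simp at h4
        | cons a l => exact ⟨a, by simp⟩) (alt l).toFinset
    (by intro v hv; simp at hv ⊢; exact (alt_sub l).subset hv) hind
  rw [List.toFinset_card_of_nodup hnd, ← alt_len l he] at h1
  have h2 : ∀ v ∈ (alt l).toFinset, 2 ≤ dg G l.toFinset v := by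
    intro v hv
    simp at hv
    obtain ⟨s, t, hst⟩ := List.append_of_mem ((alt_sub l).subset hv)
    subst hst
    have hc := cyc_rot G Lo _ _ hl
    have hlen : 3 ≤ (t ++ s).length := by simp at h4 ⊢; omega
    have hm : ∀ z, z ∈ t ++ s → z ∈ (s ++ v :: t).toFinset := by
      intro z hz; simp at hz ⊢; tauto
    simp only [List.cons_append] at hc
    generalize t ++ s = r at hc hlen hm
    rcases r with _ | ⟨c, r⟩
    · simp at hlen
    rcases List.eq_nil_or_concat r with rfl | ⟨r', d, rfl⟩
    · simp at hlen
    obtain ⟨_, g2, g3⟩ := hc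
    rw [List.concat_eq_append] at *
    rw [pth_cons, pth_append, pth_nil] at g3
    have hcd : c ≠ d := by
      rintro rfl
      simp at g2
    have : ({c, d} : Finset V) ⊆ (s ++ v :: t).toFinset.filter (fun u => G.Adj v u) := by
      intro z hz
      simp only [Finset.mem_insert, Finset.mem_singleton] at hz
      rw [Finset.mem_filter]
      rcases hz with rfl | rfl
      · exact ⟨hm _ (by simp), g3.1⟩
      · exact ⟨hm _ (by simp), g3.2.2.symm⟩
    have h5 := Finset.card_le_card this
    rw [Finset.card_pair hcd] at h5
    exact h5
  have h3 := Finset.sum_le_sum h2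
  rw [Finset.sum_const, List.toFinset_card_of_nodup (hnd.sublist (alt_sub l))] at h3
  simp at h3
  omega

lemma split2 {V : Type*} (p q s t : List V) (y u : V) (h : p ++ y :: q = s ++ u :: t)
    (hne : s.length ≠ p.length) :
    (∃ p2, p = s ++ u :: p2 ∧ t = p2 ++ y :: q) ∨ (∃ s2, q = s2 ++ u :: t ∧ s = p ++ y :: s2) := by
  induction p generalizing s with
  | nil =>
    cases s with
    | nil => simp at hne
    | cons a s =>
      simp at h
      right
      exact ⟨s, h.2, by simp [h.1]⟩
  | cons b p ih =>
    cases s with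
    | nil =>
      simp at h
      left
      exact ⟨p, by simp [h.1], h.2.symm⟩
    | cons a s =>
      simp at h hne
      rcases ih s h.2 hne with ⟨p2, h1, h2⟩ | ⟨s2, h1, h2⟩
      · left; exact ⟨p2, by simp [h1, h.1], h2⟩
      · right; exact ⟨s2, h1, by simp [h2, h.1]⟩

end
end OB

namespace OB
section
open scoped Classical

def HP {V : Type*} (G : SimpleGraph V) (Lo : Finset V) : Prop :=
  ∀ W ⊆ Lo, W.Nonempty → ∀ A ⊆ W, Ind G A → ∑ v ∈ A, dg G W v < W.card

def IHc {V : Type*} (G : SimpleGraph V) (Lo : Finset V) (n : ℕ) : Prop :=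
  ∀ x p y q, (x :: (p ++ y :: q)).length < n → Cyc G Lo (x :: (p ++ y :: q)) → p ≠ [] → q ≠ [] →
    G.Adj x y → Clq G (x :: (p ++ y :: q))

lemma cyc_cons {V : Type*} (G : SimpleGraph V) (Lo : Finset V) (x : V) (l : List V) :
    Cyc G Lo (x :: l) ↔ (∀ v ∈ x :: l, v ∈ Lo) ∧ (x :: l).Nodup ∧ Pth G x l x := Iff.rfl

lemma ch_rot {V : Type*} (G : SimpleGraph V) (Lo : Finset V) {n : ℕ} (ih : IHc G Lo n)
    (s p q : List V) (x y : V) (hl : (s ++ x :: (p ++ y :: q)).length < n)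
    (hc : Cyc G Lo (s ++ x :: (p ++ y :: q))) (hp : p ≠ []) (hq : q ++ s ≠ []) (h : G.Adj x y) :
    Clq G (s ++ x :: (p ++ y :: q)) := by
  have h1 := cyc_rot G Lo _ _ hc
  have h2 := ih x p y (q ++ s) (by simp at hl ⊢; omega) (by simpa using h1) hp hq h
  refine clq_perm G ?_ h2
  have : (x :: (p ++ y :: (q ++ s))) = (x :: (p ++ y :: q)) ++ s := by simp
  rw [this]
  exact List.perm_append_comm

lemma ev_clq {V : Type*} (G : SimpleGraph V) (Lo : Finset V) (hP : HP G Lo) {n : ℕ} (ih : IHc G Lo n)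
    (l : List V) (hl : Cyc G Lo l) (he : Even l.length) (h4 : 4 ≤ l.length) (hn : l.length < n) :
    Clq G l := by
  obtain ⟨s, x, p, y, q, rfl, h1, h2, h3⟩ := even_chord G Lo hP l hl he h4
  refine ch_rot G Lo ih s p q x y hn hl ?_ ?_ h3
  · rintro rfl; simp at h2
  · intro h
    simp at h
    obtain ⟨rfl, rfl⟩ := h
    simp at he h2
    grind

lemma four {V : Type*} (G : SimpleGraph V) (Lo : Finset V) (hP : HP G Lo) (a b c d : V)
    (h : Cyc G Lo [a, b, c, d]) : G.Adj a c := by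
  obtain ⟨s, x, p, y, q, h0, h1, h2, h3⟩ := even_chord G Lo hP _ h (by simp; decide) (by simp)
  have hl := congrArg List.length h0
  simp at hl
  have hs : s = [] := by
    rw [← List.length_eq_zero_iff]; grind
  subst hs
  have hp : p.length = 1 := by simp at hl; grind
  obtain ⟨e, rfl⟩ := List.length_eq_one_iff.mp hp
  simp at h0
  rw [h0.1, h0.2.2.1]; exact h3

lemma caseA {V : Type*} (G : SimpleGraph V) (Lo : Finset V) (hP : HP G Lo) {n : ℕ} (ih : IHc G Lo n)
    (v0 v1 v2 : V) (t : List V) (hn : (v0 :: v1 :: v2 :: t).length = n)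
    (hc : Cyc G Lo (v0 :: v1 :: v2 :: t)) (ht : t ≠ []) (hadj : G.Adj v0 v2) :
    Clq G (v0 :: v1 :: v2 :: t) := by
  obtain ⟨c1, c2, c3⟩ := (cyc_cons ..).mp hc
  rw [pth_cons, pth_cons] at c3
  have hC2 : Cyc G Lo (v0 :: v2 :: t) := by
    refine (cyc_cons ..).mpr ⟨?_, ?_, ?_⟩
    · intro v hv; apply c1; simp at hv ⊢; tauto
    · simp at c2 ⊢; tauto
    · rw [pth_cons]; exact ⟨hadj, c3.2.2⟩
  have hlen : (v0 :: v2 :: t).length < n := by simp at hn ⊢; omega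
  have ht0 : 0 < t.length := List.length_pos_iff.mpr ht
  by_cases hq : Clq G (v0 :: v2 :: t)
  · have h1 : ∀ w ∈ t, G.Adj v1 w := by
      intro w hw
      apply four G Lo hP v1 v0 w v2
      refine (cyc_cons ..).mpr ⟨?_, ?_, ?_⟩
      · intro v hv; apply c1; simp at hv ⊢; grind
      · simp at c2 ⊢; grind
      · simp only [pth_cons, pth_nil]
        refine ⟨c3.1.symm, hq _ (by simp) _ (by simp [hw]) ?_, hq _ (by simp [hw]) _ (by simp) ?_,
          c3.2.1.symm⟩
        · rintro rfl; simp at c2; grind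
        · rintro rfl; simp at c2; grind
    intro a ha b hb hab
    by_cases ha1 : a = v1
    · subst ha1
      simp at hb
      rcases hb with rfl | rfl | rfl | hb
      · exact c3.1.symm
      · exact absurd rfl hab
      · exact c3.2.1
      · exact h1 _ hb
    · by_cases hb1 : b = v1
      · subst hb1
        simp at ha
        rcases ha with rfl | rfl | rfl | ha
        · exact c3.1
        · exact absurd rfl hab
        · exact c3.2.1.symm
        · exact (h1 _ ha).symm
      · exact hq a (by simp at ha ⊢; tauto) b (by simp at hb ⊢; tauto) hab
  · exfalso
    have hodd : ¬ Even (v0 :: v2 :: t).length := by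
      intro he
      apply hq
      apply ev_clq G Lo hP ih _ hC2 he _ hlen
      simp at he ⊢
      grind
    have hrot : Cyc G Lo (v1 :: v2 :: (t ++ [v0])) := by
      have := cyc_rot G Lo [v0] _ hc
      simpa using this
    have hrot2 : Cyc G Lo (v2 :: (t ++ [v0])) := by
      have := cyc_rot G Lo [v0] _ hC2
      simpa using this
    have hperm2 : (v2 :: (t ++ [v0])).Perm (v0 :: v2 :: t) := by
      have : v2 :: (t ++ [v0]) = (v2 :: t) ++ [v0] := by simp
      rw [this]; exact List.perm_append_comm
    have hnl : n = t.length + 3 := by simp at hn; omega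
    have hto : Odd t.length := by simp at hodd; grind
    obtain ⟨s, x, p, y, q, h0, h1, h2, h3⟩ := even_chord G Lo hP _ hrot (by simp; grind)
      (by simp; omega)
    have hlq := congrArg List.length h0
    simp at hlq
    cases s with
    | cons a s =>
      simp only [List.cons_append, List.cons.injEq] at h0
      apply hq
      apply clq_perm G hperm2
      rw [h0.2]
      rw [h0.2] at hrot2
      apply ch_rot G Lo ih _ _ _ _ _ _ hrot2 _ _ h3
      · simp at hlq ⊢; omega
      · rintro rfl; simp at h2
      · intro h; simp at h; obtain ⟨rfl, rfl⟩ := h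
        simp at h1
    | nil =>
      simp only [List.nil_append, List.cons.injEq] at h0
      obtain ⟨rfl, h0⟩ := h0
      cases p with
      | nil => simp at h2
      | cons b t1 =>
      simp only [List.cons_append, List.cons.injEq] at h0
      obtain ⟨rfl, h0⟩ := h0
      rcases List.eq_nil_or_concat q with rfl | ⟨t2, d, rfl⟩
      · simp at h2 hlq; grind
      rw [List.concat_eq_append] at *
      have h0' : t ++ [v0] = (t1 ++ y :: t2) ++ [d] := by simpa using h0
      obtain ⟨ht12, hd⟩ := List.append_inj' h0' (by simp)
      simp at hd
      subst hd
      subst ht12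
      rw [pth_append] at c3
      have hvw : (t2 ≠ [] ∧ G.Adj v0 y) ∨ (t2 = [] ∧ G.Adj v2 y) := by
        by_cases ht2 : t2 = []
        · right
          refine ⟨ht2, ?_⟩
          subst ht2
          apply four G Lo hP v2 v0 y v1
          refine (cyc_cons ..).mpr ⟨?_, ?_, ?_⟩
          · intro v hv; apply c1; simp at hv ⊢; grind
          · simp at c2 ⊢; grind
          · simp only [pth_cons, pth_nil] at c3 ⊢
            exact ⟨hadj.symm, c3.2.2.2.symm, h3.symm, c3.2.1⟩
        · left
          refine ⟨ht2, ?_⟩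
          have ht20 : 0 < t2.length := List.length_pos_iff.mpr ht2
          have hZ : Clq G (v1 :: ([v0] ++ v2 :: (t1 ++ [y]))) := by
            apply ih
            · simp at hnl ⊢; omega
            · refine (cyc_cons ..).mpr ⟨?_, ?_, ?_⟩
              · intro v hv; apply c1; simp at hv ⊢; grind
              · simp [List.nodup_append] at c2 ⊢; grind
              · simp only [pth_cons, pth_nil, pth_append]
                exact ⟨⟨c3.1.symm, hadj⟩, c3.2.2.1, h3.symm⟩
            · simp
            · simp
            · exact c3.2.1
          apply hZ _ (by simp) _ (by simp)
          rintro rfl; simp at c2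
      rcases hvw with ⟨ht2, hvw⟩ | ⟨ht2, hvw⟩
      · apply hq
        exact ch_rot G Lo ih [] (v2 :: t1) t2 v0 y hlen hC2 (by simp) (by simpa using ht2) hvw
      · apply hq
        by_cases ht1 : t1 = []
        · subst ht1
          subst ht2
          simp only [pth_nil] at c3
          have := c3.2.2.2.symm
          intro a ha b hb hab
          simp at ha hb
          rcases ha with rfl | rfl | rfl <;> rcases hb with rfl | rfl | rfl <;>
            simp_all [G.adj_comm]
        · exact ch_rot G Lo ih [v0] t1 t2 v2 y hlen hC2 ht1 (by simp) hvw

/-- Within a cyclic list `l` of length `n` that is not a clique, chords are long and odd. -/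
lemma f1 {V : Type*} (G : SimpleGraph V) (Lo : Finset V) (hP : HP G Lo) {n : ℕ} (ih : IHc G Lo n)
    (x y : V) (p q : List V) (hn : (x :: (p ++ y :: q)).length = n)
    (hc : Cyc G Lo (x :: (p ++ y :: q))) (hp : p ≠ []) (hq : q ≠ []) (h : G.Adj x y)
    (hncl : ¬ Clq G (x :: (p ++ y :: q))) : Odd p.length ∧ 3 ≤ p.length ∧
      ¬ Clq G (x :: (p ++ [y])) := by
  have hq0 : 0 < q.length := List.length_pos_iff.mpr hq
  have hp0 : 0 < p.length := List.length_pos_iff.mpr hp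
  have hp1 : p.length ≠ 1 := by
    intro h1
    obtain ⟨a, rfl⟩ := List.length_eq_one_iff.mp h1
    exact hncl (caseA G Lo hP ih x a y q hn hc hq h)
  have hcl : ¬ Clq G (x :: (p ++ [y])) := by
    intro hcl
    rcases p with _ | ⟨a, _ | ⟨b, p⟩⟩
    · exact hp rfl
    · exact hp1 rfl
    · refine hncl (caseA G Lo hP ih x a b (p ++ y :: q) hn hc (by simp) (hcl _ (by simp) _ (by simp) ?_))
      have := hc.2.1
      rintro rfl
      simp at this
  have hodd : Odd p.length := by
    by_contra he
    apply hcl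
    apply ev_clq G Lo hP ih
    · obtain ⟨c1, c2, c3⟩ := (cyc_cons ..).mp hc
      rw [pth_append] at c3
      refine (cyc_cons ..).mpr ⟨?_, ?_, ?_⟩
      · intro v hv; apply c1; simp at hv ⊢; tauto
      · refine List.Nodup.sublist ?_ c2
        apply List.Sublist.cons_cons
        apply List.Sublist.append_left
        simp
      · rw [pth_append, pth_nil]; exact ⟨c3.1, h.symm⟩
    · simp; grind
    · simp; grind
    · simp at hn ⊢; omega
  refine ⟨hodd, by grind, hcl⟩

lemma inside {V : Type*} (G : SimpleGraph V) (Lo : Finset V) (hP : HP G Lo) {n : ℕ} (ih : IHc G Lo n)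
    (x y : V) (p q : List V) (hn : (x :: (p ++ y :: q)).length = n)
    (hc : Cyc G Lo (x :: (p ++ y :: q))) (hq : q ≠ []) (h : G.Adj x y)
    (hncl : ¬ Clq G (x :: (p ++ y :: q))) (s m r : List V) (u w : V)
    (hpp : p = s ++ u :: (m ++ w :: r)) (hm : m ≠ []) : ¬ G.Adj u w := by
  intro huw
  have hq0 : 0 < q.length := List.length_pos_iff.mpr hq
  refine (f1 G Lo hP ih x y p q hn hc (by simp [hpp]) hq h hncl).2.2 ?_
  have hc' : Cyc G Lo (x :: (p ++ [y])) := by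
    obtain ⟨c1, c2, c3⟩ := (cyc_cons ..).mp hc
    rw [pth_append] at c3
    refine (cyc_cons ..).mpr ⟨?_, ?_, ?_⟩
    · intro v hv; apply c1; simp at hv ⊢; tauto
    · refine List.Nodup.sublist ?_ c2
      apply List.Sublist.cons_cons
      apply List.Sublist.append_left
      simp
    · rw [pth_append, pth_nil]; exact ⟨c3.1, h.symm⟩
  have e : (x :: (p ++ [y])) = (x :: s) ++ u :: (m ++ w :: (r ++ [y])) := by simp [hpp]
  have hl : (x :: (p ++ [y])).length < n := by simp at hn ⊢; omega
  rw [e] at hc' hl ⊢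
  exact ch_rot G Lo ih _ _ _ _ _ hl hc' hm (by simp) huw

set_option maxHeartbeats 2000000 in
lemma hc_main {V : Type*} (G : SimpleGraph V) (Lo : Finset V) (hP : HP G Lo) (n : ℕ) :
    ∀ x p y q, (x :: (p ++ y :: q)).length = n → Cyc G Lo (x :: (p ++ y :: q)) → p ≠ [] → q ≠ [] →
    G.Adj x y → Clq G (x :: (p ++ y :: q)) := by
  induction n using Nat.strong_induction_on with
  | _ n ih0 =>
  have ih : IHc G Lo n := fun x p y q hl => ih0 _ hl x p y q rfl
  intro x p y q hn hc hp hq h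
  by_contra hncl
  have hperm : ∀ a b : List V, a ++ b = x :: (p ++ y :: q) → ¬ Clq G (b ++ a) := by
    intro a b hab hcl
    exact hncl (clq_perm G (hab ▸ List.perm_append_comm) hcl)
  have hrot : ∀ a b : List V, a ++ b = x :: (p ++ y :: q) → Cyc G Lo (b ++ a) := by
    intro a b hab
    apply cyc_rot; rw [hab]; exact hc
  have e1 : (x :: p) ++ (y :: q) = x :: (p ++ y :: q) := by simp
  have hn' : (y :: (q ++ x :: p)).length = n := by simp at hn ⊢; omega
  have hc' : Cyc G Lo (y :: (q ++ x :: p)) := by simpa using hrot _ _ e1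
  have hncl' : ¬ Clq G (y :: (q ++ x :: p)) := by simpa using hperm _ _ e1
  obtain ⟨p1, p2, _⟩ := f1 G Lo hP ih x y p q hn hc hp hq h hncl
  obtain ⟨q1, q2, _⟩ := f1 G Lo hP ih y x q p hn' hc' hq hp h.symm hncl'
  have hcr : Cyc G Lo (p ++ y :: (q ++ [x])) := by
    have := hrot [x] (p ++ y :: q) (by simp)
    simpa using this
  obtain ⟨s, u, m, w, r, h0, hs, hm, huw⟩ := even_chord G Lo hP _ hcr (by simp; grind)
    (by simp; omega)
  have hm0 : m ≠ [] := by rintro rfl; simp at hm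
  rcases split2 _ _ _ _ _ _ h0 (by grind) with ⟨p2', hp2, ht⟩ | ⟨s2, hs2, hs2'⟩
  · have l1 := congrArg List.length hp2
    simp at l1
    rcases split2 _ _ _ _ _ _ ht.symm (by grind) with ⟨p3, hp3, _⟩ | ⟨s2, hs2, hs2'⟩
    · exact inside G Lo hP ih x y p q hn hc hq h hncl s m p3 u w (by rw [hp2, hp3]) hm0 huw
    · -- crossing
      have l2 := congrArg List.length hs2'
      have l3 := congrArg List.length hs2
      simp at l2 l3
      rcases List.eq_nil_or_concat r with rfl | ⟨q2', d, rfl⟩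
      · exfalso; simp at l3; grind
      rw [List.concat_eq_append] at *
      have h5 : q ++ [x] = (s2 ++ w :: q2') ++ [d] := by simpa using hs2
      obtain ⟨hqq, hd⟩ := List.append_inj' h5 (by simp)
      simp at hd
      subst hd
      subst hqq
      subst hp2
      have es1 : Even s2.length := by grind
      have es2 : Even p2'.length := by grind
      have es3 : Even q2'.length := by grind
      have hxu : G.Adj x u → s = [] := by
        intro hxu
        by_contra hs0
        have e : x :: (s ++ u :: p2' ++ y :: (s2 ++ w :: q2')) =
          x :: (s ++ u :: (p2' ++ y :: (s2 ++ w :: q2'))) := by simp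
        have := f1 G Lo hP ih x u s (p2' ++ y :: (s2 ++ w :: q2')) (e ▸ hn) (e ▸ hc) hs0 (by simp)
          hxu (e ▸ hncl)
        grind
      have hn4 : 4 < n := by simp at hn; grind
      obtain ⟨c1, c2, c3⟩ := (cyc_cons ..).mp hc
      simp only [pth_append] at c3
      have hxu' : x ≠ u := by rintro rfl; simp at c2
      by_cases h22 : p2' = [] ∧ q2' = []
      · obtain ⟨rfl, rfl⟩ := h22
        simp only [pth_nil] at c3
        have hZ : Clq G [u, y, x, w] := by
          apply ev_clq G Lo hP ih _ _ (by simp; decide) (by simp) (by simpa using hn4)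
          refine (cyc_cons ..).mpr ⟨?_, ?_, ?_⟩
          · intro v hv; apply c1; simp at hv ⊢; tauto
          · simp [List.nodup_append] at c2 ⊢; grind
          · simp only [pth_cons, pth_nil]
            exact ⟨c3.1.2, h.symm, c3.2.2.symm, huw.symm⟩
        have := hxu (hZ _ (by simp) _ (by simp) hxu')
        subst this
        simp at p2
      · have hZ : Clq G (x :: (s ++ u :: (([] : List V) ++ w :: (s2.reverse ++ [y])))) := by
          apply ev_clq G Lo hP ih
          · refine (cyc_cons ..).mpr ⟨?_, ?_, ?_⟩
            · intro v hv; apply c1; simp at hv ⊢; tauto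
            · have hsub : (x :: (s ++ [u] ++ y :: (s2 ++ [w]))).Nodup := by
                refine List.Nodup.sublist ?_ c2
                simp [List.append_sublist_append_left]
              refine (List.Perm.nodup_iff ?_).mp hsub
              apply List.Perm.cons
              rw [List.append_assoc]
              apply List.Perm.append_left
              apply List.Perm.cons
              have : (w :: (s2.reverse ++ [y])) = (y :: (s2 ++ [w])).reverse := by simp
              simp only [List.nil_append]
              rw [this]
              exact (List.reverse_perm _).symm
            · simp only [pth_append, pth_nil, pth_rev]
              exact ⟨c3.1.1, huw, c3.2.1, h.symm⟩
          · simp; grind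
          · simp; omega
          · have : 0 < p2'.length ∨ 0 < q2'.length := by
              rw [List.length_pos_iff, List.length_pos_iff]; tauto
            simp at hn ⊢; omega
        have hs0 := hxu (hZ _ (by simp) _ (by simp) hxu')
        subst hs0
        have huy : G.Adj u y := hZ _ (by simp) _ (by simp) (by
          rintro rfl; simp at c2)
        have hp20 : p2' ≠ [] := by
          rintro rfl
          simp at p2
        have e : [x] ++ (u :: (p2' ++ y :: (s2 ++ w :: q2'))) =
          x :: (([] ++ u :: p2') ++ y :: (s2 ++ w :: q2')) := by simp
        have := f1 G Lo hP ih u y p2' ((s2 ++ w :: q2') ++ [x]) (by simp at hn ⊢; omega)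
          (by simpa using hrot _ _ e) hp20 (by simp) huy (by simpa using hperm _ _ e)
        grind
  · have l1 := congrArg List.length hs2
    have l2 := congrArg List.length hs2'
    simp at l1 l2
    rcases List.eq_nil_or_concat r with rfl | ⟨r', d, rfl⟩
    · simp at l1; grind
    rw [List.concat_eq_append] at *
    have h5 : q ++ [x] = (s2 ++ u :: (m ++ w :: r')) ++ [d] := by simpa using hs2
    obtain ⟨hqq, hd⟩ := List.append_inj' h5 (by simp)
    exact inside G Lo hP ih y x q p hn' hc' hp h.symm hncl' s2 m r' u w hqq hm0 huw

end
end OB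

namespace OB
section
open scoped Classical

lemma last_split {V : Type*} (P : V → Prop) (l : List V) (h : ∃ x ∈ l, P x) :
    ∃ s x t, l = s ++ x :: t ∧ P x ∧ ∀ z ∈ t, ¬ P z := by
  induction l with
  | nil => simp at h
  | cons a l ih =>
    by_cases h1 : ∃ x ∈ l, P x
    · obtain ⟨s, x, t, h2, h3, h4⟩ := ih h1
      exact ⟨a :: s, x, t, by simp [h2], h3, h4⟩
    · push Not at h1
      obtain ⟨x, hx, hPx⟩ := h
      rcases List.mem_cons.mp hx with rfl | hx
      · exact ⟨[], x, l, rfl, hPx, h1⟩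
      · exact absurd hPx (h1 x hx)

lemma clq_chain {V : Type*} (G : SimpleGraph V) (l : List V) (hn : l.Nodup) (hc : Clq G l) :
    List.IsChain G.Adj l := by
  apply List.Pairwise.isChain
  exact hn.imp_of_mem (fun ha hb hab => hc _ ha _ hb hab)

lemma gl {V : Type*} (G : SimpleGraph V) (Lo : Finset V) (hP : HP G Lo) (Y : Finset V) (hY : Y ⊆ Lo)
    (hne : Y.Nonempty) : (∃ v ∈ Y, dg G Y v ≤ 2) ∨ ∃ B ⊆ Y, 4 ≤ B.card ∧
      (∀ x ∈ B, ∀ y ∈ B, x ≠ y → G.Adj x y) ∧ ∃ w ∈ B, ∀ u ∈ B, u ≠ w → ∀ z ∈ Y, G.Adj u z → z ∈ B := by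
  let IsP : List V → Prop := fun l => l.Nodup ∧ (∀ v ∈ l, v ∈ Y) ∧ List.IsChain G.Adj l
  have hmax : ∃ l, IsP l ∧ ∀ l', IsP l' → l'.length ≤ l.length := by
    let S : Set ℕ := {n | ∃ l, IsP l ∧ l.length = n}
    have hS : BddAbove S := by
      refine ⟨Y.card, ?_⟩
      rintro n ⟨l, hl, rfl⟩
      rw [← List.toFinset_card_of_nodup hl.1]
      exact Finset.card_le_card (by intro v hv; simp at hv; exact hl.2.1 v hv)
    have hSn : S.Nonempty := ⟨0, [], ⟨by simp, by simp, by simp⟩, rfl⟩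
    obtain ⟨l, hl, hll⟩ := Nat.sSup_mem hSn hS
    exact ⟨l, hl, fun l' hl' => hll ▸ le_csSup hS ⟨l', hl', rfl⟩⟩
  obtain ⟨l, hl, hlm⟩ := hmax
  have hnb : ∀ v r, IsP (v :: r) → (v :: r).length = l.length → ∀ z ∈ Y, G.Adj v z → z ∈ r := by
    intro v r hvr hlen z hz hvz
    by_contra hzr
    have : IsP (z :: v :: r) := by
      refine ⟨?_, ?_, ?_⟩
      · rw [List.nodup_cons]
        refine ⟨?_, hvr.1⟩
        simp only [List.mem_cons, not_or]
        exact ⟨hvz.ne.symm, hzr⟩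
      · intro u hu
        rcases List.mem_cons.mp hu with rfl | hu
        · exact hz
        · exact hvr.2.1 u hu
      · rw [List.isChain_cons_cons]
        exact ⟨hvz.symm, hvr.2.2⟩
    have := hlm _ this
    simp at this hlen
    omega
  cases l with
  | nil =>
    obtain ⟨y, hy⟩ := hne
    have := hlm [y] ⟨by simp, by simpa using hy, by simp⟩
    simp at this
  | cons v0 rest =>
  by_cases hd : dg G Y v0 ≤ 2
  · left; exact ⟨v0, hl.2.1 v0 (by simp), hd⟩
  right
  have hN := hnb v0 rest hl rfl
  have hex : ∃ x ∈ rest, G.Adj v0 x := by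
    by_contra hcon
    push Not at hcon
    apply hd
    have : Y.filter (fun u => G.Adj v0 u) = ∅ := by
      apply Finset.filter_eq_empty_iff.mpr
      intro z hz hadj
      exact hcon z (hN z hz hadj) hadj
    unfold dg
    rw [this]; simp
  obtain ⟨t1, w, t2, hrest, hw, ht2⟩ := last_split (fun x => G.Adj v0 x) rest hex
  subst hrest
  obtain ⟨hl1, hl2, hl3⟩ := hl
  have hch : Pth G v0 t1 w ∧ List.IsChain G.Adj (w :: t2) := by
    have : v0 :: (t1 ++ w :: t2) = (v0 :: t1) ++ w :: t2 := by simp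
    rw [this, List.isChain_split] at hl3
    exact hl3
  -- a chord
  have hcB : ∃ a s c s', t1 = a :: (s ++ c :: s') ∧ G.Adj v0 c := by
    cases t1 with
    | nil =>
      exfalso; apply hd
      have : Y.filter (fun u => G.Adj v0 u) ⊆ {w} := by
        intro z hz
        rw [Finset.mem_filter] at hz
        have h1 := hN z hz.1 hz.2
        simp at h1 ⊢
        rcases h1 with h1 | h1
        · exact h1
        · exact absurd hz.2 (ht2 z h1)
      have := Finset.card_le_card this
      unfold dg
      simp at this
      omega
    | cons a t1 =>
      by_contra hcon
      push Not at hcon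
      apply hd
      have : Y.filter (fun u => G.Adj v0 u) ⊆ {a, w} := by
        intro z hz
        rw [Finset.mem_filter] at hz
        have h1 := hN z hz.1 hz.2
        simp at h1 ⊢
        rcases h1 with h1 | h1 | h1 | h1
        · exact Or.inl h1
        · obtain ⟨s, s', hss⟩ := List.append_of_mem h1
          exact absurd hz.2 (hcon a s z s' (by rw [hss]))
        · exact Or.inr h1
        · exact absurd hz.2 (ht2 z h1)
      exact (Finset.card_le_card this).trans Finset.card_le_two
  obtain ⟨a, s, c, s', rfl, hc⟩ := hcB
  set t1 := a :: (s ++ c :: s') with ht1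
  have hndB : (v0 :: (t1 ++ [w])).Nodup := by
    refine List.Nodup.sublist ?_ hl1
    apply List.Sublist.cons_cons
    apply List.Sublist.append_left
    simp
  have hmemB : ∀ z ∈ v0 :: (t1 ++ [w]), z ∈ Y := by
    intro z hz; apply hl2; simp at hz ⊢; tauto
  have hB : Clq G (v0 :: (t1 ++ [w])) := by
    have e : v0 :: (t1 ++ [w]) = v0 :: ((a :: s) ++ c :: (s' ++ [w])) := by simp [ht1]
    have hcy : Cyc G Lo (v0 :: (t1 ++ [w])) := by
      refine (cyc_cons ..).mpr ⟨fun z hz => hY (hmemB z hz), hndB, ?_⟩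
      rw [pth_append, pth_nil]
      exact ⟨hch.1, hw.symm⟩
    rw [e] at hcy ⊢
    exact hc_main G Lo hP _ v0 (a :: s) c (s' ++ [w]) rfl hcy (by simp) (by simp) hc
  refine ⟨(v0 :: (t1 ++ [w])).toFinset, ?_, ?_, ?_, w, by simp, ?_⟩
  · intro z hz; rw [List.mem_toFinset] at hz; exact hmemB z hz
  · rw [List.toFinset_card_of_nodup hndB]; simp [ht1]; omega
  · intro x hx y hy hxy
    rw [List.mem_toFinset] at hx hy
    exact hB x hx y hy hxy
  · intro u hu huw z hz huz
    rw [List.mem_toFinset] at hu ⊢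
    have hu' : u ∈ v0 :: t1 := by simp at hu ⊢; tauto
    set E := (v0 :: t1).erase u with hE
    have hperm : (v0 :: t1).Perm (u :: E) := List.perm_cons_erase hu'
    have hpB : (v0 :: (t1 ++ [w])).Perm (u :: (E ++ [w])) := by
      have := hperm.append_right [w]
      simpa using this
    have hpL : (v0 :: (t1 ++ w :: t2)).Perm (u :: (E ++ w :: t2)) := by
      have := hperm.append_right (w :: t2)
      simpa using this
    have hEl : E ≠ [] := by
      intro h
      have := hperm.length_eq
      rw [h] at this
      simp [ht1] at this
    have hpt : Pth G u E w := clq_chain G _ (hpB.nodup_iff.mp hndB) (clq_perm G hpB hB)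
    have hIs : IsP (u :: (E ++ w :: t2)) := by
      refine ⟨hpL.nodup_iff.mp hl1, fun v hv => hl2 v (hpL.mem_iff.mpr hv), ?_⟩
      have : u :: (E ++ w :: t2) = (u :: E) ++ w :: t2 := by simp
      rw [this, List.isChain_split]
      exact ⟨hpt, hch.2⟩
    have hzr := hnb u _ hIs hpL.length_eq.symm z hz huz
    rw [hpB.mem_iff]
    by_cases hz2 : z ∈ t2
    · exfalso
      apply ht2 z hz2
      obtain ⟨r1, r2, rfl⟩ := List.append_of_mem hz2
      have hcl : Clq G (u :: (E ++ w :: (r1 ++ [z]))) := by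
        apply hc_main G Lo hP _ _ _ _ _ rfl
        · have hsub : (u :: (E ++ w :: (r1 ++ [z]))).Sublist (u :: (E ++ w :: (r1 ++ z :: r2))) := by
            apply List.Sublist.cons_cons
            apply List.Sublist.append_left
            apply List.Sublist.cons_cons
            apply List.Sublist.append_left
            simp
          refine (cyc_cons ..).mpr ⟨fun v hv => hY (hIs.2.1 v (hsub.subset hv)), hIs.1.sublist hsub, ?_⟩
          rw [pth_append, pth_append, pth_nil]
          refine ⟨hpt, ?_, huz.symm⟩
          have h1 := hch.2
          have e : w :: (r1 ++ z :: r2) = (w :: r1) ++ z :: r2 := by simp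
          rw [e, List.isChain_split] at h1
          exact h1.1
        · exact hEl
        · simp
        · exact hB u hu w (by simp) huw
      have hv0 : v0 ∈ u :: E := hperm.mem_iff.mp (by simp)
      apply hcl v0 _ z (by simp)
      · rintro rfl
        rw [List.nodup_cons] at hl1
        apply hl1.1; simp
      · rw [List.mem_cons] at hv0 ⊢
        rw [List.mem_append]; tauto
    · simp at hzr ⊢; tauto

end
end OB

namespace OB
section
open scoped Classical

def Clf {V : Type*} (G : SimpleGraph V) (B : Finset V) : Prop :=
  ∀ x ∈ B, ∀ y ∈ B, x ≠ y → G.Adj x y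

def inK {V : Type*} (G : SimpleGraph V) (k : ℕ) (Y : Finset V) (v : V) : Prop :=
  ∃ Q ⊆ Y, Q.card = k ∧ Clf G Q ∧ v ∈ Q

noncomputable def phi {V : Type*} (G : SimpleGraph V) (k : ℕ) (Y : Finset V) (v : V) : ℤ :=
  if k ≤ dg G Y v then -36
  else if dg G Y v + 1 = k then (if inK G k Y v then 12 else -20)
  else if dg G Y v + 2 = k then 24
  else if dg G Y v + 3 = k then 80
  else 130

lemma inK_mono {V : Type*} (G : SimpleGraph V) (k : ℕ) {Y' Y : Finset V} (h : Y' ⊆ Y) (v : V)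
    (hv : inK G k Y' v) : inK G k Y v := by
  obtain ⟨Q, h1, h2⟩ := hv
  exact ⟨Q, h1.trans h, h2⟩

lemma phi_L1 {V : Type*} (G : SimpleGraph V) (k : ℕ) {Y' Y : Finset V} (h : Y' ⊆ Y) (v : V)
    (hd : dg G Y v = dg G Y' v) : phi G k Y' v ≤ phi G k Y v := by
  have := inK_mono G k h v
  unfold phi
  rw [hd]
  split_ifs <;> first | omega | tauto

lemma phi_L2 {V : Type*} (G : SimpleGraph V) (k : ℕ) {Y' Y : Finset V} (h : Y' ⊆ Y) (v : V)
    (hd : dg G Y v ≤ dg G Y' v + 1) : phi G k Y' v ≤ phi G k Y v + 56 := by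
  have h1 := inK_mono G k h v
  have h2 := dg_mono G h v
  unfold phi
  split_ifs <;> omega

lemma phi_L3 {V : Type*} (G : SimpleGraph V) (k : ℕ) (Y' Y : Finset V) (v : V) :
    phi G k Y' v ≤ phi G k Y v + 166 := by
  unfold phi
  split_ifs <;> omega

lemma phi_ge {V : Type*} (G : SimpleGraph V) (k : ℕ) (Y : Finset V) (v : V) :
    -36 ≤ phi G k Y v := by
  unfold phi
  split_ifs <;> omega

lemma dg_one {V : Type*} (G : SimpleGraph V) (w v : V) :
    dg G {w} v = if G.Adj v w then 1 else 0 := by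
  unfold dg
  rw [Finset.filter_singleton]
  split_ifs <;> simp

/-- a general drop bound -/
lemma phi_drop {V : Type*} (G : SimpleGraph V) (k : ℕ) (Y R : Finset V) (hR : R ⊆ Y) (w : V)
    (h : ∀ v ∈ Y \ R, dg G R v ≤ if G.Adj v w then 1 else 0) :
    ∑ v ∈ Y \ R, phi G k (Y \ R) v ≤ ∑ v ∈ Y \ R, phi G k Y v + 56 * (dg G (Y \ R) w : ℤ) := by
  have : (56 * (dg G (Y \ R) w : ℤ)) = ∑ v ∈ Y \ R, if G.Adj v w then (56 : ℤ) else 0 := by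
    unfold dg
    rw [← Finset.sum_filter, Finset.sum_const]
    simp [G.adj_comm, mul_comm]
  rw [this, ← Finset.sum_add_distrib]
  apply Finset.sum_le_sum
  intro v hv
  have h1 := h v hv
  have h2 := dg_split G hR v
  split_ifs at h1 ⊢ with ha
  · exact phi_L2 G k Finset.sdiff_subset v (by omega)
  · have := phi_L1 G k (Finset.sdiff_subset (s := Y) (t := R)) v (by omega)
    omega

lemma pot {V : Type*} (G : SimpleGraph V) (Lo : Finset V) (hP : HP G Lo) (k : ℕ) (hk : 9 ≤ k)
    (hcl : ∀ Q ⊆ Lo, Clf G Q → Q.card ≤ k) :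
    ∀ (n : ℕ) (Y : Finset V), Y.card = n → Y ⊆ Lo → (∀ v ∈ Y, dg G Y v ≤ k) →
      0 ≤ ∑ v ∈ Y, phi G k Y v := by
  intro n
  induction n using Nat.strong_induction_on with
  | _ n ih =>
  intro Y hn hY hdk
  rcases Y.eq_empty_or_nonempty with rfl | hne
  · simp
  have hrec : ∀ R ⊆ Y, R.Nonempty → 0 ≤ ∑ v ∈ Y \ R, phi G k (Y \ R) v := by
    intro R hR hRn
    refine ih _ ?_ (Y \ R) rfl (Finset.sdiff_subset.trans hY) ?_
    · rw [← hn]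
      apply Finset.card_lt_card
      refine ⟨Finset.sdiff_subset, fun h => ?_⟩
      obtain ⟨x, hx⟩ := hRn
      exact (Finset.mem_sdiff.mp (h (hR hx))).2 hx
    · intro v hv
      exact (dg_mono G Finset.sdiff_subset v).trans (hdk v (Finset.sdiff_subset hv))
  rcases gl G Lo hP Y hY hne with ⟨v, hv, hd⟩ | ⟨B, hBY, hB4, hBc, w, hwB, hBn⟩
  · have hR : ({v} : Finset V) ⊆ Y := by simpa using hv
    have h1 := hrec {v} hR (by simp)
    have h2 := phi_drop G k Y {v} hR v (fun u _ => by rw [dg_one])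
    have h3 := Finset.sum_sdiff hR (f := fun u => phi G k Y u)
    have h4 := dg_mono G (Finset.sdiff_subset (s := Y) (t := {v})) v
    have h5 : phi G k Y v = 130 := by
      unfold phi
      split_ifs <;> omega
    rw [Finset.sum_singleton, h5] at h3
    have h6 : (dg G (Y \ {v}) v : ℤ) ≤ 2 := by exact_mod_cast h4.trans hd
    linarith
  · have hBk := hcl B (hBY.trans hY) hBc
    have hdB : ∀ u ∈ B, dg G B u + 1 = B.card := by
      intro u hu
      have : B.filter (fun z => G.Adj u z) = B.erase u := by
        ext z
        simp only [Finset.mem_filter, Finset.mem_erase]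
        constructor
        · rintro ⟨h1, h2⟩; exact ⟨h2.ne.symm, h1⟩
        · rintro ⟨h1, h2⟩; exact ⟨h2, hBc u hu z h2 h1.symm⟩
      unfold dg
      rw [this, Finset.card_erase_of_mem hu]
      omega
    have hdY : ∀ u ∈ B, u ≠ w → dg G Y u + 1 = B.card := by
      intro u hu huw
      rw [← hdB u hu]
      congr 1
      unfold dg
      congr 1
      ext z
      simp only [Finset.mem_filter]
      constructor
      · rintro ⟨h1, h2⟩; exact ⟨hBn u hu huw z h1 h2, h2⟩
      · rintro ⟨h1, h2⟩; exact ⟨hBY h1, h2⟩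
    have hBe : (B.erase w).card + 1 = B.card := by
      rw [Finset.card_erase_of_mem hwB]; omega
    by_cases hkB : B.card = k
    · have h1 := hrec B hBY ⟨w, hwB⟩
      have h2 := phi_drop G k Y B hBY w (by
        intro v hv
        rw [Finset.mem_sdiff] at hv
        rw [← dg_one]
        apply Finset.card_le_card
        intro z hz
        rw [Finset.mem_filter] at hz ⊢
        refine ⟨?_, hz.2⟩
        rw [Finset.mem_singleton]
        by_contra hzw
        exact hv.2 (hBn z hz.1 hzw v hv.1 hz.2.symm))
      have h3 := Finset.sum_sdiff hBY (f := fun u => phi G k Y u)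
      have h4 : ∑ u ∈ B.erase w, phi G k Y u = ∑ u ∈ B.erase w, (12 : ℤ) := by
        apply Finset.sum_congr rfl
        intro u hu
        rw [Finset.mem_erase] at hu
        have e1 := hdY u hu.2 hu.1
        have e2 : inK G k Y u := ⟨B, hBY, hkB, hBc, hu.2⟩
        unfold phi
        rw [if_neg (by omega), if_pos (by omega), if_pos e2]
      have h5 := Finset.add_sum_erase B (fun u => phi G k Y u) hwB
      have h6 := phi_ge G k Y w
      have h7 := dg_split G hBY w
      have h8 := hdB w hwB
      have h9 := hdk w (hBY hwB)
      have h10 : (dg G (Y \ B) w : ℤ) ≤ 1 := by exact_mod_cast (by omega : dg G (Y \ B) w ≤ 1)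
      rw [Finset.sum_const, nsmul_eq_mul] at h4
      have h11 : (8 : ℤ) ≤ ((B.erase w).card : ℤ) := by exact_mod_cast (by omega)
      linarith
    · have hR : B.erase w ⊆ Y := (Finset.erase_subset _ _).trans hBY
      have h1 := hrec (B.erase w) hR (Finset.card_pos.mp (by omega))
      have h3 := Finset.sum_sdiff hR (f := fun u => phi G k Y u)
      have hw : w ∈ Y \ B.erase w := by simp [hBY hwB]
      have h2 : ∑ v ∈ Y \ B.erase w, phi G k (Y \ B.erase w) v ≤
          ∑ v ∈ Y \ B.erase w, phi G k Y v + 166 := by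
        rw [← Finset.add_sum_erase _ _ hw,
          ← Finset.add_sum_erase _ (fun v => phi G k Y v) hw]
        have e1 := phi_L3 G k (Y \ B.erase w) Y w
        have e2 : ∑ v ∈ (Y \ B.erase w).erase w, phi G k (Y \ B.erase w) v ≤
            ∑ v ∈ (Y \ B.erase w).erase w, phi G k Y v := by
          apply Finset.sum_le_sum
          intro v hv
          apply phi_L1 G k Finset.sdiff_subset
          rw [dg_split G hR v]
          have : dg G (B.erase w) v = 0 := by
            unfold dg
            rw [Finset.card_eq_zero, Finset.filter_eq_empty_iff]
            intro z hz hvz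
            simp at hv hz
            exact hv.2.2 hv.1 (hBn z hz.2 hz.1 v hv.2.1 hvz.symm)
          omega
        linarith
      have h4 : 166 ≤ ∑ u ∈ B.erase w, phi G k Y u := by
        by_cases hk1 : B.card + 1 = k
        · have : ∑ u ∈ B.erase w, phi G k Y u = ∑ u ∈ B.erase w, (24 : ℤ) := by
            apply Finset.sum_congr rfl
            intro u hu
            rw [Finset.mem_erase] at hu
            have e1 := hdY u hu.2 hu.1
            unfold phi
            split_ifs <;> omega
          rw [this, Finset.sum_const, nsmul_eq_mul]
          have h11 : (7 : ℤ) ≤ ((B.erase w).card : ℤ) := by exact_mod_cast (by omega)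
          linarith
        · have : ∑ u ∈ B.erase w, (80 : ℤ) ≤ ∑ u ∈ B.erase w, phi G k Y u := by
            apply Finset.sum_le_sum
            intro u hu
            rw [Finset.mem_erase] at hu
            have e1 := hdY u hu.2 hu.1
            unfold phi
            split_ifs <;> omega
          rw [Finset.sum_const, nsmul_eq_mul] at this
          have h11 : (3 : ℤ) ≤ ((B.erase w).card : ℤ) := by exact_mod_cast (by omega)
          linarith
      linarith

end
end OB

namespace OB
section
open scoped Classical

structure Cfg {V : Type*} (G : SimpleGraph V) (k : ℕ) (Lo Hi : Finset V) : Prop where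
  k9 : 9 ≤ k
  disj : Disjoint Lo Hi
  hiInd : Ind G Hi
  hiDeg : ∀ h ∈ Hi, dg G Lo h = k + 1
  loDeg : ∀ v ∈ Lo, dg G Lo v + dg G Hi v = k
  star : ∀ W ⊆ Lo ∪ Hi, W.Nonempty → ∀ A ⊆ W, Ind G A →
    ∑ v ∈ A, dg G W v < W.card + (W ∩ Hi).card
  clq : ∀ Q ⊆ Lo ∪ Hi, Clf G Q → Q.card ≤ k

lemma caro {V : Type*} (G : SimpleGraph V) : ∀ (n : ℕ) (T : Finset V), T.card = n →
    ∃ I ⊆ T, Ind G I ∧ ∑ v ∈ T, (1 : ℚ) / (1 + dg G T v) ≤ I.card := by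
  intro n
  induction n using Nat.strong_induction_on with
  | _ n ih =>
  intro T hT
  rcases T.eq_empty_or_nonempty with rfl | hne
  · exact ⟨∅, by simp, by simp [Ind], by simp⟩
  obtain ⟨v, hv, hmin⟩ := Finset.exists_min_image T (fun u => dg G T u) hne
  set C := insert v (T.filter (fun u => G.Adj v u)) with hC
  have hCT : C ⊆ T := by
    intro z hz
    rw [hC, Finset.mem_insert, Finset.mem_filter] at hz
    rcases hz with rfl | hz
    · exact hv
    · exact hz.1
  have hCc : C.card = dg G T v + 1 := by
    rw [hC, Finset.card_insert_of_notMem (by simp)]; rfl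
  have hvC : v ∈ C := by simp [hC]
  obtain ⟨I, hI1, hI2, hI3⟩ := ih _ (by
    rw [← hT]
    apply Finset.card_lt_card
    refine ⟨Finset.sdiff_subset, fun h => ?_⟩
    exact (Finset.mem_sdiff.mp (h hv)).2 hvC) (T \ C) rfl
  have hvI : v ∉ I := fun h => (Finset.mem_sdiff.mp (hI1 h)).2 hvC
  have hnI : ∀ z ∈ I, ¬ G.Adj v z := by
    intro z hz hvz
    have := Finset.mem_sdiff.mp (hI1 hz)
    exact this.2 (by simp [hC, this.1, hvz])
  refine ⟨insert v I, ?_, ?_, ?_⟩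
  · intro z hz
    rcases Finset.mem_insert.mp hz with rfl | hz
    · exact hv
    · exact (Finset.mem_sdiff.mp (hI1 hz)).1
  · intro a ha b hb hab
    rcases Finset.mem_insert.mp ha with rfl | ha'
    · rcases Finset.mem_insert.mp hb with rfl | hb'
      · exact G.irrefl hab
      · exact hnI b hb' hab
    · rcases Finset.mem_insert.mp hb with rfl | hb'
      · exact hnI a ha' hab.symm
      · exact hI2 a ha' b hb' hab
  · rw [Finset.card_insert_of_notMem hvI, ← Finset.sum_sdiff hCT]
    have h1 : ∑ u ∈ T \ C, (1 : ℚ) / (1 + dg G T u) ≤ ∑ u ∈ T \ C, (1 : ℚ) / (1 + dg G (T \ C) u) := by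
      apply Finset.sum_le_sum
      intro u _
      apply one_div_le_one_div_of_le
      · positivity
      · have : (dg G (T \ C) u : ℚ) ≤ dg G T u := by
          exact_mod_cast dg_mono G Finset.sdiff_subset u
        linarith
    have h2 : ∑ u ∈ C, (1 : ℚ) / (1 + dg G T u) ≤ ∑ u ∈ C, (1 : ℚ) / (1 + dg G T v) := by
      apply Finset.sum_le_sum
      intro u hu
      apply one_div_le_one_div_of_le
      · positivity
      · have : (dg G T v : ℚ) ≤ dg G T u := by
          exact_mod_cast hmin u (hCT hu)
        linarith
    have h3 : ∑ u ∈ C, (1 : ℚ) / (1 + dg G T v) = 1 := by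
      rw [Finset.sum_const, nsmul_eq_mul, hCc]
      push_cast
      have : (0 : ℚ) < 1 + dg G T v := by positivity
      field_simp
      ring
    push_cast
    linarith

/-- the random set -/
noncomputable def SS {V : Type*} [Fintype V] (o : V → Fin 5) : Finset V :=
  Finset.univ.filter (fun v => o v = 0)

lemma count {V : Type*} [Fintype V] (R : Finset V) :
    ((Finset.univ.filter (fun o : V → Fin 5 => R ⊆ SS o)).card : ℚ) =
      5 ^ (Fintype.card V) * (1 / 5) ^ R.card := by
  have h1 : (Finset.univ.filter (fun o : V → Fin 5 => R ⊆ SS o)) =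
      Fintype.piFinset (fun v => if v ∈ R then ({0} : Finset (Fin 5)) else Finset.univ) := by
    ext o
    simp only [Finset.mem_filter, Finset.mem_univ, true_and, Fintype.mem_piFinset]
    constructor
    · intro h v
      split_ifs with hv
      · have := h hv
        simp [SS] at this
        simp [this]
      · simp
    · intro h v hv
      have := h v
      rw [if_pos hv] at this
      simp at this
      simp [SS, this]
  have h2 : (Finset.univ.filter (fun o : V → Fin 5 => R ⊆ SS o)).card * 5 ^ R.card
      = 5 ^ (Fintype.card V) := by
    rw [h1, Fintype.card_piFinset]
    have : (5 : ℕ) ^ R.card = ∏ v : V, if v ∈ R then 5 else 1 := by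
      rw [Finset.prod_ite_mem]; simp
    rw [this, ← Finset.prod_mul_distrib]
    rw [Finset.prod_congr rfl (g := fun _ => 5)]
    · simp
    · intro v _
      split_ifs <;> simp
  have h3 : ((Finset.univ.filter (fun o : V → Fin 5 => R ⊆ SS o)).card : ℚ) * 5 ^ R.card
      = 5 ^ (Fintype.card V) := by exact_mod_cast h2
  rw [← h3, mul_assoc, ← mul_pow]
  norm_num

noncomputable def req {V : Type*} (G : SimpleGraph V) (Hi : Finset V) (v : V) : Finset V :=
  if dg G Hi v = 0 then {v} else Hi.filter (fun h => G.Adj v h)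

noncomputable def LS {V : Type*} (G : SimpleGraph V) (Lo Hi S : Finset V) : Finset V :=
  Lo.filter (fun v => req G Hi v ⊆ S)

lemma oneS {V : Type*} (G : SimpleGraph V) (k : ℕ) (Lo Hi : Finset V) (c : Cfg G k Lo Hi)
    (hne : (Lo ∪ Hi).Nonempty) (S : Finset V) :
    ((k : ℚ) + 1) * (Hi \ S).card + k * ∑ v ∈ LS G Lo Hi S, (1 : ℚ) / (1 + dg G (LS G Lo Hi S) v) <
      Lo.card + 2 * Hi.card := by
  obtain ⟨I, hI1, hI2, hI3⟩ := caro G _ (LS G Lo Hi S) rfl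
  have hIL : I ⊆ Lo := hI1.trans (Finset.filter_subset _ _)
  have hdis : Disjoint (Hi \ S) I :=
    (c.disj.symm.mono Finset.sdiff_subset hIL)
  have hcross : ∀ h ∈ Hi \ S, ∀ v ∈ I, ¬ G.Adj v h := by
    intro h hh v hv hvh
    rw [Finset.mem_sdiff] at hh
    have h1 := hI1 hv
    rw [LS, Finset.mem_filter] at h1
    have h2 : h ∈ Hi.filter (fun h => G.Adj v h) := by simp [hh.1, hvh]
    have h3 : dg G Hi v ≠ 0 := by
      unfold dg
      exact (Finset.card_pos.mpr ⟨h, h2⟩).ne'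
    rw [req, if_neg h3] at h1
    exact hh.2 (h1.2 h2)
  have hA : Ind G ((Hi \ S) ∪ I) := by
    intro a ha b hb hab
    rcases Finset.mem_union.mp ha with ha | ha <;> rcases Finset.mem_union.mp hb with hb | hb
    · exact c.hiInd a (Finset.sdiff_subset ha) b (Finset.sdiff_subset hb) hab
    · exact hcross a ha b hb hab.symm
    · exact hcross b hb a ha hab
    · exact hI2 a ha b hb hab
  have hsub : (Hi \ S) ∪ I ⊆ Lo ∪ Hi := by
    apply Finset.union_subset
    · exact Finset.sdiff_subset.trans Finset.subset_union_right
    · exact hIL.trans Finset.subset_union_left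
  have hstar := c.star _ (Finset.Subset.refl _) hne _ hsub hA
  have hsd : (Lo ∪ Hi) \ Lo = Hi := by
    rw [Finset.union_sdiff_left]; exact Finset.sdiff_eq_self_of_disjoint c.disj.symm
  have hdX : ∀ v, dg G (Lo ∪ Hi) v = dg G Lo v + dg G Hi v := by
    intro v
    rw [dg_split G (Finset.subset_union_left (s₁ := Lo) (s₂ := Hi)) v, hsd]
  rw [Finset.sum_union hdis, Finset.card_union_of_disjoint c.disj] at hstar
  have e1 : ∑ v ∈ Hi \ S, dg G (Lo ∪ Hi) v = ∑ v ∈ Hi \ S, (k + 1) := by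
    apply Finset.sum_congr rfl
    intro h hh
    have hh := Finset.sdiff_subset hh
    have : dg G Hi h = 0 := by
      unfold dg
      rw [Finset.card_eq_zero, Finset.filter_eq_empty_iff]
      intro z hz
      exact c.hiInd h hh z hz
    rw [hdX, c.hiDeg h hh, this]
  have e2 : ∑ v ∈ I, dg G (Lo ∪ Hi) v = ∑ v ∈ I, k := by
    apply Finset.sum_congr rfl
    intro v hv
    rw [hdX, c.loDeg v (hIL hv)]
  have e3 : (Lo ∪ Hi) ∩ Hi = Hi := Finset.union_inter_cancel_right
  rw [e1, e2, e3, Finset.sum_const, Finset.sum_const] at hstar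
  simp only [smul_eq_mul] at hstar
  have hq : ((Hi \ S).card : ℚ) * (k + 1) + I.card * k < Lo.card + Hi.card + Hi.card := by
    exact_mod_cast hstar
  have : (k : ℚ) * ∑ v ∈ LS G Lo Hi S, (1 : ℚ) / (1 + dg G (LS G Lo Hi S) v) ≤ k * I.card := by
    apply mul_le_mul_of_nonneg_left hI3 (by positivity)
  linarith

lemma avgL {V : Type*} [Fintype V] (G : SimpleGraph V) (Lo Hi : Finset V) (c : V → ℚ)
    (hc : ∀ v ∈ Lo, 1 + ∑ u ∈ Lo.filter (fun u => G.Adj v u),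
      (1 / 5 : ℚ) ^ (req G Hi u \ req G Hi v).card ≤ c v) :
    (5 : ℚ) ^ (Fintype.card V) * ∑ v ∈ Lo, (1 / 5 : ℚ) ^ (req G Hi v).card / c v ≤
    ∑ o : V → Fin 5, ∑ v ∈ LS G Lo Hi (SS o), (1 : ℚ) / (1 + dg G (LS G Lo Hi (SS o)) v) := by
  have hcpos : ∀ v ∈ Lo, 0 < c v := by
    intro v hv
    refine lt_of_lt_of_le ?_ (hc v hv)
    have : 0 ≤ ∑ u ∈ Lo.filter (fun u => G.Adj v u),
      (1 / 5 : ℚ) ^ (req G Hi u \ req G Hi v).card := Finset.sum_nonneg (fun _ _ => by positivity)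
    linarith
  have e1 : ∀ o : V → Fin 5, ∑ v ∈ Lo, (if req G Hi v ⊆ SS o then
      (2 / c v - (1 + (dg G (LS G Lo Hi (SS o)) v : ℚ)) / (c v) ^ 2) else 0) ≤
      ∑ v ∈ LS G Lo Hi (SS o), (1 : ℚ) / (1 + dg G (LS G Lo Hi (SS o)) v) := by
    intro o
    rw [← Finset.sum_filter]
    apply Finset.sum_le_sum
    intro v hv
    have h1 := hcpos v (Finset.mem_filter.mp hv).1
    have h2 : (0 : ℚ) < 1 + dg G (LS G Lo Hi (SS o)) v := by positivity
    generalize (1 + dg G (LS G Lo Hi (SS o)) v : ℚ) = d at h2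
    rw [div_sub_div _ _ h1.ne' (by positivity), div_le_div_iff₀ (by positivity) h2]
    nlinarith [mul_nonneg h1.le (sq_nonneg (c v - d))]
  refine le_trans ?_ (Finset.sum_le_sum (fun o _ => e1 o))
  rw [Finset.sum_comm, Finset.mul_sum]
  apply Finset.sum_le_sum
  intro v hv
  have h1 := hcpos v hv
  have e2 : ∀ o : V → Fin 5, (if req G Hi v ⊆ SS o then
      (2 / c v - (1 + (dg G (LS G Lo Hi (SS o)) v : ℚ)) / (c v) ^ 2) else 0) =
      (2 / c v - 1 / (c v) ^ 2) * (if req G Hi v ⊆ SS o then 1 else 0) -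
      (1 / (c v) ^ 2) * ∑ u ∈ Lo.filter (fun u => G.Adj v u),
        (if req G Hi u ∪ req G Hi v ⊆ SS o then (1 : ℚ) else 0) := by
    intro o
    have : (if req G Hi v ⊆ SS o then (dg G (LS G Lo Hi (SS o)) v : ℚ) else 0) =
        ∑ u ∈ Lo.filter (fun u => G.Adj v u),
        (if req G Hi u ∪ req G Hi v ⊆ SS o then (1 : ℚ) else 0) := by
      split_ifs with hs
      · rw [← Finset.sum_filter, Finset.sum_const, nsmul_eq_mul, mul_one]
        unfold dg
        congr 2
        ext u
        simp only [LS, Finset.mem_filter, Finset.union_subset_iff]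
        tauto
      · symm
        apply Finset.sum_eq_zero
        intro u _
        rw [if_neg]
        rw [Finset.union_subset_iff]; tauto
    rw [← this]
    split_ifs
    · ring
    · ring
  simp_rw [e2]
  rw [Finset.sum_sub_distrib, ← Finset.mul_sum, ← Finset.mul_sum, Finset.sum_comm]
  have e3 : ∀ R : Finset V, ∑ o : V → Fin 5, (if R ⊆ SS o then (1 : ℚ) else 0) =
      5 ^ (Fintype.card V) * (1 / 5) ^ R.card := by
    intro R
    rw [← count R, Finset.sum_boole]
  simp_rw [e3]
  have e4 : ∀ u, (5 : ℚ) ^ (Fintype.card V) * (1 / 5) ^ (req G Hi u ∪ req G Hi v).card =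
      (5 ^ (Fintype.card V) * (1 / 5) ^ (req G Hi v).card) *
        (1 / 5) ^ (req G Hi u \ req G Hi v).card := by
    intro u
    rw [← Finset.sdiff_union_self_eq_union, Finset.card_union_of_disjoint Finset.sdiff_disjoint,
      pow_add]
    ring
  simp_rw [e4]
  rw [← Finset.mul_sum]
  have h2 := hc v hv
  generalize ∑ u ∈ Lo.filter (fun u => G.Adj v u),
      (1 / 5 : ℚ) ^ (req G Hi u \ req G Hi v).card = D at h2 ⊢
  have h3 : (0 : ℚ) < 5 ^ (Fintype.card V) * (1 / 5) ^ (req G Hi v).card := by positivity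
  rw [← mul_div_assoc]
  generalize (5 : ℚ) ^ (Fintype.card V) * (1 / 5) ^ (req G Hi v).card = P at h3 ⊢
  have h4 : 1 / c v ≤ 2 / c v - (1 + D) / (c v) ^ 2 := by
    have : (1 + D) / (c v) ^ 2 ≤ c v / (c v) ^ 2 := by
      apply div_le_div_of_nonneg_right h2 (by positivity)
    have h5 : c v / (c v) ^ 2 = 1 / c v := by field_simp
    have h6 : 2 / c v = 1 / c v + 1 / c v := by ring
    linarith
  calc P / c v = P * (1 / c v) := by ring
    _ ≤ P * (2 / c v - (1 + D) / (c v) ^ 2) := mul_le_mul_of_nonneg_left h4 h3.le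
    _ = _ := by ring

end
end OB

namespace OB
section
open scoped Classical

noncomputable def cc {V : Type*} (G : SimpleGraph V) (k : ℕ) (Lo Hi : Finset V) (v : V) : ℚ :=
  if dg G Hi v = 0 then 1 + k / 5
  else if dg G Hi v = 1 ∧ inK G k Lo v then (8 + k) / 5
  else 1 + dg G Lo v

lemma dg_pos {V : Type*} (G : SimpleGraph V) (X : Finset V) (v h : V) (hh : h ∈ X) (a : G.Adj v h) :
    dg G X v ≠ 0 := by
  unfold dg
  exact (Finset.card_pos.mpr ⟨h, by simp [hh, a]⟩).ne'

lemma fifth {n : ℕ} (h : n ≠ 0) : (1 / 5 : ℚ) ^ n ≤ 1 / 5 := by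
  have := pow_le_pow_of_le_one (a := (1 / 5 : ℚ)) (by norm_num) (by norm_num)
    (Nat.one_le_iff_ne_zero.mpr h)
  simpa using this

lemma clq_nb {V : Type*} (G : SimpleGraph V) (k : ℕ) (Lo Hi : Finset V) (c : Cfg G k Lo Hi)
    (Q : Finset V) (hQ : Q ⊆ Lo) (hQk : Q.card = k) (hQc : Clf G Q) (h : V) (hh : h ∈ Hi) :
    dg G Q h ≤ 2 := by
  have hhQ : h ∉ Q := fun hq => (Finset.disjoint_left.mp c.disj (hQ hq)) hh
  have hW : insert h Q ⊆ Lo ∪ Hi := by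
    intro z hz
    rcases Finset.mem_insert.mp hz with rfl | hz
    · simp [hh]
    · simp [hQ hz]
  have hex : ∃ x ∈ Q, ¬ G.Adj h x := by
    by_contra hcon
    push Not at hcon
    have := c.clq (insert h Q) hW (by
      intro a ha b hb hab
      rcases Finset.mem_insert.mp ha with rfl | ha'
      · rcases Finset.mem_insert.mp hb with rfl | hb'
        · exact absurd rfl hab
        · exact hcon b hb'
      · rcases Finset.mem_insert.mp hb with rfl | hb'
        · exact (hcon a ha').symm
        · exact hQc a ha' b hb' hab)
    rw [Finset.card_insert_of_notMem hhQ] at this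
    omega
  obtain ⟨x, hx, hhx⟩ := hex
  have hne : h ≠ x := by rintro rfl; exact hhQ hx
  have hs := c.star (insert h Q) hW ⟨h, by simp⟩ {h, x} (by
    intro z hz
    simp at hz
    rcases hz with rfl | rfl <;> simp [hx]) (by
    intro a ha b hb hab
    simp only [Finset.mem_insert, Finset.mem_singleton] at ha hb
    rcases ha with rfl | rfl <;> rcases hb with rfl | rfl
    · exact G.irrefl hab
    · exact hhx hab
    · exact hhx hab.symm
    · exact G.irrefl hab)
  rw [Finset.sum_pair hne, Finset.card_insert_of_notMem hhQ] at hs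
  have h1 : dg G Q h ≤ dg G (insert h Q) h := dg_mono G (Finset.subset_insert _ _) h
  have h2 : dg G Q x ≤ dg G (insert h Q) x := dg_mono G (Finset.subset_insert _ _) x
  have h3 : Q.erase x ⊆ Q.filter (fun u => G.Adj x u) := by
    intro z hz
    rw [Finset.mem_erase] at hz
    rw [Finset.mem_filter]
    exact ⟨hz.2, hQc x hx z hz.2 hz.1.symm⟩
  have h4 := Finset.card_le_card h3
  rw [Finset.card_erase_of_mem hx] at h4
  have h5 : (insert h Q ∩ Hi).card ≤ 1 := by
    have : insert h Q ∩ Hi ⊆ {h} := by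
      intro z hz
      rw [Finset.mem_inter, Finset.mem_insert] at hz
      rcases hz.1 with rfl | hzq
      · simp
      · exact absurd hz.2 (Finset.disjoint_left.mp c.disj (hQ hzq))
    simpa using Finset.card_le_card this
  have h6 : Q.card - 1 ≤ dg G Q x := by
    unfold dg
    convert h4
  have := c.k9
  omega

lemma req_mem {V : Type*} (G : SimpleGraph V) (Lo Hi : Finset V) (u : V) :
    ∃ z ∈ req G Hi u, z = u ∨ (z ∈ Hi ∧ G.Adj u z) := by
  unfold req
  split_ifs with h
  · exact ⟨u, by simp, Or.inl rfl⟩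
  · obtain ⟨z, hz⟩ := Finset.card_pos.mp (Nat.pos_of_ne_zero h)
    exact ⟨z, hz, Or.inr (by simpa using hz)⟩

lemma cc_ok {V : Type*} (G : SimpleGraph V) (k : ℕ) (Lo Hi : Finset V) (c : Cfg G k Lo Hi)
    (v : V) (hv : v ∈ Lo) : 1 + ∑ u ∈ Lo.filter (fun u => G.Adj v u),
      (1 / 5 : ℚ) ^ (req G Hi u \ req G Hi v).card ≤ cc G k Lo Hi v := by
  have hdeg := c.loDeg v hv
  have hLH : ∀ u ∈ Lo, u ∉ Hi := fun u hu => Finset.disjoint_left.mp c.disj hu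
  have hgen : ∑ u ∈ Lo.filter (fun u => G.Adj v u),
      (1 / 5 : ℚ) ^ (req G Hi u \ req G Hi v).card ≤ dg G Lo v := by
    have : (dg G Lo v : ℚ) = ∑ u ∈ Lo.filter (fun u => G.Adj v u), (1 : ℚ) := by simp [dg]
    rw [this]
    apply Finset.sum_le_sum
    intro u _
    exact pow_le_one₀ (by norm_num) (by norm_num)
  unfold cc
  split_ifs with h0 h1
  · have h2 : ∑ u ∈ Lo.filter (fun u => G.Adj v u), (1 / 5 : ℚ) ^ (req G Hi u \ req G Hi v).card
        ≤ ∑ u ∈ Lo.filter (fun u => G.Adj v u), (1 / 5 : ℚ) := by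
      apply Finset.sum_le_sum
      intro u hu
      rw [Finset.mem_filter] at hu
      apply fifth
      obtain ⟨z, hz, hz'⟩ := req_mem G Lo Hi u
      refine (Finset.card_pos.mpr ⟨z, ?_⟩).ne'
      rw [Finset.mem_sdiff]
      refine ⟨hz, ?_⟩
      rw [req, if_pos h0, Finset.mem_singleton]
      rintro rfl
      rcases hz' with rfl | hz'
      · exact G.irrefl hu.2
      · exact hLH _ hv hz'.1
    rw [Finset.sum_const, nsmul_eq_mul] at h2
    have h3 : ((Lo.filter (fun u => G.Adj v u)).card : ℚ) = k := by
      have : dg G Lo v = k := by omega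
      rw [← this]; rfl
    rw [h3] at h2
    linarith
  · obtain ⟨h1, Q, hQ, hQk, hQc, hvQ⟩ := h1
    have hrv : req G Hi v = Hi.filter (fun h => G.Adj v h) := by rw [req, if_neg h0]
    obtain ⟨h, hh⟩ := Finset.card_eq_one.mp h1
    have hhH : h ∈ Hi ∧ G.Adj v h := by
      have : h ∈ Hi.filter (fun u => G.Adj v u) := by rw [hh]; simp
      simpa using this
    have hNQ : Lo.filter (fun u => G.Adj v u) = Q.erase v := by
      symm
      apply Finset.eq_of_subset_of_card_le
      · intro z hz
        rw [Finset.mem_erase] at hz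
        rw [Finset.mem_filter]
        exact ⟨hQ hz.2, hQc v hvQ z hz.2 hz.1.symm⟩
      · rw [Finset.card_erase_of_mem hvQ]
        change dg G Lo v ≤ _
        omega
    have hQ2 := clq_nb G k Lo Hi c Q hQ hQk hQc h hhH.1
    have hle : ∀ u ∈ Q.erase v, (1 / 5 : ℚ) ^ (req G Hi u \ req G Hi v).card ≤
        1 / 5 + if G.Adj h u then (4 / 5) else 0 := by
      intro u hu
      split_ifs with ha
      · refine (pow_le_one₀ (by norm_num) (by norm_num)).trans (by norm_num)
      · rw [add_zero]
        apply fifth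
        obtain ⟨z, hz, hz'⟩ := req_mem G Lo Hi u
        refine (Finset.card_pos.mpr ⟨z, ?_⟩).ne'
        rw [Finset.mem_sdiff]
        refine ⟨hz, ?_⟩
        rw [hrv, hh, Finset.mem_singleton]
        rintro rfl
        rcases hz' with rfl | hz'
        · exact hLH _ (hQ (Finset.mem_erase.mp hu).2) hhH.1
        · exact ha hz'.2.symm
    rw [hNQ]
    have h2 := Finset.sum_le_sum hle
    rw [Finset.sum_add_distrib, Finset.sum_const, nsmul_eq_mul, ← Finset.sum_filter,
      Finset.sum_const, nsmul_eq_mul] at h2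
    have h3 : ((Q.erase v).card : ℚ) = k - 1 := by
      rw [Finset.card_erase_of_mem hvQ, hQk, Nat.cast_sub (by have := c.k9; omega)]
      simp
    have h4 : (((Q.erase v).filter (fun u => G.Adj h u)).card : ℚ) ≤ 1 := by
      have e : ((Q.erase v).filter (fun u => G.Adj h u)) = (Q.filter (fun u => G.Adj h u)).erase v := by
        ext z; simp only [Finset.mem_filter, Finset.mem_erase]; tauto
      have hm : v ∈ Q.filter (fun u => G.Adj h u) := by simp [hvQ, hhH.2.symm]
      rw [e, Finset.card_erase_of_mem hm]
      have : (Q.filter (fun u => G.Adj h u)).card ≤ 2 := hQ2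
      exact_mod_cast (by omega : (Q.filter (fun u => G.Adj h u)).card - 1 ≤ 1)
    rw [h3] at h2
    linarith
  · linarith

lemma per_v {V : Type*} (G : SimpleGraph V) (k : ℕ) (Lo Hi : Finset V) (c : Cfg G k Lo Hi)
    (v : V) (hv : v ∈ Lo) : 1 + (phi G k Lo v : ℚ) / 100 ≤
      3 / 5 * (dg G Hi v : ℚ) + k * ((1 / 5 : ℚ) ^ (req G Hi v).card / cc G k Lo Hi v) := by
  have hdeg := c.loDeg v hv
  have hk := c.k9
  have hkq : (9 : ℚ) ≤ k := by exact_mod_cast hk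
  have hnn : 0 ≤ k * ((1 / 5 : ℚ) ^ (req G Hi v).card / cc G k Lo Hi v) := by
    have : 0 ≤ cc G k Lo Hi v := by
      unfold cc
      split_ifs <;> positivity
    positivity
  have hreq : dg G Hi v ≠ 0 → (req G Hi v).card = dg G Hi v := by
    intro h; rw [req, if_neg h]; rfl
  by_cases h0 : dg G Hi v = 0
  · have e1 : phi G k Lo v = -36 := by
      unfold phi; rw [if_pos (by omega)]
    have e2 : cc G k Lo Hi v = 1 + k / 5 := by unfold cc; rw [if_pos h0]
    have e3 : (req G Hi v).card = 1 := by rw [req, if_pos h0]; simp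
    rw [e1, e2, e3, h0]
    have : (16 / 25 : ℚ) ≤ k * ((1 / 5) ^ 1 / (1 + k / 5)) := by
      rw [pow_one, ← mul_div_assoc, le_div_iff₀ (by positivity)]
      linarith
    push_cast
    linarith
  by_cases h1 : dg G Hi v = 1
  · have e3 : (req G Hi v).card = 1 := by rw [hreq h0, h1]
    by_cases hK : inK G k Lo v
    · have e1 : phi G k Lo v = 12 := by
        unfold phi; rw [if_neg (by omega), if_pos (by omega), if_pos hK]
      have e2 : cc G k Lo Hi v = (8 + k) / 5 := by unfold cc; rw [if_neg h0, if_pos ⟨h1, hK⟩]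
      rw [e1, e2, e3, h1]
      have : (13 / 25 : ℚ) ≤ k * ((1 / 5) ^ 1 / ((8 + k) / 5)) := by
        rw [pow_one, ← mul_div_assoc, le_div_iff₀ (by positivity)]
        linarith
      push_cast
      linarith
    · have e1 : phi G k Lo v = -20 := by
        unfold phi; rw [if_neg (by omega), if_pos (by omega), if_neg hK]
      have e2 : cc G k Lo Hi v = k := by
        unfold cc; rw [if_neg h0, if_neg (by tauto)]
        have : dg G Lo v + 1 = k := by omega
        rw [← this]; push_cast; ring
      rw [e1, e2, e3, h1]
      have : (1 / 5 : ℚ) ≤ k * ((1 / 5) ^ 1 / k) := by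
        rw [pow_one, ← mul_div_assoc, le_div_iff₀ (by positivity)]
        linarith
      push_cast
      linarith
  by_cases h2 : dg G Hi v = 2
  · have e3 : (req G Hi v).card = 2 := by rw [hreq h0, h2]
    have e1 : phi G k Lo v = 24 := by
      unfold phi; split_ifs <;> omega
    have e2 : cc G k Lo Hi v = k - 1 := by
      unfold cc; rw [if_neg h0, if_neg (by omega)]
      have : dg G Lo v + 2 = k := by omega
      rw [← this]; push_cast; ring
    rw [e1, e2, e3, h2]
    have : (1 / 25 : ℚ) ≤ k * ((1 / 5) ^ 2 / (k - 1)) := by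
      rw [← mul_div_assoc, le_div_iff₀ (by linarith)]
      linarith
    push_cast
    linarith
  by_cases h3 : dg G Hi v = 3
  · have e1 : phi G k Lo v = 80 := by
      unfold phi; split_ifs <;> omega
    rw [e1, h3]
    push_cast
    linarith
  · have e1 : phi G k Lo v = 130 := by
      unfold phi; split_ifs <;> omega
    have : (4 : ℚ) ≤ dg G Hi v := by exact_mod_cast (by omega : 4 ≤ dg G Hi v)
    rw [e1]
    push_cast
    linarith

lemma cfg_false {V : Type*} [Fintype V] (G : SimpleGraph V) (k : ℕ) (Lo Hi : Finset V)
    (c : Cfg G k Lo Hi) (hne : (Lo ∪ Hi).Nonempty) : False := by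
  have hk := c.k9
  have hkq : (9 : ℚ) ≤ k := by exact_mod_cast hk
  have hP : HP G Lo := by
    intro W hW hWn A hA hAi
    have h1 := c.star W (hW.trans Finset.subset_union_left) hWn A hA hAi
    have h2 : W ∩ Hi = ∅ := Finset.disjoint_iff_inter_eq_empty.mp (c.disj.mono_left hW)
    rw [h2] at h1
    simpa using h1
  have hpot := pot G Lo hP k hk (fun Q hQ => c.clq Q (hQ.trans Finset.subset_union_left)) _ Lo rfl
    (Finset.Subset.refl _) (fun v hv => by have := c.loDeg v hv; omega)
  have hpotq : (0 : ℚ) ≤ ∑ v ∈ Lo, (phi G k Lo v : ℚ) := by exact_mod_cast hpot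
  have hper := Finset.sum_le_sum (fun v hv => per_v G k Lo Hi c v hv)
  rw [Finset.sum_add_distrib, Finset.sum_add_distrib, ← Finset.sum_div, ← Finset.mul_sum,
    ← Finset.mul_sum, Finset.sum_const, nsmul_eq_mul, mul_one] at hper
  have hdc : ∑ v ∈ Lo, (dg G Hi v : ℚ) = (k + 1) * Hi.card := by
    have h1 : ∑ v ∈ Lo, dg G Hi v = ∑ h ∈ Hi, dg G Lo h := by
      unfold dg
      simp_rw [Finset.card_filter]
      rw [Finset.sum_comm]
      simp_rw [G.adj_comm]
    have h2 : ∑ h ∈ Hi, dg G Lo h = (k + 1) * Hi.card := by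
      rw [Finset.sum_congr rfl (fun h hh => c.hiDeg h hh), Finset.sum_const, smul_eq_mul, mul_comm]
    rw [h2] at h1
    exact_mod_cast h1
  have havg := avgL G Lo Hi (cc G k Lo Hi) (fun v hv => cc_ok G k Lo Hi c v hv)
  have hS : ∑ o : V → Fin 5, (((k : ℚ) + 1) * (Hi \ SS o).card +
      k * ∑ v ∈ LS G Lo Hi (SS o), (1 : ℚ) / (1 + dg G (LS G Lo Hi (SS o)) v)) <
      ∑ o : V → Fin 5, ((Lo.card : ℚ) + 2 * Hi.card) := by
    apply Finset.sum_lt_sum_of_nonempty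
    · exact Finset.univ_nonempty
    · intro o _
      exact oneS G k Lo Hi c hne (SS o)
  rw [Finset.sum_add_distrib, ← Finset.mul_sum, ← Finset.mul_sum, Finset.sum_const, nsmul_eq_mul,
    Finset.card_univ, Fintype.card_fun, Fintype.card_fin] at hS
  have hHi : ∑ o : V → Fin 5, ((Hi \ SS o).card : ℚ) = 5 ^ (Fintype.card V) * (4 / 5 * Hi.card) := by
    have h1 : ∀ o : V → Fin 5, ((Hi \ SS o).card : ℚ) =
        ∑ h ∈ Hi, (1 - (if {h} ⊆ SS o then (1 : ℚ) else 0)) := by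
      intro o
      have : Hi \ SS o = Hi.filter (fun h => ¬ ({h} ⊆ SS o)) := by
        ext z; simp
      rw [this, Finset.card_filter]
      push_cast
      apply Finset.sum_congr rfl
      intro h _
      split_ifs <;> simp_all
    simp_rw [h1]
    rw [Finset.sum_comm]
    have h2 : ∀ h : V, ∑ o : V → Fin 5, (1 - (if {h} ⊆ SS o then (1 : ℚ) else 0)) =
        5 ^ (Fintype.card V) * (4 / 5) := by
      intro h
      have h3 := count ({h} : Finset V)
      rw [← Finset.sum_boole] at h3
      rw [Finset.sum_sub_distrib, h3, Finset.sum_const, nsmul_eq_mul, Finset.card_univ,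
        Fintype.card_fun, Fintype.card_fin]
      push_cast
      simp only [Finset.card_singleton]
      ring
    rw [Finset.sum_congr rfl (fun h _ => h2 h), Finset.sum_const, nsmul_eq_mul]
    ring
  rw [hHi] at hS
  push_cast at hS
  have hN : (0 : ℚ) < 5 ^ (Fintype.card V) := by positivity
  have hk0 : (0 : ℚ) ≤ k := by positivity
  have havg' := mul_le_mul_of_nonneg_left havg hk0
  have hfin : (5 : ℚ) ^ (Fintype.card V) * (((k : ℚ) + 1) * (4 / 5 * Hi.card) +
      k * ∑ v ∈ Lo, (1 / 5 : ℚ) ^ (req G Hi v).card / cc G k Lo Hi v) <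
      5 ^ (Fintype.card V) * ((Lo.card : ℚ) + 2 * Hi.card) := by
    refine lt_of_le_of_lt ?_ hS
    have : (5 : ℚ) ^ (Fintype.card V) * (((k : ℚ) + 1) * (4 / 5 * Hi.card) +
      k * ∑ v ∈ Lo, (1 / 5 : ℚ) ^ (req G Hi v).card / cc G k Lo Hi v) =
      ((k : ℚ) + 1) * (5 ^ (Fintype.card V) * (4 / 5 * Hi.card)) +
      k * (5 ^ (Fintype.card V) * ∑ v ∈ Lo, (1 / 5 : ℚ) ^ (req G Hi v).card / cc G k Lo Hi v) := by
      ring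
    rw [this]
    linarith
  have hlt := lt_of_mul_lt_mul_left hfin hN.le
  rw [hdc] at hper
  have hH0 : (0 : ℚ) ≤ Hi.card := by positivity
  nlinarith [mul_nonneg (sub_nonneg.mpr hkq) hH0]

end
end OB

namespace OB
section
open scoped Classical

lemma main_col {V : Type*} [Fintype V] (G : SimpleGraph V) (k : ℕ) (hk : 9 ≤ k)
    (hdeg : ∀ x y, G.Adj x y → dg G Finset.univ x + dg G Finset.univ y ≤ 2 * k + 1)
    (hcl : ∀ Q : Finset V, Clf G Q → Q.card ≤ k) (L : V → Finset ℕ) (hL : ∀ v, (L v).card = k) :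
    LCol G L Finset.univ := by
  by_contra hcon
  obtain ⟨X, hX, hmin'⟩ := WellFounded.has_min (wellFounded_lt (α := Finset V))
    {X | ¬ LCol G L X} ⟨Finset.univ, hcon⟩
  have hmin : ∀ Y ⊂ X, LCol G L Y := by
    intro Y hY
    by_contra h
    exact hmin' Y h hY
  have hX : ¬ LCol G L X := hX
  have hlow : ∀ v ∈ X, k ≤ dg G X v := by
    intro v hv
    by_contra hlt
    apply hX
    apply extend G L (W := {v})
    · apply hmin
      refine ⟨Finset.sdiff_subset, fun h => ?_⟩
      exact (Finset.mem_sdiff.mp (h hv)).2 (by simp)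
    · intro L' hL'
      have h1 := hL' v (by simp)
      have h2 := dg_mono G (Finset.sdiff_subset (s := X) (t := {v})) v
      rw [hL] at h1
      obtain ⟨a, ha⟩ := Finset.card_pos.mp (show 0 < (L' v).card by omega)
      refine ⟨fun _ => a, by simpa using ha, ?_⟩
      intro x hx y hy hxy
      simp at hx hy
      subst hx; subst hy
      exact absurd hxy G.irrefl
  have hsum : ∀ x ∈ X, ∀ y ∈ X, G.Adj x y → dg G X x + dg G X y ≤ 2 * k + 1 := by
    intro x _ y _ h
    have h1 := dg_mono G (Finset.subset_univ X) x
    have h2 := dg_mono G (Finset.subset_univ X) y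
    have h3 := hdeg x y h
    omega
  have hhigh : ∀ v ∈ X, dg G X v ≤ k + 1 := by
    intro v hv
    have h1 := hlow v hv
    obtain ⟨u, hu⟩ := Finset.card_pos.mp (show 0 < (X.filter (fun u => G.Adj v u)).card from
      lt_of_lt_of_le (by omega) h1)
    rw [Finset.mem_filter] at hu
    have h2 := hsum v hv u hu.1 hu.2
    have h3 := hlow u hu.1
    omega
  set Lo := X.filter (fun v => dg G X v = k) with hLo
  set Hi := X.filter (fun v => dg G X v = k + 1) with hHi
  have hun : Lo ∪ Hi = X := by
    ext v
    simp only [hLo, hHi, Finset.mem_union, Finset.mem_filter]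
    constructor
    · rintro (h | h) <;> exact h.1
    · intro h
      have h1 := hlow v h
      have h2 := hhigh v h
      have : dg G X v = k ∨ dg G X v = k + 1 := by omega
      tauto
  have hdis : Disjoint Lo Hi := by
    rw [Finset.disjoint_left]
    intro v h1 h2
    rw [hLo, Finset.mem_filter] at h1
    rw [hHi, Finset.mem_filter] at h2
    omega
  have hsd : X \ Lo = Hi := by
    rw [← hun, Finset.union_sdiff_left]; exact Finset.sdiff_eq_self_of_disjoint hdis.symm
  have hsp : ∀ v, dg G X v = dg G Lo v + dg G Hi v := by
    intro v
    rw [dg_split G (Finset.filter_subset _ X : Lo ⊆ X) v, hsd]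
  have hHind : Ind G Hi := by
    intro x hx y hy hxy
    rw [hHi, Finset.mem_filter] at hx hy
    have := hsum x hx.1 y hy.1 hxy
    omega
  apply cfg_false G k Lo Hi ?_ ?_
  · refine ⟨hk, hdis, hHind, ?_, ?_, ?_, fun Q _ => hcl Q⟩
    · intro h hh
      have h1 := hsp h
      have : dg G Hi h = 0 := by
        unfold dg
        rw [Finset.card_eq_zero, Finset.filter_eq_empty_iff]
        intro z hz
        exact hHind h hh z hz
      have h2 := (Finset.mem_filter.mp hh).2
      omega
    · intro v hv
      have h1 := hsp v
      have h2 := (Finset.mem_filter.mp hv).2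
      omega
    · intro W hW hWn A hA hAi
      rw [hun] at hW
      have h1 := star G L X k hL hX hmin (fun v => 1 + if v ∈ Hi then 1 else 0) (by
        intro v hv
        split_ifs with h
        · have := (Finset.mem_filter.mp h).2
          omega
        · have h1 := hlow v hv
          have h2 := hhigh v hv
          have : dg G X v ≠ k + 1 := fun h3 => h (by rw [hHi, Finset.mem_filter]; exact ⟨hv, h3⟩)
          omega) W hW hWn A hA hAi
      rw [Finset.sum_add_distrib, Finset.sum_const, ← Finset.sum_filter, Finset.sum_const,
        Finset.filter_mem_eq_inter] at h1
      simpa using h1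
  · rw [hun]
    by_contra h
    rw [Finset.not_nonempty_iff_eq_empty] at h
    apply hX
    rw [h]
    exact ⟨fun _ => 0, by simp, by simp⟩

lemma dg_univ {V : Type*} [Fintype V] (G : SimpleGraph V) [DecidableRel G.Adj] (v : V) :
    dg G Finset.univ v = G.degree v := by
  unfold dg
  rw [← G.card_neighborFinset_eq_degree]
  congr 1
  ext z
  simp

end
end OB

/-- Every graph with at least one edge, `θ(G) ≥ 18` and `2·ω(G) ≤ θ(G)` is
`⌊θ(G)/2⌋`-choosable. -/
theorem ore_brooks_choosable {V : Type*} [Fintype V] [DecidableEq V]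
    (G : SimpleGraph V) [DecidableRel G.Adj]
    (hedge : G.edgeFinset.Nonempty)
    (hθ : 18 ≤ oreDeg G) (hω : 2 * G.cliqueNum ≤ oreDeg G) :
    Choosable G (fun _ => ((oreDeg G / 2 : ℕ) : ℤ)) := by
  intro L hL
  have hL' : ∀ v, (L v).card = oreDeg G / 2 := fun v => Int.ofNat_inj.mp (hL v)
  obtain ⟨c, h1, h2⟩ := OB.main_col G (oreDeg G / 2) (by omega) (by
    intro x y hxy
    rw [OB.dg_univ, OB.dg_univ]
    have h : (if G.Adj x y then G.degree x + G.degree y else 0) ≤ oreDeg G :=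
      Finset.le_sup (f := fun p : V × V =>
        if G.Adj p.1 p.2 then G.degree p.1 + G.degree p.2 else 0) (Finset.mem_univ (x, y))
    rw [if_pos hxy] at h
    omega) (by
    intro Q hQ
    have h : G.IsClique (Q : Set V) := fun x hx y hy hne => hQ x hx y hy hne
    have := h.card_le_cliqueNum
    omega) L hL'
  exact ⟨c, fun v => h1 v (Finset.mem_univ v), fun x y h =>
    h2 x (Finset.mem_univ x) y (Finset.mem_univ y) h⟩
end
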